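/- arXiv:1403.6666 — 2 statements merged into one kernel-verified Lean document; each statement's English description precedes it below -/
import Mathlib

section
/- Let d ≥ 2, let 0 < r₁ < r₂, and let r > 0 be such that the spherical shell A_{r₁,r₂} and the ball B_r have the same d-dimensional Lebesgue measure (equivalently r^d = r₂^d − r₁^d, so that r < r₂). Then there exists α₀ < 0 such that for all α < α₀ one has λ₁^α(B_r) < λ₁^α(A_{r₁,r₂}). In particular, the ball does not maximise the first Robin eigenvalue with negative boundary parameter among domains of given volume. -/
open MeasureTheory Metric Filter Asymptotics Real RealInnerProductSpace

noncomputable section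

abbrev Eu (d : ℕ) := EuclideanSpace ℝ (Fin d)

/-- The set of Rayleigh quotient values of nonzero Lipschitz test functions for the
Robin problem with boundary parameter `α` on `Ω ⊆ ℝ^d`. -/
def robinRayleighSet (d : ℕ) (α : ℝ) (Ω : Set (Eu d)) : Set ℝ :=
  { lam : ℝ | ∃ (u : Eu d → ℝ) (K : NNReal),
      LipschitzOnWith K u (closure Ω) ∧
      (∫ x in Ω, (u x) ^ 2) ≠ 0 ∧
      lam = ((∫ x in Ω, ‖fderiv ℝ u x‖ ^ 2)
              + α * ∫ x in frontier Ω, (u x) ^ 2 ∂(μH[(d : ℝ) - 1]))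
            / (∫ x in Ω, (u x) ^ 2) }

/-- The first Robin eigenvalue `λ₁^α(Ω)`, defined variationally. -/
def robinEig (d : ℕ) (α : ℝ) (Ω : Set (Eu d)) : ℝ :=
  sInf (robinRayleighSet d α Ω)

/-- The open spherical shell `A_{r₁,r₂} = {x ∈ ℝ^d : r₁ < |x| < r₂}`. -/
def shell (d : ℕ) (r₁ r₂ : ℝ) : Set (Eu d) :=
  {x : Eu d | r₁ < ‖x‖ ∧ ‖x‖ < r₂}

open scoped ENNReal NNReal in
theorem measure_isOpen_le_liminf_mul {X : Type*} [MetricSpace X] [CompactSpace X]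
    [MeasurableSpace X] [BorelSpace X] (μ ν : Measure X) [IsFiniteMeasure μ] [IsFiniteMeasure ν]
    (hμ : ∀ x y r, μ (ball x r) = μ (ball y r)) (hν : ∀ x y r, ν (ball x r) = ν (ball y r))
    (hν0 : ∀ x r, 0 < r → ν (ball x r) ≠ 0) (x₀ : X) {G : Set X} (hG : IsOpen G) :
    μ G ≤ liminf (fun n : ℕ => μ (ball x₀ (1 / (n + 1))) / ν (ball x₀ (1 / (n + 1)))) atTop
      * ν G := by
  set g : ℕ → ℝ≥0∞ := fun n => ν (ball x₀ (1 / ((n : ℝ) + 1))) with hg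
  set h : ℕ → ℝ≥0∞ := fun n => μ (ball x₀ (1 / ((n : ℝ) + 1))) with hh
  have hpos : ∀ n : ℕ, (0 : ℝ) < 1 / ((n : ℝ) + 1) := fun n => by positivity
  have hg0 : ∀ n, g n ≠ 0 := fun n => hν0 _ _ (hpos n)
  have hgt : ∀ n, g n ≠ ∞ := fun n => measure_ne_top _ _
  have hmeasS : ∀ n : ℕ, MeasurableSet {p : X × X | dist p.1 p.2 < 1 / ((n : ℝ) + 1)} :=
    fun n => (isOpen_lt continuous_dist continuous_const).measurableSet
  have hball : ∀ (n : ℕ) (x : X), Prod.mk x ⁻¹' {p : X × X | dist p.1 p.2 < 1 / ((n : ℝ) + 1)}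
      = ball x (1 / ((n : ℝ) + 1)) := by
    intro n x
    ext y
    simp [dist_comm]
  have hball' : ∀ (n : ℕ) (y : X),
      (fun x => (x, y)) ⁻¹' {p : X × X | dist p.1 p.2 < 1 / ((n : ℝ) + 1)}
      = ball y (1 / ((n : ℝ) + 1)) := by
    intro n x
    ext y
    simp
  have hmeas : ∀ n : ℕ,
      Measurable fun x => (ν.restrict G) (ball x (1 / ((n : ℝ) + 1))) / g n := by
    intro n
    refine Measurable.div_const ?_ _
    simpa only [hball] using measurable_measure_prodMk_left (ν := ν.restrict G) (hmeasS n)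
  calc μ G = ∫⁻ x in G, 1 ∂μ := by simp
    _ ≤ ∫⁻ x in G, liminf (fun n : ℕ =>
          (ν.restrict G) (ball x (1 / ((n : ℝ) + 1))) / g n) atTop ∂μ := by
        refine setLIntegral_mono' hG.measurableSet fun x hx => ?_
        refine le_liminf_of_le (by isBoundedDefault) ?_
        obtain ⟨ε, hε, hεG⟩ := Metric.isOpen_iff.1 hG x hx
        filter_upwards [tendsto_one_div_add_atTop_nhds_zero_nat.eventually (gt_mem_nhds hε)]
          with n hn
        have hsub : ball x (1 / ((n : ℝ) + 1)) ⊆ G := (ball_subset_ball hn.le).trans hεG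
        rw [Measure.restrict_eq_self _ hsub, hν x x₀, ENNReal.div_self (hg0 n) (hgt n)]
    _ ≤ liminf (fun n : ℕ => ∫⁻ x in G,
          (ν.restrict G) (ball x (1 / ((n : ℝ) + 1))) / g n ∂μ) atTop := lintegral_liminf_le hmeas
    _ ≤ liminf (fun n : ℕ => h n / g n * ν G) atTop := by
        refine liminf_le_liminf (Eventually.of_forall fun n => ?_)
        have hswap : ∫⁻ x in G, (ν.restrict G) (ball x (1 / ((n : ℝ) + 1))) ∂μ
            = ∫⁻ y in G, (μ.restrict G) (ball y (1 / ((n : ℝ) + 1))) ∂ν := by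
          have h1 := Measure.prod_apply (μ := μ.restrict G) (ν := ν.restrict G) (hmeasS n)
          have h2 := Measure.prod_apply_symm (μ := μ.restrict G) (ν := ν.restrict G) (hmeasS n)
          simp only [hball] at h1
          simp only [hball'] at h2
          rw [← h1, h2]
        simp only [div_eq_mul_inv (_ : ℝ≥0∞)]
        rw [lintegral_mul_const' _ _ (ENNReal.inv_ne_top.2 (hg0 n)), hswap]
        calc (∫⁻ y in G, (μ.restrict G) (ball y (1 / ((n : ℝ) + 1))) ∂ν) * (g n)⁻¹
            ≤ (∫⁻ y in G, h n ∂ν) * (g n)⁻¹ := by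
              gcongr with y
              exact (Measure.restrict_apply_le _ _).trans (hμ y x₀ _).le
          _ = h n * (g n)⁻¹ * ν G := by
              rw [setLIntegral_const]; ring
    _ = liminf (fun n : ℕ => h n / g n) atTop * ν G :=
        (ENNReal.liminf_mul_const_of_ne_top (measure_ne_top _ _)).trans (mul_comm _ _)

open scoped ENNReal NNReal in
theorem measure_ball_ne_zero_of_uniform {X : Type*} [MetricSpace X] [CompactSpace X]
    [MeasurableSpace X] [BorelSpace X] (μ : Measure X) (hμ0 : μ ≠ 0)
    (hμ : ∀ x y r, μ (ball x r) = μ (ball y r)) (x : X) {r : ℝ} (hr : 0 < r) :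
    μ (ball x r) ≠ 0 := by
  intro h0
  obtain ⟨t, -, ht, hcov⟩ := finite_cover_balls_of_compact (isCompact_univ (X := X)) hr
  refine hμ0 (Measure.measure_univ_eq_zero.1 (measure_mono_null hcov ?_))
  refine (measure_biUnion_null_iff ht.countable).2 fun y _ => ?_
  rw [hμ y x, h0]

/-- Two finite measures on a compact metric space for which balls of equal radii have equal
measures are proportional. -/
theorem exists_eq_smul_of_uniform {X : Type*} [MetricSpace X] [CompactSpace X]
    [MeasurableSpace X] [BorelSpace X] (μ ν : Measure X) [IsFiniteMeasure μ] [IsFiniteMeasure ν]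
    (hμ0 : μ ≠ 0) (hν0 : ν ≠ 0)
    (hμ : ∀ x y r, μ (ball x r) = μ (ball y r)) (hν : ∀ x y r, ν (ball x r) = ν (ball y r)) :
    ∃ c : NNReal, 0 < c ∧ μ = c • ν := by
  obtain ⟨x₀⟩ : Nonempty X := by
    by_contra h
    rw [not_nonempty_iff] at h
    exact hμ0 (Measure.eq_zero_of_isEmpty μ)
  set L := liminf (fun n : ℕ => μ (ball x₀ (1 / (n + 1))) / ν (ball x₀ (1 / (n + 1)))) atTop
  set L' := liminf (fun n : ℕ => ν (ball x₀ (1 / (n + 1))) / μ (ball x₀ (1 / (n + 1)))) atTop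
  have hμb := fun x r (hr : (0 : ℝ) < r) => measure_ball_ne_zero_of_uniform μ hμ0 hμ x hr
  have hνb := fun x r (hr : (0 : ℝ) < r) => measure_ball_ne_zero_of_uniform ν hν0 hν x hr
  have h1 : ∀ G, IsOpen G → μ G ≤ L * ν G := fun G hG =>
    measure_isOpen_le_liminf_mul μ ν hμ hν hνb x₀ hG
  have h2 : ∀ G, IsOpen G → ν G ≤ L' * μ G := fun G hG =>
    measure_isOpen_le_liminf_mul ν μ hν hμ hμb x₀ hG
  have hLL : L * L' ≤ 1 := by
    refine ENNReal.le_liminf_mul.trans ?_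
    refine (liminf_le_liminf (v := fun _ : ℕ => 1) (Eventually.of_forall fun n => ?_)).trans ?_
    · simp only [Pi.mul_apply, div_eq_mul_inv]
      have hp : (0 : ℝ) < 1 / ((n : ℝ) + 1) := by positivity
      set a := μ (ball x₀ (1 / ((n : ℝ) + 1)))
      set b := ν (ball x₀ (1 / ((n : ℝ) + 1)))
      calc a * b⁻¹ * (b * a⁻¹) = (a * a⁻¹) * (b * b⁻¹) := by ring
        _ ≤ 1 * 1 := by gcongr <;> exact ENNReal.mul_inv_le_one _
        _ = 1 := one_mul _
    · simp
  have hμu : μ Set.univ ≠ 0 := by simpa using hμ0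
  have hνu : ν Set.univ ≠ 0 := by simpa using hν0
  have hL0 : L ≠ 0 := fun h => hμu (by simpa [h] using h1 _ isOpen_univ)
  have hL0' : L' ≠ 0 := fun h => hνu (by simpa [h] using h2 _ isOpen_univ)
  have hLt : L ≠ ⊤ := fun h => by simp [h, hL0'] at hLL
  have key : ∀ G, IsOpen G → μ G = L * ν G := fun G hG => by
    refine (h1 G hG).antisymm ?_
    calc L * ν G ≤ L * (L' * μ G) := by gcongr; exact h2 G hG
      _ = (L * L') * μ G := by ring
      _ ≤ 1 * μ G := by gcongr
      _ = μ G := one_mul _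
  refine ⟨L.toNNReal, ENNReal.toNNReal_pos hL0 hLt, ?_⟩
  refine ext_of_generate_finite _ (BorelSpace.measurable_eq (α := X)) isPiSystem_isOpen ?_ ?_
  · intro G hG
    rw [key G hG, Measure.smul_apply, ENNReal.smul_def, ENNReal.coe_toNNReal hLt, smul_eq_mul]
  · rw [key _ isOpen_univ, Measure.smul_apply, ENNReal.smul_def, ENNReal.coe_toNNReal hLt, smul_eq_mul]

section SphereMeasure

variable {E : Type*} [NormedAddCommGroup E] [InnerProductSpace ℝ E]

theorem exists_linearIsometryEquiv_apply_eq (x y : sphere (0 : E) 1) :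
    ∃ e : E ≃ₗᵢ[ℝ] E, e x = y :=
  ⟨Submodule.reflection (ℝ ∙ ((x : E) - y))ᗮ, Submodule.reflection_sub (by simp)⟩

theorem image_coe_ball_sphere (e : E ≃ₗᵢ[ℝ] E) {x y : sphere (0 : E) 1} (h : e x = y) (r : ℝ) :
    e '' ((↑) '' ball x r) = ((↑) '' ball y r : Set E) := by
  rw [Subtype.image_ball, Subtype.image_ball, ← h]
  ext z
  constructor
  · rintro ⟨w, ⟨hw, hw'⟩, rfl⟩
    exact ⟨by simpa using hw, by simpa using hw'⟩
  · rintro ⟨hw, hw'⟩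
    refine ⟨e.symm z, ⟨?_, by simpa using hw'⟩, by simp⟩
    rw [mem_ball, ← e.dist_map]
    simpa using hw

variable [MeasurableSpace E] [BorelSpace E]

theorem hausdorffMeasure_sphere_ball_eq (s : ℝ) (hs : 0 ≤ s) (x y : sphere (0 : E) 1) (r : ℝ) :
    μH[s] (ball x r) = μH[s] (ball y r) := by
  obtain ⟨e, he⟩ := exists_linearIsometryEquiv_apply_eq x y
  have H : ∀ t : Set (sphere (0 : E) 1), μH[s] t = μH[s] (((↑) : _ → E) '' t) := fun t =>
    (isometry_subtype_coe.hausdorffMeasure_image (Or.inl hs) t).symm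
  rw [H, H, ← image_coe_ball_sphere e he]
  exact (e.toIsometryEquiv.hausdorffMeasure_image _ _).symm

variable [FiniteDimensional ℝ E]

theorem hausdorffMeasure_hemisphere_lt_top {n : ℕ} (hn : Module.finrank ℝ E = n + 1) (v : E)
    (hv : ‖v‖ = 1) : μH[(n : ℝ)] {x : E | ‖x‖ = 1 ∧ ⟪v, x⟫ ≤ 0} < ⊤ := by
  have : Fact (Module.finrank ℝ E = n + 1) := ⟨hn⟩
  have hv0 : v ≠ 0 := by rintro rfl; simp at hv
  have hF : Module.finrank ℝ (ℝ ∙ v)ᗮ = n := Submodule.finrank_orthogonal_span_singleton hv0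
  set f : (ℝ ∙ v)ᗮ → E := stereoInvFunAux v ∘ Subtype.val with hf
  have hfs : ContDiff ℝ 1 f :=
    contDiff_stereoInvFunAux.comp (ℝ ∙ v)ᗮ.subtypeL.contDiff
  obtain ⟨K, hK⟩ := (hfs.contDiffOn (s := closedBall 0 2)).exists_lipschitzOnWith
    (by decide) (convex_closedBall _ _) (isCompact_closedBall _ _)
  have hsub : {x : E | ‖x‖ = 1 ∧ ⟪v, x⟫ ≤ 0} ⊆ f '' closedBall 0 2 := by
    rintro x ⟨hx, hvx⟩
    have hxs : x ∈ sphere (0 : E) 1 := by simpa using hx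
    have hne : ((⟨x, hxs⟩ : sphere (0 : E) 1) : E) ≠ v := by
      rintro rfl
      simp [hx] at hvx
      linarith
    refine ⟨stereoToFun v x, ?_, ?_⟩
    · rw [mem_closedBall, dist_zero_right, stereoToFun_apply, norm_smul]
      have h1 : ‖(ℝ ∙ v)ᗮ.orthogonalProjectionOnto x‖ ≤ 1 :=
        (Submodule.norm_orthogonalProjectionOnto_apply_le _ _).trans hx.le
      have h2 : ‖2 / ((1 : ℝ) - ⟪v, x⟫)‖ ≤ 2 := by
        rw [norm_of_nonneg (by apply div_nonneg <;> linarith)]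
        rw [div_le_iff₀] <;> linarith
      exact (mul_le_mul h2 h1 (norm_nonneg _) zero_le_two).trans_eq (mul_one 2)
    · exact congrArg Subtype.val (stereo_left_inv hv hne)
  refine (measure_mono hsub).trans_lt ?_
  refine (hK.hausdorffMeasure_image_le (Nat.cast_nonneg n)).trans_lt ?_
  refine ENNReal.mul_lt_top (ENNReal.rpow_lt_top_of_nonneg (by positivity) (by simp)) ?_
  rw [← hF]
  exact (isCompact_closedBall _ _).measure_lt_top

theorem hausdorffMeasure_sphere_lt_top {n : ℕ} (hn : Module.finrank ℝ E = n + 1) :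
    μH[(n : ℝ)] (sphere (0 : E) 1) < ⊤ := by
  have : Nontrivial E := Module.nontrivial_of_finrank_pos (R := ℝ) (by omega)
  obtain ⟨v, hv⟩ := exists_norm_eq E (zero_le_one (α := ℝ))
  refine (measure_mono (t := {x : E | ‖x‖ = 1 ∧ ⟪v, x⟫ ≤ 0} ∪ {x : E | ‖x‖ = 1 ∧ ⟪-v, x⟫ ≤ 0})
    fun x hx => ?_).trans_lt (measure_union_lt_top (hausdorffMeasure_hemisphere_lt_top hn v hv)
      (hausdorffMeasure_hemisphere_lt_top hn (-v) (by simpa using hv)))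
  have hx' : ‖x‖ = 1 := by simpa using hx
  rcases le_total ⟪v, x⟫ 0 with h | h
  · exact Or.inl ⟨hx', h⟩
  · exact Or.inr ⟨hx', by simpa using h⟩

theorem hausdorffMeasure_sphere_pos {n : ℕ} (hn : Module.finrank ℝ E = n + 1) :
    0 < μH[(n : ℝ)] (sphere (0 : E) 1) := by
  have : Fact (Module.finrank ℝ E = n + 1) := ⟨hn⟩
  have : Nontrivial E := Module.nontrivial_of_finrank_pos (R := ℝ) (by omega)
  obtain ⟨v, hv⟩ := exists_norm_eq E (zero_le_one (α := ℝ))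
  have hv0 : v ≠ 0 := by rintro rfl; simp at hv
  have hF : Module.finrank ℝ (ℝ ∙ v)ᗮ = n := Submodule.finrank_orthogonal_span_singleton hv0
  have hsub : ball (0 : (ℝ ∙ v)ᗮ) 1 ⊆
      (ℝ ∙ v)ᗮ.orthogonalProjectionOnto '' (sphere (0 : E) 1) := by
    intro w hw
    have hw1 : ‖(w : E)‖ < 1 := by simpa using hw
    have hvw : ⟪(w : E), v⟫ = 0 := by
      rw [real_inner_comm]
      exact Submodule.mem_orthogonal_singleton_iff_inner_right.1 w.2
    refine ⟨w + √(1 - ‖(w : E)‖ ^ 2) • v, ?_, ?_⟩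
    · have h0 : 0 ≤ 1 - ‖(w : E)‖ ^ 2 := by nlinarith [norm_nonneg (w : E)]
      have : ‖(w : E) + √(1 - ‖(w : E)‖ ^ 2) • v‖ ^ 2 = 1 := by
        rw [norm_add_sq_real, inner_smul_right, hvw, norm_smul, hv, mul_one, norm_eq_abs, sq_abs,
          Real.sq_sqrt h0]
        ring
      rw [mem_sphere_zero_iff_norm]
      exact (pow_eq_one_iff_of_nonneg (norm_nonneg _) two_ne_zero).1 this
    · rw [map_add, map_smul, Submodule.orthogonalProjectionOnto_mem_subspace_eq_self]
      rw [Submodule.orthogonalProjectionOnto_orthogonalComplement_singleton_eq_zero]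
      simp
  have hpos : 0 < μH[(n : ℝ)] (ball (0 : (ℝ ∙ v)ᗮ) 1) := by
    rw [← hF]
    exact isOpen_ball.measure_pos _ ⟨0, by simp⟩
  calc 0 < μH[(n : ℝ)] (ball (0 : (ℝ ∙ v)ᗮ) 1) := hpos
    _ ≤ μH[(n : ℝ)] ((ℝ ∙ v)ᗮ.orthogonalProjectionOnto '' (sphere (0 : E) 1)) := measure_mono hsub
    _ ≤ μH[(n : ℝ)] (sphere (0 : E) 1) :=
      hausdorffMeasure_orthogonalProjectionOnto_le _ _ _ (Nat.cast_nonneg n)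

open scoped Pointwise in
theorem toSphere_ball_eq (x y : sphere (0 : E) 1) (r : ℝ) :
    (volume : Measure E).toSphere (ball x r) = (volume : Measure E).toSphere (ball y r) := by
  obtain ⟨e, he⟩ := exists_linearIsometryEquiv_apply_eq x y
  rw [Measure.toSphere_apply' _ measurableSet_ball, Measure.toSphere_apply' _ measurableSet_ball,
    ← image_coe_ball_sphere e he]
  have : Set.Ioo (0 : ℝ) 1 • (e '' ((↑) '' ball x r)) =
      e '' (Set.Ioo (0 : ℝ) 1 • ((↑) '' ball x r)) := by
    ext z
    simp only [Set.mem_smul, Set.mem_image]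
    constructor
    · rintro ⟨s, hs, _, ⟨w, hw, rfl⟩, rfl⟩
      exact ⟨s • w, ⟨s, hs, w, hw, rfl⟩, by simp⟩
    · rintro ⟨_, ⟨s, hs, w, hw, rfl⟩, rfl⟩
      exact ⟨s, hs, _, ⟨w, hw, rfl⟩, by simp⟩
  rw [this, LinearIsometryEquiv.image_eq_preimage_symm,
    e.symm.measurePreserving.measure_preimage_emb e.symm.toHomeomorph.measurableEmbedding]

/-- The Hausdorff measure on the unit sphere is a multiple of the surface measure. -/
theorem exists_hausdorffMeasure_sphere_eq_smul {n : ℕ} (hn : Module.finrank ℝ E = n + 1) :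
    ∃ c : NNReal, 0 < c ∧
      (μH[(n : ℝ)] : Measure (sphere (0 : E) 1)) = c • (volume : Measure E).toSphere := by
  have : Nontrivial E := Module.nontrivial_of_finrank_pos (R := ℝ) (by omega)
  have huniv : (μH[(n : ℝ)] : Measure (sphere (0 : E) 1)) Set.univ =
      μH[(n : ℝ)] (sphere (0 : E) 1) := by
    rw [← isometry_subtype_coe.hausdorffMeasure_image (Or.inl (Nat.cast_nonneg n)), Set.image_univ,
      Subtype.range_coe]
  have : IsFiniteMeasure (μH[(n : ℝ)] : Measure (sphere (0 : E) 1)) :=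
    ⟨huniv ▸ hausdorffMeasure_sphere_lt_top hn⟩
  refine exists_eq_smul_of_uniform _ _ ?_ (Measure.toSphere_ne_zero _)
    (hausdorffMeasure_sphere_ball_eq _ (Nat.cast_nonneg n)) toSphere_ball_eq
  intro h
  exact (hausdorffMeasure_sphere_pos hn).ne' (by rw [← huniv, h]; simp)

open scoped Pointwise in
/-- Integration over a sphere with respect to Hausdorff measure, in terms of the unit sphere. -/
theorem exists_integral_sphere_hausdorffMeasure {n : ℕ} (hn : Module.finrank ℝ E = n + 1) :
    ∃ c : ℝ, 0 < c ∧ ∀ (f : E → ℝ) (R : ℝ), 0 < R →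
      μH[(n : ℝ)] (sphere (0 : E) R) < ⊤ ∧
      ∫ x in sphere (0 : E) R, f x ∂(μH[(n : ℝ)]) =
        c * (R ^ n * ∫ θ : sphere (0 : E) 1, f (R • (θ : E)) ∂(volume : Measure E).toSphere) := by
  obtain ⟨c, hc, h⟩ := exists_hausdorffMeasure_sphere_eq_smul hn
  refine ⟨c, hc, fun f R hR => ?_⟩
  have hemb : MeasurableEmbedding (fun x : E => R • x) :=
    (Homeomorph.smulOfNeZero R hR.ne').measurableEmbedding
  have hmap : (μH[(n : ℝ)]).restrict (sphere (0 : E) R) =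
      (Real.toNNReal R ^ n) • Measure.map (fun θ : sphere (0 : E) 1 => R • (θ : E)) μH[(n : ℝ)] := by
    have h1 : Measure.map (fun θ : sphere (0 : E) 1 => R • (θ : E)) μH[(n : ℝ)] =
        Measure.map (fun x : E => R • x) ((μH[(n : ℝ)]).restrict (sphere (0 : E) 1)) := by
      have := isometry_subtype_coe.map_hausdorffMeasure (X := sphere (0 : E) 1)
        (d := (n : ℝ)) (Or.inl (Nat.cast_nonneg n))
      rw [Subtype.range_coe] at this
      rw [← this, Measure.map_map hemb.measurable measurable_subtype_coe]
      rfl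
    rw [h1]
    ext s hs
    rw [Measure.smul_apply, hemb.map_apply, Measure.restrict_apply hs,
      Measure.restrict_apply (hemb.measurable hs)]
    have h2 : s ∩ sphere (0 : E) R = R • ((fun x : E => R • x) ⁻¹' s ∩ sphere (0 : E) 1) := by
      ext z
      rw [Set.mem_smul_set_iff_inv_smul_mem₀ hR.ne']
      simp only [Set.mem_inter_iff, Set.mem_preimage, mem_sphere_zero_iff_norm, norm_smul, norm_inv,
        norm_of_nonneg hR.le, smul_inv_smul₀ hR.ne']
      refine and_congr_right fun _ => ?_
      rw [inv_mul_eq_one₀ hR.ne', eq_comm]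
    rw [h2, Measure.hausdorffMeasure_smul₀ (Nat.cast_nonneg n) hR.ne']
    congr 1
    rw [NNReal.rpow_natCast]
    congr 1
    ext
    simp [hR.le]
  refine ⟨?_, ?_⟩
  · have : sphere (0 : E) R = R • sphere (0 : E) 1 := by
      simp [smul_sphere' hR.ne', abs_of_pos hR]
    rw [this, Measure.hausdorffMeasure_smul₀ (Nat.cast_nonneg n) hR.ne']
    exact ENNReal.mul_lt_top (by simp) (hausdorffMeasure_sphere_lt_top hn)
  rw [hmap, integral_smul_nnreal_measure, MeasurableEmbedding.integral_map, h,
    integral_smul_nnreal_measure]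
  · simp only [NNReal.smul_def, NNReal.coe_pow, Real.coe_toNNReal _ hR.le, smul_eq_mul]
    ring
  · exact hemb.comp (MeasurableEmbedding.subtype_coe isClosed_sphere.measurableSet)

end SphereMeasure

section PolarCoordinates

variable {E : Type*} [NormedAddCommGroup E] [InnerProductSpace ℝ E] [FiniteDimensional ℝ E]
  [MeasurableSpace E] [BorelSpace E]

/-- The measure with density `s ^ n` on the half-line `(0, ∞)`. -/
def powMeasure (n : ℕ) : Measure ℝ :=
  (volume.restrict (Set.Ioi 0)).withDensity fun s => ENNReal.ofReal (s ^ n)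

theorem map_coe_volumeIoiPow (n : ℕ) :
    (Measure.volumeIoiPow n).map ((↑) : Set.Ioi (0 : ℝ) → ℝ) = powMeasure n := by
  ext s hs
  rw [Measure.map_apply measurable_subtype_coe hs, powMeasure, withDensity_apply _ hs,
    Measure.volumeIoiPow, withDensity_apply _ (measurable_subtype_coe hs),
    setLIntegral_subtype measurableSet_Ioi _ fun a : ℝ => ENNReal.ofReal (a ^ n),
    Measure.restrict_restrict hs, Subtype.image_preimage_coe, Set.inter_comm]

instance (n : ℕ) : SFinite (powMeasure n) := by
  unfold powMeasure
  infer_instance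

theorem measurePreserving_polar {n : ℕ} (hn : Module.finrank ℝ E = n + 1) :
    MeasurePreserving (fun p : sphere (0 : E) 1 × ℝ => p.2 • (p.1 : E))
      ((volume : Measure E).toSphere.prod (powMeasure n)) volume := by
  have : Nontrivial E := Module.nontrivial_of_finrank_pos (R := ℝ) (by omega)
  have hmeas : Measurable (fun p : sphere (0 : E) 1 × ℝ => p.2 • (p.1 : E)) := by fun_prop
  refine ⟨hmeas, ?_⟩
  have h1 := (volume : Measure E).measurePreserving_homeomorphUnitSphereProd
  rw [hn, Nat.add_sub_cancel] at h1
  have h2 : MeasurePreserving (Prod.map id ((↑) : Set.Ioi (0 : ℝ) → ℝ))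
      ((volume : Measure E).toSphere.prod (Measure.volumeIoiPow n))
      ((volume : Measure E).toSphere.prod (powMeasure n)) :=
    (MeasurePreserving.id _).prod ⟨measurable_subtype_coe, map_coe_volumeIoiPow n⟩
  have h3 := h2.comp h1
  rw [← h3.map_eq, Measure.map_map hmeas h3.measurable]
  have h4 : (fun p : sphere (0 : E) 1 × ℝ => p.2 • (p.1 : E)) ∘
      (Prod.map id ((↑) : Set.Ioi (0 : ℝ) → ℝ) ∘ homeomorphUnitSphereProd E) =
      ((↑) : ({0}ᶜ : Set E) → E) := by
    ext x
    have hx : ‖(x : E)‖ ≠ 0 := norm_ne_zero_iff.2 x.2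
    simp [smul_smul, hx]
  rw [h4, (MeasurableEmbedding.subtype_coe (measurableSet_singleton _).compl).map_comap,
    Subtype.range_coe, restrict_compl_singleton]

theorem ae_ae_polar {n : ℕ} (hn : Module.finrank ℝ E = n + 1) {P : E → Prop}
    (hP : ∀ᵐ x : E, P x) :
    ∀ᵐ θ : sphere (0 : E) 1 ∂(volume : Measure E).toSphere, ∀ᵐ s : ℝ, 0 < s →
      P (s • (θ : E)) := by
  have h1 := (measurePreserving_polar hn).quasiMeasurePreserving.ae hP
  filter_upwards [Measure.ae_ae_of_ae_prod h1] with θ hθ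
  rw [powMeasure, ae_withDensity_iff (by fun_prop), ae_restrict_iff' measurableSet_Ioi] at hθ
  filter_upwards [hθ] with s hs hs0
  exact hs hs0 (by simpa using pow_pos hs0 n)

theorem integral_powMeasure (n : ℕ) (f : ℝ → ℝ) :
    ∫ s, f s ∂(powMeasure n) = ∫ s in Set.Ioi 0, s ^ n * f s := by
  rw [powMeasure, integral_withDensity_eq_integral_toReal_smul (by fun_prop) (by simp)]
  refine setIntegral_congr_fun measurableSet_Ioi fun s hs => ?_
  simp [ENNReal.toReal_ofReal (pow_nonneg (le_of_lt hs) n)]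

theorem integrable_powMeasure {n : ℕ} {f : ℝ → ℝ} :
    Integrable f (powMeasure n) ↔ IntegrableOn (fun s => s ^ n * f s) (Set.Ioi 0) := by
  rw [powMeasure, integrable_withDensity_iff_integrable_smul' (by fun_prop) (by simp)]
  refine integrableOn_congr_fun (fun s hs => ?_) measurableSet_Ioi
  simp [ENNReal.toReal_ofReal (pow_nonneg (le_of_lt hs) n)]

theorem polar_shell {n : ℕ} (hn : Module.finrank ℝ E = n + 1) {a b : ℝ} (ha : 0 ≤ a)
    {F : E → ℝ} (hF : IntegrableOn F {x | a < ‖x‖ ∧ ‖x‖ < b}) :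
    (∀ᵐ θ : sphere (0 : E) 1 ∂(volume : Measure E).toSphere,
      IntegrableOn (fun s : ℝ => s ^ n * F (s • (θ : E))) (Set.Ioo a b)) ∧
    Integrable (fun θ : sphere (0 : E) 1 => ∫ s in Set.Ioo a b, s ^ n * F (s • (θ : E)))
      (volume : Measure E).toSphere ∧
    ∫ x in {x | a < ‖x‖ ∧ ‖x‖ < b}, F x =
      ∫ θ : sphere (0 : E) 1, (∫ s in Set.Ioo a b, s ^ n * F (s • (θ : E)))
        ∂(volume : Measure E).toSphere := by
  set S : Set E := {x | a < ‖x‖ ∧ ‖x‖ < b} with hS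
  have hSm : MeasurableSet S :=
    ((isOpen_lt continuous_const continuous_norm).inter
      (isOpen_lt continuous_norm continuous_const)).measurableSet
  have hmp := measurePreserving_polar (E := E) hn
  have hG : Integrable (S.indicator F) := (integrable_indicator_iff hSm).2 hF
  have hGc := (hmp.integrable_comp hG.aestronglyMeasurable).2 hG
  have hind : ∀ (θ : sphere (0 : E) 1), (Set.Ioi (0 : ℝ)).EqOn
      (fun s : ℝ => s ^ n * S.indicator F (s • (θ : E)))
      ((Set.Ioo a b).indicator fun s : ℝ => s ^ n * F (s • (θ : E))) := by
    intro θ s hs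
    have hns : ‖s • (θ : E)‖ = s := by simp [norm_smul, abs_of_pos (Set.mem_Ioi.1 hs)]
    by_cases h : s ∈ Set.Ioo a b
    · have : s • (θ : E) ∈ S := by simpa [hS, hns] using h
      simp [h, this]
    · have : s • (θ : E) ∉ S := by simpa [hS, hns] using h
      simp [h, this]
  have hsub : Set.Ioo a b ∩ Set.Ioi 0 = Set.Ioo a b :=
    Set.inter_eq_left.2 fun s hs => ha.trans_lt hs.1
  have hinteg : ∀ θ : sphere (0 : E) 1, ∫ s, S.indicator F (s • (θ : E)) ∂(powMeasure n) =
      ∫ s in Set.Ioo a b, s ^ n * F (s • (θ : E)) := by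
    intro θ
    rw [integral_powMeasure, setIntegral_congr_fun measurableSet_Ioi (hind θ),
      integral_indicator measurableSet_Ioo, Measure.restrict_restrict measurableSet_Ioo, hsub]
  refine ⟨?_, ?_, ?_⟩
  · filter_upwards [hGc.prod_right_ae] with θ hθ
    have h1 := integrable_powMeasure.1 hθ
    simp only [Function.comp_def] at h1
    rw [integrableOn_congr_fun (hind θ) measurableSet_Ioi, IntegrableOn,
      integrable_indicator_iff measurableSet_Ioo, IntegrableOn,
      Measure.restrict_restrict measurableSet_Ioo, hsub] at h1
    exact h1
  · simpa only [Function.comp_def, hinteg] using hGc.integral_prod_left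
  · have h1 := integral_map hmp.measurable.aemeasurable
      (hmp.map_eq.symm ▸ hG.aestronglyMeasurable)
    rw [hmp.map_eq] at h1
    rw [← integral_indicator hSm, h1]
    simpa only [Function.comp_def, hinteg] using integral_prod _ hGc

end PolarCoordinates

theorem boundary_sub_le_integral {a b : ℝ} (hab : a < b) {v w G : ℝ → ℝ} {K : NNReal}
    (hv : LipschitzOnWith K v (Set.Icc a b)) (hw : ContDiff ℝ 1 w)
    (hG : IntegrableOn G (Set.Ioo a b))
    (hle : ∀ᵐ s : ℝ, s ∈ Set.Ioo a b →
      deriv w s * v s ^ 2 + w s * (2 * v s * deriv v s) ≤ G s) :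
    w b * v b ^ 2 - w a * v a ^ 2 ≤ ∫ s in Set.Ioo a b, G s := by
  have hvac : AbsolutelyContinuousOnInterval v a b := by
    rw [← Set.uIcc_of_le hab.le] at hv
    exact hv.absolutelyContinuousOnInterval
  have hwac : AbsolutelyContinuousOnInterval w a b := hw.contDiffOn.absolutelyContinuousOnInterval
  have hf := hwac.fun_mul (hvac.fun_mul hvac)
  have h1 := hf.integral_deriv_eq_sub
  have h2 := hf.intervalIntegrable_deriv
  rw [intervalIntegrable_iff_integrableOn_Ioo_of_le hab.le] at h2
  rw [intervalIntegral.integral_of_le hab.le, integral_Ioc_eq_integral_Ioo] at h1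
  calc w b * v b ^ 2 - w a * v a ^ 2 = w b * (v b * v b) - w a * (v a * v a) := by ring
    _ = ∫ s in Set.Ioo a b, deriv (fun x => w x * (v x * v x)) s := h1.symm
    _ ≤ ∫ s in Set.Ioo a b, G s := by
      refine integral_mono_ae h2 hG ?_
      rw [EventuallyLE, ae_restrict_iff' measurableSet_Ioo]
      filter_upwards [hle, hvac.ae_differentiableAt] with s hs hd hmem
      have hd' := (hd (by rw [Set.uIcc_of_le hab.le]; exact Set.Ioo_subset_Icc_self hmem)).hasDerivAt
      have hw' := ((hw.differentiable (by decide)) s).hasDerivAt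
      refine le_of_eq_of_le ?_ (hs hmem)
      rw [(hw'.fun_mul (hd'.fun_mul hd')).deriv]
      ring

section NormShell

variable {E : Type*} [NormedAddCommGroup E]

theorem isOpen_normShell (a b : ℝ) : IsOpen {x : E | a < ‖x‖ ∧ ‖x‖ < b} :=
  (isOpen_lt continuous_const continuous_norm).inter (isOpen_lt continuous_norm continuous_const)

theorem isCompact_closedNormShell [ProperSpace E] (a b : ℝ) :
    IsCompact {x : E | a ≤ ‖x‖ ∧ ‖x‖ ≤ b} := by
  refine (isCompact_closedBall (0 : E) b).of_isClosed_subset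
    ((isClosed_le continuous_const continuous_norm).inter
      (isClosed_le continuous_norm continuous_const)) fun x hx => by simpa using hx.2

theorem normShell_subset (a b : ℝ) :
    {x : E | a < ‖x‖ ∧ ‖x‖ < b} ⊆ {x : E | a ≤ ‖x‖ ∧ ‖x‖ ≤ b} :=
  fun _ hx => ⟨hx.1.le, hx.2.le⟩

variable [NormedSpace ℝ E]

theorem closure_normShell {a b : ℝ} (ha : 0 < a) (hab : a < b) :
    closure {x : E | a < ‖x‖ ∧ ‖x‖ < b} = {x : E | a ≤ ‖x‖ ∧ ‖x‖ ≤ b} := by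
  refine Set.Subset.antisymm (closure_minimal (normShell_subset a b)
    ((isClosed_le continuous_const continuous_norm).inter
      (isClosed_le continuous_norm continuous_const))) fun x ⟨hx1, hx2⟩ => ?_
  have hx0 : 0 < ‖x‖ := ha.trans_le hx1
  have hlim : Tendsto (fun t : ℝ => (1 + t * ((a + b) / 2 / ‖x‖ - 1)) • x)
      (nhdsWithin 0 (Set.Ioi 0)) (nhds x) := by
    have : Continuous fun t : ℝ => (1 + t * ((a + b) / 2 / ‖x‖ - 1)) • x := by fun_prop
    simpa using (this.tendsto 0).mono_left nhdsWithin_le_nhds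
  refine mem_closure_of_tendsto hlim ?_
  filter_upwards [Ioo_mem_nhdsGT (zero_lt_one' ℝ)] with t ht
  have hval : (1 + t * ((a + b) / 2 / ‖x‖ - 1)) * ‖x‖ = (1 - t) * ‖x‖ + t * ((a + b) / 2) := by
    field_simp
    ring
  have h1 : 0 ≤ 1 - t := by linarith [ht.2]
  have hpos : 0 ≤ (1 + t * ((a + b) / 2 / ‖x‖ - 1)) := by
    have : 0 ≤ (a + b) / 2 / ‖x‖ := by
      have := ha.trans hab
      positivity
    nlinarith [ht.1, ht.2, mul_nonneg ht.1.le this]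
  rw [norm_smul, norm_of_nonneg hpos, hval]
  constructor <;> nlinarith [ht.1, ht.2]

theorem frontier_normShell {a b : ℝ} (ha : 0 < a) (hab : a < b) :
    frontier {x : E | a < ‖x‖ ∧ ‖x‖ < b} = sphere 0 a ∪ sphere 0 b := by
  rw [(isOpen_normShell a b).frontier_eq, closure_normShell ha hab]
  ext x
  simp only [Set.mem_sdiff, Set.mem_ofPred_eq, Set.mem_union, mem_sphere_zero_iff_norm]
  grind

end NormShell

section ShellInequality

variable {E : Type*} [NormedAddCommGroup E] [InnerProductSpace ℝ E] [FiniteDimensional ℝ E]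
  [MeasurableSpace E] [BorelSpace E]

theorem integrableOn_sq_of_lipschitzOnWith {a b : ℝ} {u : E → ℝ} {K : NNReal}
    (hu : LipschitzOnWith K u {x | a ≤ ‖x‖ ∧ ‖x‖ ≤ b}) :
    IntegrableOn (fun x => u x ^ 2) {x : E | a < ‖x‖ ∧ ‖x‖ < b} :=
  ((hu.continuousOn.pow 2).integrableOn_compact (isCompact_closedNormShell a b)).mono_set
    (normShell_subset a b)

theorem integrableOn_norm_fderiv_sq_of_lipschitzOnWith {s : Set E} (hs : IsOpen s)
    (hs' : volume s ≠ ⊤) {u : E → ℝ} {K : NNReal} (hu : LipschitzOnWith K u s) :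
    IntegrableOn (fun x => ‖fderiv ℝ u x‖ ^ 2) s := by
  refine Measure.integrableOn_of_bounded (M := (K : ℝ) ^ 2) hs'
    ((measurable_fderiv ℝ u).norm.pow_const 2).aestronglyMeasurable ?_
  rw [ae_restrict_iff' hs.measurableSet]
  refine Eventually.of_forall fun x hx => ?_
  rw [norm_of_nonneg (by positivity)]
  gcongr
  exact norm_fderiv_le_of_lipschitzOn ℝ (hs.mem_nhds hx) hu

theorem volume_normShell_ne_top (a b : ℝ) : volume {x : E | a < ‖x‖ ∧ ‖x‖ < b} ≠ ⊤ :=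
  ((measure_mono (normShell_subset a b)).trans_lt
    (isCompact_closedNormShell a b).measure_lt_top).ne

/-- A Robin-type inequality on shells, obtained from a radial vector field `φ` whose
Riccati expression is bounded by `Λ`. -/
theorem shell_boundary_le {n : ℕ} (hn : Module.finrank ℝ E = n + 1) {a b : ℝ} (ha : 0 ≤ a)
    (hab : a < b) {φ : ℝ → ℝ} (hφ : ContDiff ℝ 1 φ) {Λ : ℝ}
    (hΛ : ∀ s ∈ Set.Ioo a b, deriv φ s + n * φ s / s + φ s ^ 2 ≤ Λ) {u : E → ℝ} {K : NNReal}
    (hu : LipschitzOnWith K u {x | a ≤ ‖x‖ ∧ ‖x‖ ≤ b}) :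
    φ b * (b ^ n * ∫ θ : sphere (0 : E) 1, u (b • (θ : E)) ^ 2 ∂(volume : Measure E).toSphere) -
      φ a * (a ^ n * ∫ θ : sphere (0 : E) 1, u (a • (θ : E)) ^ 2 ∂(volume : Measure E).toSphere)
    ≤ (∫ x in {x : E | a < ‖x‖ ∧ ‖x‖ < b}, ‖fderiv ℝ u x‖ ^ 2) +
      Λ * ∫ x in {x : E | a < ‖x‖ ∧ ‖x‖ < b}, u x ^ 2 := by
  set S : Set E := {x | a < ‖x‖ ∧ ‖x‖ < b} with hS
  have hSo : IsOpen S := isOpen_normShell a b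
  have hI1 : IntegrableOn (fun x => ‖fderiv ℝ u x‖ ^ 2) S :=
    integrableOn_norm_fderiv_sq_of_lipschitzOnWith hSo (volume_normShell_ne_top a b)
      (hu.mono (normShell_subset a b))
  have hI2 : IntegrableOn (fun x => u x ^ 2) S := integrableOn_sq_of_lipschitzOnWith hu
  have hF : IntegrableOn (fun x => ‖fderiv ℝ u x‖ ^ 2 + Λ * u x ^ 2) S :=
    hI1.add (hI2.const_mul Λ)
  obtain ⟨hae, hinteg, heq⟩ := polar_shell hn ha hF
  have hR : (∫ x in S, ‖fderiv ℝ u x‖ ^ 2) + Λ * ∫ x in S, u x ^ 2 =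
      ∫ x in S, (‖fderiv ℝ u x‖ ^ 2 + Λ * u x ^ 2) := by
    rw [integral_add hI1 (hI2.const_mul Λ), integral_const_mul]
  rw [hR, heq]
  have hnorm : ∀ (θ : sphere (0 : E) 1) {s : ℝ}, 0 ≤ s → ‖s • (θ : E)‖ = s := by
    intro θ s hs
    simp [norm_smul, abs_of_nonneg hs]
  have hcont : ∀ s ∈ Set.Icc a b, Integrable (fun θ : sphere (0 : E) 1 => u (s • (θ : E)) ^ 2)
      (volume : Measure E).toSphere := by
    intro s hs
    refine Continuous.integrable_of_hasCompactSupport ?_ (HasCompactSupport.of_compactSpace _)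
    refine Continuous.pow ?_ 2
    refine hu.continuousOn.comp_continuous (by fun_prop) fun θ => ?_
    rw [Set.mem_ofPred_eq, hnorm θ (ha.trans hs.1)]
    exact hs
  rw [← integral_const_mul, ← integral_const_mul, ← integral_const_mul, ← integral_const_mul,
    ← integral_sub]
  rotate_left
  · exact ((hcont b ⟨hab.le, le_rfl⟩).const_mul _).const_mul _
  · exact ((hcont a ⟨le_rfl, hab.le⟩).const_mul _).const_mul _
  refine integral_mono_ae (Integrable.sub (((hcont b ⟨hab.le, le_rfl⟩).const_mul _).const_mul _)
    (((hcont a ⟨le_rfl, hab.le⟩).const_mul _).const_mul _)) hinteg ?_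
  have hdiff : ∀ᵐ x : E, x ∈ S → DifferentiableAt ℝ u x := by
    filter_upwards [(hu.mono (normShell_subset a b)).ae_differentiableWithinAt_of_mem
      (μ := volume)] with x hx hxS
    exact (hx hxS).differentiableAt (hSo.mem_nhds hxS)
  filter_upwards [hae, ae_ae_polar hn hdiff] with θ hθ hθd
  have hw : ContDiff ℝ 1 fun s : ℝ => φ s * s ^ n := hφ.mul (contDiff_id.pow n)
  have hv : LipschitzOnWith K (fun s : ℝ => u (s • (θ : E))) (Set.Icc a b) := by
    refine LipschitzOnWith.of_dist_le_mul fun s hs t ht => ?_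
    have hm : ∀ r ∈ Set.Icc a b, r • (θ : E) ∈ {x : E | a ≤ ‖x‖ ∧ ‖x‖ ≤ b} := fun r hr => by
      rw [Set.mem_ofPred_eq, hnorm θ (ha.trans hr.1)]
      exact hr
    refine (hu.dist_le_mul _ (hm s hs) _ (hm t ht)).trans_eq ?_
    rw [dist_eq_norm, ← sub_smul, norm_smul]
    simp [dist_eq_norm]
  have key := boundary_sub_le_integral hab hv hw hθ ?_
  · refine le_of_eq_of_le ?_ key
    ring
  filter_upwards [hθd] with s hs hmem
  have hs0 : 0 < s := ha.trans_lt hmem.1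
  have hsS : s • (θ : E) ∈ S := by
    rw [hS, Set.mem_ofPred_eq, hnorm θ hs0.le]
    exact hmem
  have hud := (hs hs0 hsS).hasFDerivAt
  have hline : HasDerivAt (fun s : ℝ => s • (θ : E)) (θ : E) s := by
    simpa using (hasDerivAt_id s).smul_const (θ : E)
  have hdv : HasDerivAt (fun s : ℝ => u (s • (θ : E))) (fderiv ℝ u (s • (θ : E)) θ) s :=
    hud.comp_hasDerivAt s hline
  have hφd := ((hφ.differentiable (by decide)) s).hasDerivAt
  rw [hdv.deriv, (hφd.fun_mul (hasDerivAt_pow n s)).deriv]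
  have hle : (fderiv ℝ u (s • (θ : E)) θ) ^ 2 ≤ ‖fderiv ℝ u (s • (θ : E))‖ ^ 2 := by
    have := (fderiv ℝ u (s • (θ : E))).le_opNorm (θ : E)
    rw [norm_eq_of_mem_sphere, mul_one] at this
    rw [← sq_abs]
    gcongr
    exact this
  set p := fderiv ℝ u (s • (θ : E)) θ
  set q := ‖fderiv ℝ u (s • (θ : E))‖
  set y := u (s • (θ : E))
  have hpow : (n : ℝ) * s ^ (n - 1) = s ^ n * (n / s) := by
    rcases n with _ | m
    · simp
    · rw [Nat.add_sub_cancel, pow_succ]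
      field_simp
  have hpos : 0 ≤ s ^ n := by positivity
  have h1 : (deriv φ s + n * φ s / s + φ s ^ 2) * y ^ 2 ≤ Λ * y ^ 2 := by
    gcongr
    exact hΛ s hmem
  rw [hpow]
  calc (deriv φ s * s ^ n + φ s * (s ^ n * (n / s))) * y ^ 2 + φ s * s ^ n * (2 * y * p)
      = s ^ n * ((deriv φ s + n * φ s / s) * y ^ 2 + 2 * (φ s * y) * p) := by ring
    _ ≤ s ^ n * (q ^ 2 + Λ * y ^ 2) := by
      refine mul_le_mul_of_nonneg_left ?_ hpos
      nlinarith [sq_nonneg (φ s * y - p)]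

end ShellInequality

section Robin

variable {n : ℕ}

theorem mem_robinRayleighSet_succ {α lam : ℝ} {Ω : Set (Eu (n + 1))} :
    lam ∈ robinRayleighSet (n + 1) α Ω ↔ ∃ (u : Eu (n + 1) → ℝ) (K : NNReal),
      LipschitzOnWith K u (closure Ω) ∧ (∫ x in Ω, (u x) ^ 2) ≠ 0 ∧
      lam = ((∫ x in Ω, ‖fderiv ℝ u x‖ ^ 2) +
        α * ∫ x in frontier Ω, (u x) ^ 2 ∂(μH[(n : ℝ)])) / (∫ x in Ω, (u x) ^ 2) := by
  rw [robinRayleighSet, Set.mem_ofPred_eq, Nat.cast_add_one, add_sub_cancel_right]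

theorem robinRayleighSet_nonempty {α : ℝ} {Ω : Set (Eu (n + 1))} (h0 : volume Ω ≠ 0)
    (htop : volume Ω ≠ ⊤) : (robinRayleighSet (n + 1) α Ω).Nonempty := by
  refine ⟨_, fun _ => 1, 0, (LipschitzWith.const 1).lipschitzOnWith, ?_, rfl⟩
  simp [Measure.real, ENNReal.toReal_eq_zero_iff, h0, htop]

theorem ball_ae_eq_normShell (r : ℝ) :
    ball (0 : Eu (n + 1)) r =ᵐ[volume] {x : Eu (n + 1) | 0 < ‖x‖ ∧ ‖x‖ < r} := by
  refine eventuallyEq_set.mpr ?_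
  filter_upwards [compl_mem_ae_iff.mpr (measure_singleton (0 : Eu (n + 1)))] with x hx
  have : 0 < ‖x‖ := norm_pos_iff.mpr hx
  simp [this]

theorem le_of_mem_robinRayleighSet_ball {α c r Λ : ℝ} (hr : 0 < r)
    (hc : ∀ (f : Eu (n + 1) → ℝ) (R : ℝ), 0 < R → μH[(n : ℝ)] (sphere (0 : Eu (n + 1)) R) < ⊤ ∧
      ∫ x in sphere (0 : Eu (n + 1)) R, f x ∂μH[(n : ℝ)] =
        c * (R ^ n * ∫ θ : sphere (0 : Eu (n + 1)) 1, f (R • (θ : Eu (n + 1)))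
          ∂(volume : Measure (Eu (n + 1))).toSphere))
    {φ : ℝ → ℝ} (hφ : ContDiff ℝ 1 φ)
    (hΛ : ∀ s ∈ Set.Ioo 0 r, deriv φ s + n * φ s / s + φ s ^ 2 ≤ Λ)
    (hφ0 : φ 0 = 0) (hφr : φ r = -(α * c)) {lam : ℝ}
    (hlam : lam ∈ robinRayleighSet (n + 1) α (ball 0 r)) : -Λ ≤ lam := by
  obtain ⟨u, K, hu, hI, rfl⟩ := mem_robinRayleighSet_succ.mp hlam
  have hI0 : 0 < ∫ x in ball (0 : Eu (n + 1)) r, u x ^ 2 :=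
    lt_of_le_of_ne (integral_nonneg fun x => sq_nonneg _) hI.symm
  rw [closure_ball _ hr.ne'] at hu
  have hu' : LipschitzOnWith K u {x | 0 ≤ ‖x‖ ∧ ‖x‖ ≤ r} := hu.mono fun x hx => by simpa using hx.2
  have key := shell_boundary_le (E := Eu (n + 1)) (n := n) (by simp) le_rfl hr hφ hΛ hu'
  rw [← setIntegral_congr_set (ball_ae_eq_normShell r),
    ← setIntegral_congr_set (ball_ae_eq_normShell r), hφ0, hφr] at key
  rw [le_div_iff₀ hI0, frontier_ball _ hr.ne', (hc _ r hr).2]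
  linarith

theorem le_of_mem_robinRayleighSet_shell {α c a b Λ : ℝ} (ha : 0 < a) (hab : a < b)
    (hc : ∀ (f : Eu (n + 1) → ℝ) (R : ℝ), 0 < R → μH[(n : ℝ)] (sphere (0 : Eu (n + 1)) R) < ⊤ ∧
      ∫ x in sphere (0 : Eu (n + 1)) R, f x ∂μH[(n : ℝ)] =
        c * (R ^ n * ∫ θ : sphere (0 : Eu (n + 1)) 1, f (R • (θ : Eu (n + 1)))
          ∂(volume : Measure (Eu (n + 1))).toSphere))
    {φ : ℝ → ℝ} (hφ : ContDiff ℝ 1 φ)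
    (hΛ : ∀ s ∈ Set.Ioo a b, deriv φ s + n * φ s / s + φ s ^ 2 ≤ Λ)
    (hφa : φ a = α * c) (hφb : φ b = -(α * c)) {lam : ℝ}
    (hlam : lam ∈ robinRayleighSet (n + 1) α (shell (n + 1) a b)) : -Λ ≤ lam := by
  obtain ⟨u, K, hu, hI, rfl⟩ := mem_robinRayleighSet_succ.mp hlam
  have hI0 : 0 < ∫ x in shell (n + 1) a b, u x ^ 2 :=
    lt_of_le_of_ne (integral_nonneg fun x => sq_nonneg _) hI.symm
  rw [shell, closure_normShell ha hab] at hu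
  have key := shell_boundary_le (E := Eu (n + 1)) (n := n) (by simp) ha.le hab hφ hΛ hu
  have hinteg : ∀ R ∈ Set.Icc a b,
      IntegrableOn (fun x => u x ^ 2) (sphere (0 : Eu (n + 1)) R) μH[(n : ℝ)] := fun R hR => by
    refine ContinuousOn.integrableOn_of_subset_isCompact (K := sphere (0 : Eu (n + 1)) R)
      ((hu.continuousOn.pow 2).mono fun x hx => ?_) (isCompact_sphere _ _)
      isClosed_sphere.measurableSet le_rfl (hc (fun _ => 0) R (ha.trans_le hR.1)).1.ne
    rw [mem_sphere_zero_iff_norm] at hx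
    rw [Set.mem_ofPred_eq, hx]
    exact hR
  have hdisj : Disjoint (sphere (0 : Eu (n + 1)) a) (sphere 0 b) :=
    Set.disjoint_left.mpr fun x hx hx' => by
      rw [mem_sphere_zero_iff_norm] at hx hx'
      exact hab.ne (hx.symm.trans hx')
  rw [hφa, hφb] at key
  rw [le_div_iff₀ hI0, shell, frontier_normShell ha hab,
    setIntegral_union hdisj isClosed_sphere.measurableSet (hinteg a ⟨le_rfl, hab.le⟩)
      (hinteg b ⟨hab.le, le_rfl⟩), (hc _ a ha).2, (hc _ b (ha.trans hab)).2]
  linarith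

theorem norm_fderiv_exp_mul_norm_le {A : ℝ} (hA : 0 < A) {E : Type*} [NormedAddCommGroup E]
    [NormedSpace ℝ E] (x : E) : ‖fderiv ℝ (fun x : E => exp (A * ‖x‖)) x‖ ≤ A * exp (A * ‖x‖) := by
  by_cases hd : DifferentiableAt ℝ (fun x : E => exp (A * ‖x‖)) x
  · have hn : DifferentiableAt ℝ (fun x : E => ‖x‖) x := by
      have h := (hd.log (exp_pos _).ne').const_mul A⁻¹
      refine h.congr_of_eventuallyEq (Eventually.of_forall fun y => ?_)
      simp [hA.ne']
    have h1 : ‖fderiv ℝ (fun x : E => ‖x‖) x‖ ≤ 1 := by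
      simpa using norm_fderiv_le_of_lipschitz ℝ (lipschitzWith_one_norm (E := E)) (x₀ := x)
    rw [((hn.hasFDerivAt.const_mul A).exp).fderiv, norm_smul, norm_smul, norm_of_nonneg hA.le,
      norm_of_nonneg (exp_pos _).le]
    nlinarith [mul_pos hA (exp_pos (A * ‖x‖))]
  · rw [fderiv_zero_of_not_differentiableAt hd, norm_zero]
    positivity

theorem add_div_mul_integral_pow_mul_exp_le (hn1 : 1 ≤ n) {A r : ℝ} (hr : 0 < r) :
    (2 * A + n / r) * ∫ s in Set.Ioo 0 r, s ^ n * exp (2 * A * s) ≤ r ^ n * exp (2 * A * r) := by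
  have hderiv : ∀ s : ℝ, HasDerivAt (fun s => s ^ n * exp (2 * A * s))
      (n * s ^ (n - 1) * exp (2 * A * s) + s ^ n * (exp (2 * A * s) * (2 * A))) s := fun s =>
    (hasDerivAt_pow n s).mul (by simpa using ((hasDerivAt_id s).const_mul (2 * A)).exp)
  have hftc := intervalIntegral.integral_eq_sub_of_hasDerivAt (a := 0) (b := r)
    (fun s _ => hderiv s) (Continuous.intervalIntegrable (by fun_prop) _ _)
  rw [zero_pow (by omega), zero_mul, sub_zero] at hftc
  rw [← hftc, ← integral_Ioc_eq_integral_Ioo, ← intervalIntegral.integral_of_le hr.le,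
    ← intervalIntegral.integral_const_mul]
  refine intervalIntegral.integral_mono_on hr.le
    (Continuous.intervalIntegrable (by fun_prop) _ _)
    (Continuous.intervalIntegrable (by fun_prop) _ _) fun s hs => ?_
  obtain ⟨m, rfl⟩ : ∃ m, n = m + 1 := ⟨n - 1, by omega⟩
  have hle : s / r ≤ 1 := (div_le_one hr).mpr hs.2
  have hpos : 0 ≤ ((m + 1 : ℕ) : ℝ) * s ^ m * exp (2 * A * s) := by
    have := hs.1
    positivity
  have := mul_le_mul_of_nonneg_left hle hpos
  rw [Nat.add_sub_cancel]
  calc _ = ((m + 1 : ℕ) : ℝ) * s ^ m * exp (2 * A * s) * (s / r) +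
        s ^ (m + 1) * (exp (2 * A * s) * (2 * A)) := by ring
    _ ≤ _ := by linarith

theorem exists_mem_robinRayleighSet_ball_le (hn1 : 1 ≤ n) {α c r A : ℝ} (hr : 0 < r) (hA : 0 < A)
    (hc : ∀ (f : Eu (n + 1) → ℝ) (R : ℝ), 0 < R → μH[(n : ℝ)] (sphere (0 : Eu (n + 1)) R) < ⊤ ∧
      ∫ x in sphere (0 : Eu (n + 1)) R, f x ∂μH[(n : ℝ)] =
        c * (R ^ n * ∫ θ : sphere (0 : Eu (n + 1)) 1, f (R • (θ : Eu (n + 1)))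
          ∂(volume : Measure (Eu (n + 1))).toSphere))
    (hαA : A = -(α * c)) :
    ∃ lam ∈ robinRayleighSet (n + 1) α (ball 0 r), lam ≤ -(A ^ 2 + n * A / r) := by
  set u : Eu (n + 1) → ℝ := fun x => exp (A * ‖x‖) with hu
  have hcont : Continuous u := by fun_prop
  obtain ⟨K, hK⟩ : ∃ K, LipschitzOnWith K u (closedBall 0 r) := by
    have h1 : LipschitzOnWith (Real.toNNReal (exp (A * r))) exp (Set.Iic (A * r)) := by
      refine Convex.lipschitzOnWith_of_nnnorm_deriv_le (fun x _ => differentiableAt_exp)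
        (fun x hx => ?_) (convex_Iic _)
      rw [← NNReal.coe_le_coe, coe_nnnorm, Real.deriv_exp, norm_of_nonneg (exp_pos _).le,
        coe_toNNReal _ (exp_pos _).le]
      exact exp_le_exp.mpr hx
    have h2 : LipschitzWith (‖A‖₊ * 1) fun x : Eu (n + 1) => A * ‖x‖ :=
      (lipschitzWith_smul A).comp lipschitzWith_one_norm
    refine ⟨_, h1.comp (h2.lipschitzOnWith (s := closedBall 0 r)) fun x hx => ?_⟩
    rw [mem_closedBall_zero_iff] at hx
    exact mul_le_mul_of_nonneg_left hx hA.le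
  have hI2 : IntegrableOn (fun x => u x ^ 2) (ball 0 r) :=
    ((hcont.pow 2).continuousOn.integrableOn_compact (isCompact_closedBall 0 r)).mono_set
      ball_subset_closedBall
  have hI1 : IntegrableOn (fun x => ‖fderiv ℝ u x‖ ^ 2) (ball 0 r) :=
    integrableOn_norm_fderiv_sq_of_lipschitzOnWith isOpen_ball measure_ball_lt_top.ne
      (hK.mono ball_subset_closedBall)
  have hgrad : ∫ x in ball 0 r, ‖fderiv ℝ u x‖ ^ 2 ≤ A ^ 2 * ∫ x in ball 0 r, u x ^ 2 := by
    rw [← integral_const_mul]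
    refine setIntegral_mono hI1 (hI2.const_mul _) fun x => ?_
    rw [← mul_pow]
    exact pow_le_pow_left₀ (norm_nonneg _) (norm_fderiv_exp_mul_norm_le hA x) 2
  have hpos : 0 < ∫ x in ball 0 r, u x ^ 2 := by
    rw [setIntegral_pos_iff_support_of_nonneg_ae (Eventually.of_forall fun x => sq_nonneg _) hI2]
    have : Function.support (fun x => u x ^ 2) = Set.univ :=
      Set.eq_univ_of_forall fun x => (pow_pos (exp_pos _) 2).ne'
    rw [this, Set.univ_inter]
    exact measure_ball_pos _ _ hr
  have hsq : ∀ (θ : sphere (0 : Eu (n + 1)) 1) {s : ℝ}, 0 ≤ s →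
      u (s • (θ : Eu (n + 1))) ^ 2 = exp (2 * A * s) := fun θ s hs => by
    rw [hu, ← exp_nat_mul, norm_smul, norm_eq_of_mem_sphere, norm_of_nonneg hs]
    push_cast
    ring_nf
  have hvol : ∫ x in ball 0 r, u x ^ 2 = ∫ _ : sphere (0 : Eu (n + 1)) 1,
      (∫ s in Set.Ioo 0 r, s ^ n * exp (2 * A * s)) ∂(volume : Measure (Eu (n + 1))).toSphere := by
    rw [setIntegral_congr_set (ball_ae_eq_normShell r), (polar_shell (n := n) (by simp) le_rfl
      (hI2.congr_set_ae (ball_ae_eq_normShell r).symm)).2.2]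
    refine integral_congr_ae (Eventually.of_forall fun θ => ?_)
    exact setIntegral_congr_fun measurableSet_Ioo fun s hs => by simp only [hsq θ hs.1.le]
  have hbd : (2 * A + n / r) * ∫ x in ball 0 r, u x ^ 2 ≤
      r ^ n * ∫ θ : sphere (0 : Eu (n + 1)) 1, u (r • (θ : Eu (n + 1))) ^ 2
        ∂(volume : Measure (Eu (n + 1))).toSphere := by
    simp only [hvol, hsq _ hr.le, integral_const, smul_eq_mul]
    have := mul_le_mul_of_nonneg_left (add_div_mul_integral_pow_mul_exp_le hn1 (A := A) hr)
      (measureReal_nonneg (μ := (volume : Measure (Eu (n + 1))).toSphere) (s := Set.univ))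
    linarith
  refine ⟨_, mem_robinRayleighSet_succ.mpr ⟨u, K, by rwa [closure_ball _ hr.ne'], hpos.ne', rfl⟩, ?_⟩
  rw [div_le_iff₀ hpos, frontier_ball _ hr.ne', (hc _ r hr).2]
  have h3 := mul_le_mul_of_nonneg_left hbd hA.le
  calc _ ≤ A ^ 2 * (∫ x in ball 0 r, u x ^ 2) - A * ((2 * A + n / r) * ∫ x in ball 0 r, u x ^ 2) := by
        rw [← mul_assoc α c, show α * c = -A by linarith]
        linarith
    _ = _ := by ring

theorem exists_shell_field (n : ℕ) {a b : ℝ} (ha : 0 < a) (hab : a < b) :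
    ∃ C : ℝ, 0 ≤ C ∧ ∀ A : ℝ, 0 < A → ∃ φ : ℝ → ℝ, ContDiff ℝ 1 φ ∧ φ a = -A ∧ φ b = A ∧
      ∀ s ∈ Set.Ioo a b, deriv φ s + n * φ s / s + φ s ^ 2 ≤ A ^ 2 + n * A / b + C := by
  have hw : 0 < b - a := sub_pos.mpr hab
  have hb : 0 < b := ha.trans hab
  set D : ℝ := 12 / (b - a) + 2 * n * (b - a) / (a * b) with hD
  refine ⟨D ^ 2 / 16, by positivity, fun A hA =>
    ⟨fun s => A * (-1 + 6 * ((s - a) / (b - a)) ^ 2 - 4 * ((s - a) / (b - a)) ^ 3),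
      by fun_prop, by simp, by simp only [div_self hw.ne']; ring, fun s hs => ?_⟩⟩
  have hs0 : 0 < s := ha.trans hs.1
  set t := (s - a) / (b - a) with ht
  have hderiv : deriv (fun s : ℝ => A * (-1 + 6 * ((s - a) / (b - a)) ^ 2 -
      4 * ((s - a) / (b - a)) ^ 3)) s = A * (12 / (b - a) * (t * (1 - t))) := by
    have h1 : HasDerivAt (fun s : ℝ => (s - a) / (b - a)) (1 / (b - a)) s :=
      ((hasDerivAt_id s).sub_const a).div_const _
    have h2 := ((((h1.fun_pow 2).const_mul 6).const_add (-1)).fun_sub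
      ((h1.fun_pow 3).const_mul 4)).const_mul A
    rw [h2.deriv, ← ht]
    push_cast
    ring
  have ht0 : 0 < t := div_pos (sub_pos.mpr hs.1) hw
  have ht1 : 0 < 1 - t := by
    rw [sub_pos, ht, div_lt_one hw]
    linarith [hs.2]
  have hbs : b - s = (b - a) * (1 - t) := by
    rw [ht]
    field_simp
    ring
  rw [hderiv]
  set g := -1 + 6 * t ^ 2 - 4 * t ^ 3 with hg
  have hg2 : g ^ 2 ≤ 1 - 4 * (t * (1 - t)) ^ 2 := by
    have : 0 ≤ (t * (1 - t)) ^ 2 * (2 + 4 * (t * (1 - t))) := by positivity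
    nlinarith
  have hgs : n * g / s ≤ n / b + 2 * n * (b - a) / (a * b) * (t * (1 - t)) := by
    rcases le_total t (1 / 2) with h | h
    · have hg0 : g ≤ 0 := by
        have : 0 ≤ (1 - 2 * t) * (1 + 2 * (t * (1 - t))) :=
          mul_nonneg (by linarith) (by positivity)
        nlinarith
      have : n * g / s ≤ 0 :=
        div_nonpos_of_nonpos_of_nonneg (mul_nonpos_of_nonneg_of_nonpos n.cast_nonneg hg0) hs0.le
      exact this.trans (by positivity)
    · have hg1 : g ≤ 1 := by
        have : 0 ≤ (1 - t) ^ 2 * (1 + 2 * t) := by positivity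
        nlinarith
      have h1 : 1 / s - 1 / b ≤ 2 * (b - a) / (a * b) * (t * (1 - t)) := by
        calc 1 / s - 1 / b = (b - a) * (1 - t) / (s * b) := by
              rw [← hbs]
              field_simp
          _ ≤ (b - a) * (1 - t) / (a * b) := by
              have := hs.1.le
              gcongr
          _ ≤ (b - a) * (1 - t) / (a * b) * (2 * t) :=
              le_mul_of_one_le_right (by positivity) (by linarith)
          _ = _ := by ring
      calc n * g / s ≤ n * 1 / s := by gcongr
        _ = n / b + n * (1 / s - 1 / b) := by ring
        _ ≤ n / b + n * (2 * (b - a) / (a * b) * (t * (1 - t))) := by gcongr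
        _ = _ := by ring
  have h1 := mul_le_mul_of_nonneg_left hgs hA.le
  have h2 := mul_le_mul_of_nonneg_left hg2 (sq_nonneg A)
  calc A * (12 / (b - a) * (t * (1 - t))) + n * (A * g) / s + (A * g) ^ 2
      = A * (12 / (b - a) * (t * (1 - t))) + A * (n * g / s) + A ^ 2 * g ^ 2 := by ring
    _ ≤ A * (12 / (b - a) * (t * (1 - t))) +
        A * (n / b + 2 * n * (b - a) / (a * b) * (t * (1 - t))) +
        A ^ 2 * (1 - 4 * (t * (1 - t)) ^ 2) := by gcongr
    _ = A ^ 2 + n * A / b + D ^ 2 / 16 - (2 * A * (t * (1 - t)) - D / 4) ^ 2 := by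
        rw [hD]
        ring
    _ ≤ _ := sub_le_self _ (sq_nonneg _)

theorem bddBelow_robinRayleighSet_ball {α c r : ℝ} (hr : 0 < r)
    (hc : ∀ (f : Eu (n + 1) → ℝ) (R : ℝ), 0 < R → μH[(n : ℝ)] (sphere (0 : Eu (n + 1)) R) < ⊤ ∧
      ∫ x in sphere (0 : Eu (n + 1)) R, f x ∂μH[(n : ℝ)] =
        c * (R ^ n * ∫ θ : sphere (0 : Eu (n + 1)) 1, f (R • (θ : Eu (n + 1)))
          ∂(volume : Measure (Eu (n + 1))).toSphere)) :
    BddBelow (robinRayleighSet (n + 1) α (ball 0 r)) := by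
  set A := -(α * c)
  refine ⟨-(A / r + n * A / r + A ^ 2), fun lam hlam => le_of_mem_robinRayleighSet_ball hr hc
    (φ := fun s => A / r * s) (by fun_prop) (fun s hs => ?_) (by simp)
    (div_mul_cancel₀ _ hr.ne') hlam⟩
  have hs0 := hs.1
  have h1 : deriv (fun s : ℝ => A / r * s) s = A / r := by
    simp
  have h2 : n * (A / r * s) / s = n * A / r := by field_simp
  have h3 : (A / r * s) ^ 2 ≤ A ^ 2 := by
    have : (s / r) ^ 2 ≤ 1 := pow_le_one₀ (by positivity) ((div_le_one hr).mpr hs.2.le)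
    calc (A / r * s) ^ 2 = A ^ 2 * (s / r) ^ 2 := by ring
      _ ≤ A ^ 2 := mul_le_of_le_one_right (sq_nonneg A) this
  rw [h1, h2]
  gcongr

theorem lt_of_volume_ball_eq_volume_shell {a b r : ℝ} (ha : 0 < a) (hab : a < b)
    (hvol : volume (ball (0 : Eu (n + 1)) r) = volume (shell (n + 1) a b)) : r < b := by
  by_contra! hbr
  have hdisj : Disjoint (ball (0 : Eu (n + 1)) a) (shell (n + 1) a b) :=
    Set.disjoint_left.mpr fun x hx hx' => by
      rw [mem_ball_zero_iff] at hx
      exact hx.not_gt hx'.1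
  have hsub : ball (0 : Eu (n + 1)) a ∪ shell (n + 1) a b ⊆ ball 0 r := by
    rintro x (hx | hx)
    · exact ball_subset_ball (hab.le.trans hbr) hx
    · exact mem_ball_zero_iff.mpr (hx.2.trans_le hbr)
  have h := measure_mono (μ := volume) hsub
  rw [measure_union hdisj (isOpen_normShell a b).measurableSet, hvol, add_comm] at h
  exact (ENNReal.lt_add_right (hvol ▸ measure_ball_lt_top.ne)
    (measure_ball_pos _ _ ha).ne').not_ge h

theorem exists_robinEig_ball_lt_robinEig_shell (hn1 : 1 ≤ n) {a b r : ℝ} (ha : 0 < a)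
    (hab : a < b) (hr : 0 < r) (hrb : r < b) :
    ∃ α₀ : ℝ, α₀ < 0 ∧ ∀ α < α₀,
      robinEig (n + 1) α (ball 0 r) < robinEig (n + 1) α (shell (n + 1) a b) := by
  obtain ⟨c, hc0, hc⟩ := exists_integral_sphere_hausdorffMeasure (E := Eu (n + 1)) (n := n) (by simp)
  obtain ⟨C, hC0, hC⟩ := exists_shell_field n ha hab
  have hgap : 0 < n / r - n / b := by
    have : (0 : ℝ) < n := by exact_mod_cast hn1
    exact sub_pos.mpr (by gcongr)
  refine ⟨-((C / (n / r - n / b) + 1) / c), neg_neg_of_pos (by positivity), fun α hα => ?_⟩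
  set A := -(α * c) with hA
  have hA1 : C / (n / r - n / b) + 1 < A := by
    have := (div_lt_iff₀ hc0).mp (lt_neg_of_lt_neg hα)
    linarith
  have hA0 : 0 < A := lt_trans (by positivity) hA1
  obtain ⟨lam, hlam, hle⟩ := exists_mem_robinRayleighSet_ball_le hn1 hr hA0 hc hA
  obtain ⟨φ, hφ, hφa, hφb, hφΛ⟩ := hC A hA0
  have hshell : -(A ^ 2 + n * A / b + C) ≤ robinEig (n + 1) α (shell (n + 1) a b) := by
    refine le_csInf (robinRayleighSet_nonempty ?_ (volume_normShell_ne_top a b)) fun l hl =>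
      le_of_mem_robinRayleighSet_shell ha hab hc hφ hφΛ (by rw [hφa, hA, neg_neg]) hφb hl
    refine ((isOpen_normShell a b).measure_pos volume ?_).ne'
    rw [← closure_nonempty_iff, closure_normShell ha hab]
    obtain ⟨x, hx⟩ := (NormedSpace.sphere_nonempty (E := Eu (n + 1)) (x := 0)).mpr ha.le
    rw [mem_sphere_zero_iff_norm] at hx
    exact ⟨x, hx.ge, hx.le.trans hab.le⟩
  have hCA : C < A * (n / r - n / b) := (div_lt_iff₀ hgap).mp (by linarith)
  calc robinEig (n + 1) α (ball 0 r) ≤ lam := csInf_le (bddBelow_robinRayleighSet_ball hr hc) hlam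
    _ ≤ -(A ^ 2 + n * A / r) := hle
    _ < -(A ^ 2 + n * A / b + C) := by
      have : A * (n / r - n / b) = n * A / r - n * A / b := by ring
      linarith
    _ ≤ _ := hshell

end Robin

theorem shell_beats_ball_for_large_negative_alpha
    (d : ℕ) (hd : 2 ≤ d) (r₁ r₂ r : ℝ) (hr₁ : 0 < r₁) (hr₁₂ : r₁ < r₂) (hr : 0 < r)
    (hvol : volume (Metric.ball (0 : Eu d) r) = volume (shell d r₁ r₂)) :
    ∃ α₀ : ℝ, α₀ < 0 ∧ ∀ α < α₀,
      robinEig d α (Metric.ball (0 : Eu d) r) < robinEig d α (shell d r₁ r₂) := by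
  obtain ⟨n, rfl⟩ : ∃ n, d = n + 1 := ⟨d - 1, by omega⟩
  exact exists_robinEig_ball_lt_robinEig_shell (by omega) hr₁ hr₁₂ hr
    (lt_of_volume_ball_eq_volume_shell hr₁ hr₁₂ hvol)

end
end

section
/- Let Ω ⊂ ℝ² be a bounded C² domain with outer boundary Γ₀, outer perimeter L₀ := H¹(Γ₀), and area A₀ := |Ω|. Let R be the inner radius of the region Ω₀ enclosed by Γ₀. Then for every t ∈ [0, R], the area function satisfies A(t) ≤ L₀·t − π·t², where A(t) := |{x ∈ Ω : dist(x, Γ₀) < t}|. -/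
open MeasureTheory Metric Filter Asymptotics Real RealInnerProductSpace

noncomputable section

/-- A `C²` Jordan curve in the plane: a periodic, regular, `C²` curve which is
injective on a period. -/
def IsC2JordanCurve (γ : ℝ → Eu 2) : Prop :=
  ContDiff ℝ 2 γ ∧ Function.Periodic γ 1 ∧
  (∀ s ∈ Set.Ico (0 : ℝ) 1, ∀ t ∈ Set.Ico (0 : ℝ) 1, γ s = γ t → s = t) ∧
  ∀ t, deriv γ t ≠ 0

/-- A bounded planar `C²` domain: a bounded open connected set whose boundary is a
finite disjoint union of `C²` Jordan curves. -/
def IsC2Domain (Ω : Set (Eu 2)) : Prop :=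
  IsOpen Ω ∧ IsConnected Ω ∧ Bornology.IsBounded Ω ∧
  ∃ (N : ℕ) (γ : Fin N → ℝ → Eu 2),
    (∀ i, IsC2JordanCurve (γ i)) ∧
    (∀ i j, i ≠ j → Disjoint (Set.range (γ i)) (Set.range (γ j))) ∧
    frontier Ω = ⋃ i, Set.range (γ i)

/-- The unbounded connected component of the complement of the closure of `Ω`. -/
def unboundedPart (Ω : Set (Eu 2)) : Set (Eu 2) :=
  {x | x ∈ (closure Ω)ᶜ ∧ ¬ Bornology.IsBounded (connectedComponentIn (closure Ω)ᶜ x)}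

/-- The outer boundary `Γ₀` of `Ω`: the boundary of the unbounded component of the
complement of the closure of `Ω`. -/
def outerBoundary (Ω : Set (Eu 2)) : Set (Eu 2) :=
  frontier (unboundedPart Ω)

/-- The open region `Ω₀` enclosed by the outer boundary of `Ω`. -/
def innerRegion (Ω : Set (Eu 2)) : Set (Eu 2) :=
  (closure (unboundedPart Ω))ᶜ

/-- The inner radius `R` of the region enclosed by the outer boundary of `Ω`. -/
def innerRadius (Ω : Set (Eu 2)) : ℝ :=
  sSup ((fun x => infDist x (outerBoundary Ω)) '' innerRegion Ω)

/-- The outer perimeter `L₀ = H¹(Γ₀)`. -/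
def outerPerim (Ω : Set (Eu 2)) : ℝ :=
  (μH[1] (outerBoundary Ω)).toReal

/-- `A(t)`, the area of the part of the `t`-neighbourhood of the outer boundary lying
inside `Ω`. -/
def areaFn (Ω : Set (Eu 2)) (t : ℝ) : ℝ :=
  (volume {x ∈ Ω | infDist x (outerBoundary Ω) < t}).toReal

/-- `L(t)`, the length of the part of the level curve at distance `t` from the outer
boundary that lies inside `Ω`. -/
def lenFn (Ω : Set (Eu 2)) (t : ℝ) : ℝ :=
  (μH[1] {x ∈ Ω | infDist x (outerBoundary Ω) = t}).toReal

section

open Set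
open scoped ENNReal Topology

/-- A finite subset of `O` no two points of which lie in the same interval contained in `O`. -/
def IsIntervalSeparated (O : Set ℝ) (T : Finset ℝ) : Prop :=
  (∀ a ∈ T, a ∈ O) ∧ ∀ a ∈ T, ∀ b ∈ T, a ≠ b → ¬ uIcc a b ⊆ O

/-- The number of maximal intervals contained in a subset of the line. -/
def intervalCount (O : Set ℝ) : ℝ≥0∞ :=
  ⨆ (T : Finset ℝ) (_ : IsIntervalSeparated O T), (T.card : ℝ≥0∞)

lemma IsIntervalSeparated.card_le {O : Set ℝ} {T : Finset ℝ} (h : IsIntervalSeparated O T) :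
    (T.card : ℝ≥0∞) ≤ intervalCount O :=
  le_iSup₂ (f := fun (T : Finset ℝ) (_ : IsIntervalSeparated O T) => (T.card : ℝ≥0∞)) T h

lemma uIcc_subset_trans {O : Set ℝ} {a b c : ℝ} (h₁ : uIcc a b ⊆ O) (h₂ : uIcc b c ⊆ O) :
    uIcc a c ⊆ O :=
  uIcc_subset_uIcc_union_uIcc.trans (union_subset h₁ h₂)

lemma exists_separated_card_eq {O : Set ℝ} (h : intervalCount O ≠ ⊤) :
    ∃ T, IsIntervalSeparated O T ∧ (T.card : ℝ≥0∞) = intervalCount O := by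
  obtain ⟨n, hn⟩ := ENNReal.exists_nat_gt h
  set A : Set ℕ := {k | ∃ T, IsIntervalSeparated O T ∧ T.card = k} with hA
  have hne : A.Nonempty := ⟨0, ∅, ⟨by simp, by simp⟩, rfl⟩
  have hbd : BddAbove A := by
    refine ⟨n, ?_⟩
    rintro k ⟨T, hT, rfl⟩
    exact_mod_cast (hT.card_le.trans hn.le)
  obtain ⟨T, hT, hc⟩ := Nat.sSup_mem hne hbd
  refine ⟨T, hT, le_antisymm hT.card_le (iSup₂_le fun T' hT' => ?_)⟩
  rw [hc]
  exact_mod_cast le_csSup hbd ⟨T', hT', rfl⟩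

lemma IsIntervalSeparated.exists_uIcc_subset {O : Set ℝ} {T : Finset ℝ}
    (h : IsIntervalSeparated O T) (hc : (T.card : ℝ≥0∞) = intervalCount O) {p : ℝ} (hp : p ∈ O) :
    ∃ t ∈ T, uIcc p t ⊆ O := by
  by_contra! hcon
  have hpT : p ∉ T := fun hpT => hcon p hpT (by simpa using hp)
  have : IsIntervalSeparated O (insert p T) := by
    refine ⟨?_, ?_⟩
    · intro a ha
      rcases Finset.mem_insert.1 ha with rfl | ha
      exacts [hp, h.1 a ha]
    · intro a ha b hb hab
      rcases Finset.mem_insert.1 ha with rfl | ha' <;> rcases Finset.mem_insert.1 hb with rfl | hb'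
      · exact absurd rfl hab
      · exact hcon b hb'
      · rw [uIcc_comm]; exact hcon a ha'
      · exact h.2 a ha' b hb' hab
  have h2 := this.card_le
  rw [Finset.card_insert_of_notMem hpT, ← hc] at h2
  have : T.card + 1 ≤ T.card := by exact_mod_cast h2
  omega

lemma exists_rat_separated {O : Set ℝ} (hO : IsOpen O) {T : Finset ℝ}
    (hT : IsIntervalSeparated O T) :
    ∃ T' : Finset ℚ, IsIntervalSeparated O (T'.image ((↑) : ℚ → ℝ)) ∧ T'.card = T.card := by
  have key : ∀ p ∈ O, ∃ q : ℚ, uIcc p (q : ℝ) ⊆ O := by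
    intro p hp
    obtain ⟨ε, hε, hb⟩ := Metric.isOpen_iff.1 hO p hp
    obtain ⟨q, hq1, hq2⟩ := exists_rat_btwn (show p < p + ε by linarith)
    refine ⟨q, fun z hz => hb ?_⟩
    rw [uIcc_of_le hq1.le] at hz
    rw [Metric.mem_ball, Real.dist_eq, abs_lt]
    constructor <;> linarith [hz.1, hz.2]
  choose! q hq using key
  have hinj : ∀ a ∈ T, ∀ b ∈ T, uIcc (q a : ℝ) (q b) ⊆ O → a = b := by
    intro a ha b hb hab
    by_contra hne
    refine hT.2 a ha b hb hne ?_
    refine uIcc_subset_trans (hq a (hT.1 a ha)) (uIcc_subset_trans hab ?_)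
    rw [uIcc_comm]
    exact hq b (hT.1 b hb)
  have hself : ∀ a ∈ T, (q a : ℝ) ∈ O := fun a ha => hq a (hT.1 a ha) right_mem_uIcc
  refine ⟨T.image q, ⟨?_, ?_⟩, Finset.card_image_of_injOn ?_⟩
  · simp only [Finset.mem_image]
    rintro _ ⟨_, ⟨a, ha, rfl⟩, rfl⟩
    exact hself a ha
  · simp only [Finset.mem_image]
    rintro _ ⟨_, ⟨a, ha, rfl⟩, rfl⟩ _ ⟨_, ⟨b, hb, rfl⟩, rfl⟩ hab hsub
    exact hab (by rw [hinj a ha b hb hsub])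
  · intro a ha b hb hab
    refine hinj a ha b hb ?_
    rw [show (q a : ℝ) = q b by exact_mod_cast hab]
    simpa using hself b hb

lemma intervalCount_eq_iSup_rat {O : Set ℝ} (hO : IsOpen O) :
    intervalCount O = ⨆ (T : Finset ℚ) (_ : IsIntervalSeparated O (T.image ((↑) : ℚ → ℝ))),
      (T.card : ℝ≥0∞) := by
  refine le_antisymm (iSup₂_le fun T hT => ?_) (iSup₂_le fun T hT => ?_)
  · obtain ⟨T', hT', hc⟩ := exists_rat_separated hO hT
    rw [← hc]
    exact le_iSup₂ (f := fun (T : Finset ℚ)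
      (_ : IsIntervalSeparated O (T.image ((↑) : ℚ → ℝ))) => (T.card : ℝ≥0∞)) T' hT'
  · refine le_trans (le_of_eq ?_) hT.card_le
    rw [Finset.card_image_of_injective _ Rat.cast_injective]

lemma measurable_intervalCount_slice {W : Set (ℝ × ℝ)} (hW : IsOpen W) :
    Measurable fun s : ℝ => intervalCount {p | (p, s) ∈ W} := by
  have h1 : ∀ s : ℝ, IsOpen {p : ℝ | (p, s) ∈ W} := fun s =>
    hW.preimage (by fun_prop : Continuous fun p : ℝ => (p, s))
  simp_rw [fun s => intervalCount_eq_iSup_rat (h1 s)]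
  refine Measurable.iSup fun T => ?_
  have hS : MeasurableSet {s : ℝ | IsIntervalSeparated {p | (p, s) ∈ W}
      (T.image ((↑) : ℚ → ℝ))} := by
    have hcpt : ∀ a b : ℝ, IsOpen {s : ℝ | uIcc a b ⊆ {p | (p, s) ∈ W}} := by
      intro a b
      rw [isOpen_iff_mem_nhds]
      intro s hs
      refine (isCompact_uIcc (a := a) (b := b)).eventually_forall_of_forall_eventually
        (P := fun s p => (p, s) ∈ W) fun p hp => ?_
      have : Tendsto (fun z : ℝ × ℝ => (z.2, z.1)) (𝓝 (s, p)) (𝓝 (p, s)) :=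
        (continuous_swap (X := ℝ) (Y := ℝ)).tendsto (s, p)
      exact this.eventually (hW.mem_nhds (hs hp))
    simp only [IsIntervalSeparated, ofPred_and, ofPred_forall]
    refine MeasurableSet.inter ?_ ?_
    · refine Finset.measurableSet_biInter _ fun a _ => ?_
      exact (hW.preimage (by fun_prop : Continuous fun s : ℝ => (a, s))).measurableSet
    · refine Finset.measurableSet_biInter _ fun a _ => Finset.measurableSet_biInter _ fun b _ => ?_
      refine MeasurableSet.iInter fun _ => ?_
      exact (hcpt a b).measurableSet.compl
  have : (fun s : ℝ => ⨆ (_ : IsIntervalSeparated {p | (p, s) ∈ W} (T.image ((↑) : ℚ → ℝ))),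
      (T.card : ℝ≥0∞)) = indicator {s : ℝ | IsIntervalSeparated {p | (p, s) ∈ W}
      (T.image ((↑) : ℚ → ℝ))} (fun _ => (T.card : ℝ≥0∞)) := by
    ext s
    by_cases hs : IsIntervalSeparated {p | (p, s) ∈ W} (T.image ((↑) : ℚ → ℝ))
    · simp [hs]
    · simp [hs]
  rw [this]
  exact measurable_const.indicator hS

lemma intervalCount_preimage_add (O : Set ℝ) (c : ℝ) :
    intervalCount {p | p + c ∈ O} = intervalCount O := by
  have key : ∀ (O : Set ℝ) (c : ℝ), intervalCount {p | p + c ∈ O} ≤ intervalCount O := by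
    intro O c
    refine iSup₂_le fun T hT => ?_
    have : IsIntervalSeparated O (T.image (· + c)) := by
      refine ⟨?_, ?_⟩
      · simp only [Finset.mem_image]
        rintro _ ⟨a, ha, rfl⟩
        exact hT.1 a ha
      · simp only [Finset.mem_image]
        rintro _ ⟨a, ha, rfl⟩ _ ⟨b, hb, rfl⟩ hab hsub
        refine hT.2 a ha b hb (fun h => hab (by rw [h])) fun z hz => hsub ?_
        rw [mem_uIcc] at hz ⊢
        rcases hz with hz | hz
        · left; constructor <;> linarith [hz.1, hz.2]
        · right; constructor <;> linarith [hz.1, hz.2]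
    refine le_trans (le_of_eq ?_) this.card_le
    rw [Finset.card_image_of_injective _ (add_left_injective c)]
  refine le_antisymm (key O c) ?_
  have := key {p | p + c ∈ O} (-c)
  simpa using this

/-- Removing from an open set the points at distance less than one from its right boundary
costs at most length one per interval. -/
lemma volume_diff_le_intervalCount {O : Set ℝ} (hb : BddAbove O) :
    volume (O \ {p | Icc p (p + 1) ⊆ O}) ≤ intervalCount O := by
  by_cases htop : intervalCount O = ⊤
  · simp [htop]
  obtain ⟨T, hT, hc⟩ := exists_separated_card_eq htop
  set b : ℝ → ℝ := fun t => sSup {q | uIcc t q ⊆ O} with hbdef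
  have hbdd : ∀ t, BddAbove {q | uIcc t q ⊆ O} := fun t =>
    hb.mono fun q hq => hq right_mem_uIcc
  have hsub : O \ {p | Icc p (p + 1) ⊆ O} ⊆ ⋃ t ∈ T, Icc (b t - 1) (b t) := by
    rintro p ⟨hp, hp1⟩
    obtain ⟨t, ht, hpt⟩ := hT.exists_uIcc_subset hc hp
    simp only [mem_iUnion]
    have hpb : uIcc t p ⊆ O := by rwa [uIcc_comm]
    refine ⟨t, ht, ?_, le_csSup (hbdd t) hpb⟩
    by_contra hlt
    apply hp1
    push Not at hlt
    obtain ⟨q, hq, hpq⟩ := exists_lt_of_lt_csSup ⟨p, hpb⟩ (show p + 1 < b t by linarith)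
    refine Subset.trans ?_ (uIcc_subset_trans hpt hq)
    rw [uIcc_of_le (by linarith)]
    exact Icc_subset_Icc_right hpq.le
  calc volume (O \ {p | Icc p (p + 1) ⊆ O})
      ≤ volume (⋃ t ∈ T, Icc (b t - 1) (b t)) := measure_mono hsub
    _ ≤ ∑ t ∈ T, volume (Icc (b t - 1) (b t)) := measure_biUnion_finset_le _ _
    _ = intervalCount O := by simp [← hc]

/-- A multigraph with finite vertex set `V ≠ ∅` and at least `#V` edges carries a nonzero
cycle modulo two. -/
lemma exists_cycle_mod_two {α β : Type*} [DecidableEq α] [DecidableEq β] (E : Finset β)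
    (V : Finset α) (hV : V.Nonempty) (hcard : V.card ≤ E.card) (src tgt : β → α)
    (hsrc : ∀ e ∈ E, src e ∈ V) (htgt : ∀ e ∈ E, tgt e ∈ V) :
    ∃ x : β → ZMod 2, (∃ e ∈ E, x e ≠ 0) ∧ ∀ v ∈ V,
      ∑ e ∈ E, x e * ((if src e = v then 1 else 0) + (if tgt e = v then 1 else 0)) = 0 := by
  obtain ⟨v₀, hv₀⟩ := hV
  let w : Option E → (V → ZMod 2) := fun o => match o with
    | none => fun v => if v.1 = v₀ then 1 else 0
    | some e => fun v => (if src e.1 = v.1 then 1 else 0) + (if tgt e.1 = v.1 then 1 else 0)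
  have hdep : ¬ LinearIndependent (ZMod 2) w := by
    intro h
    have := h.fintype_card_le_finrank
    simp at this
    omega
  obtain ⟨g, hg, o, ho⟩ := Fintype.not_linearIndependent_iff.1 hdep
  rw [Fintype.sum_option] at hg
  have hgv : ∀ v : V, g none * (if v.1 = v₀ then 1 else 0) + ∑ e : E, g (some e) *
      ((if src e.1 = v.1 then 1 else 0) + (if tgt e.1 = v.1 then 1 else 0)) = 0 := by
    intro v
    have := congrFun hg v
    simpa [w] using this
  have hsingle : ∀ u ∈ V, ∑ v : V, (if u = v.1 then (1 : ZMod 2) else 0) = 1 := by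
    intro u hu
    rw [Finset.sum_coe_sort V (fun v => if u = v then (1 : ZMod 2) else 0)]
    simp [hu]
  have hnone : g none = 0 := by
    have h1 : ∑ v : V, (g none * (if v.1 = v₀ then 1 else 0) + ∑ e : E, g (some e) *
      ((if src e.1 = v.1 then 1 else 0) + (if tgt e.1 = v.1 then 1 else 0))) = 0 :=
      Finset.sum_eq_zero fun v _ => hgv v
    rw [Finset.sum_add_distrib, ← Finset.mul_sum, Finset.sum_comm] at h1
    have h2 : ∀ e : E, ∑ v : V, g (some e) *
        ((if src e.1 = v.1 then 1 else 0) + (if tgt e.1 = v.1 then 1 else 0)) = 0 := by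
      intro e
      rw [← Finset.mul_sum, Finset.sum_add_distrib, hsingle _ (hsrc _ e.2),
        hsingle _ (htgt _ e.2), show (1 : ZMod 2) + 1 = 0 by decide, mul_zero]
    simp_rw [h2, eq_comm (b := v₀)] at h1
    rw [hsingle v₀ hv₀] at h1
    simpa using h1
  refine ⟨fun e => if h : e ∈ E then g (some ⟨e, h⟩) else 0, ?_, ?_⟩
  · cases o with
    | none => exact absurd hnone ho
    | some e => exact ⟨e.1, e.2, by simpa using ho⟩
  · intro v hv
    have := hgv ⟨v, hv⟩
    rw [hnone, zero_mul, zero_add] at this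
    refine Eq.trans ?_ this
    rw [← Finset.sum_coe_sort]
    simp

/-- Slabs of height one: the trapezoids of an open set with connected complement, seen as edges
between the intervals of the slices at integer heights, form a forest. -/
theorem card_edges_lt_card_vertices {W : Set (ℝ × ℝ)} {B : ℝ}
    (hB : ∀ x ∈ W, |x.1| < B ∧ |x.2| < B) (hC : IsPreconnected Wᶜ) (s₀ : ℝ)
    (E V : Finset (ℤ × ℝ))
    (hE : ∀ e ∈ E, ∀ σ ∈ Icc (0 : ℝ) 1, (e.2, s₀ + e.1 + σ) ∈ W)
    (hsep : ∀ e ∈ E, ∀ e' ∈ E, e.1 = e'.1 → e ≠ e' →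
      ∃ z ∈ uIcc e.2 e'.2, ∃ σ ∈ Icc (0 : ℝ) 1, (z, s₀ + e.1 + σ) ∉ W)
    (r : ℤ → ℝ → ℝ)
    (hr : ∀ (k : ℤ) (p : ℝ), (p, s₀ + k) ∈ W →
      (k, r k p) ∈ V ∧ ∀ z ∈ uIcc p (r k p), (z, s₀ + k) ∈ W)
    (hV : V.Nonempty) : E.card + 1 ≤ V.card := by
  by_contra! hcon
  have hsrcW : ∀ e ∈ E, (e.2, s₀ + (e.1 : ℤ)) ∈ W := fun e he => by
    simpa using hE e he 0 (by simp)
  have htgtW : ∀ e ∈ E, (e.2, s₀ + ((e.1 + 1 : ℤ) : ℝ)) ∈ W := fun e he => by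
    have := hE e he 1 (by simp)
    push_cast
    rwa [← add_assoc]
  obtain ⟨x, ⟨e₀, he₀, hx₀⟩, hx⟩ := exists_cycle_mod_two E V hV (by omega)
    (fun e => (e.1, r e.1 e.2)) (fun e => (e.1 + 1, r (e.1 + 1) e.2))
    (fun e he => (hr _ _ (hsrcW e he)).1) (fun e he => (hr _ _ (htgtW e he)).1)
  set F : ℤ → ℝ → ZMod 2 := fun k p => ∑ e ∈ E, if e.1 = k ∧ e.2 < p then x e else 0 with hF
  -- on a gap of a slice, the parities seen from the slabs above and below agree
  have hside : ∀ (k : ℤ) (p q : ℝ), (p, s₀ + k) ∉ W → (q, s₀ + k) ∈ W →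
      (r k q < p ↔ q < p) := by
    intro k p q hp hq
    have h := (hr k q hq).2
    constructor
    · intro h1
      by_contra! h2
      exact hp (h p (mem_uIcc.2 (Or.inr ⟨h1.le, h2⟩)))
    · intro h1
      by_contra! h2
      exact hp (h p (mem_uIcc.2 (Or.inl ⟨h1.le, h2⟩)))
  have hlevel : ∀ (k : ℤ) (p : ℝ), (p, s₀ + k) ∉ W → F k p = F (k - 1) p := by
    intro k p hp
    have h0 : ∑ v ∈ V with v.1 = k ∧ v.2 < p, ∑ e ∈ E, x e *
        ((if (e.1, r e.1 e.2) = v then 1 else 0) +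
          (if (e.1 + 1, r (e.1 + 1) e.2) = v then 1 else 0)) = 0 :=
      Finset.sum_eq_zero fun v hv => hx v (Finset.mem_filter.1 hv).1
    rw [Finset.sum_comm] at h0
    have h1 : ∀ e ∈ E, ∑ v ∈ V with v.1 = k ∧ v.2 < p, x e *
        ((if (e.1, r e.1 e.2) = v then 1 else 0) +
          (if (e.1 + 1, r (e.1 + 1) e.2) = v then 1 else 0)) =
        (if e.1 = k ∧ e.2 < p then x e else 0) +
          (if e.1 = k - 1 ∧ e.2 < p then x e else 0) := by
      intro e he
      rw [← Finset.mul_sum, Finset.sum_add_distrib, Finset.sum_ite_eq, Finset.sum_ite_eq, mul_add]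
      congr 1
      · have : ((e.1, r e.1 e.2) ∈ ({v ∈ V | v.1 = k ∧ v.2 < p} : Finset _)) ↔
            (e.1 = k ∧ e.2 < p) := by
          rw [Finset.mem_filter]
          constructor
          · rintro ⟨-, h2, h3⟩
            refine ⟨h2, ?_⟩
            obtain rfl := h2
            exact (hside _ p e.2 hp (hsrcW e he)).1 h3
          · rintro ⟨h2, h3⟩
            refine ⟨(hr _ _ (hsrcW e he)).1, h2, ?_⟩
            obtain rfl := h2
            exact (hside _ p e.2 hp (hsrcW e he)).2 h3
        simp only [this, mul_ite, mul_one, mul_zero]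
      · have : ((e.1 + 1, r (e.1 + 1) e.2) ∈ ({v ∈ V | v.1 = k ∧ v.2 < p} : Finset _)) ↔
            (e.1 = k - 1 ∧ e.2 < p) := by
          rw [Finset.mem_filter]
          constructor
          · rintro ⟨-, h2, h3⟩
            refine ⟨by simp only at h2; omega, ?_⟩
            obtain rfl := h2
            exact (hside _ p e.2 hp (htgtW e he)).1 h3
          · rintro ⟨h2, h3⟩
            have h2' : e.1 + 1 = k := by omega
            refine ⟨(hr _ _ (htgtW e he)).1, h2', ?_⟩
            obtain rfl := h2'
            exact (hside _ p e.2 hp (htgtW e he)).2 h3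
        simp only [this, mul_ite, mul_one, mul_zero]
    rw [Finset.sum_congr rfl h1, Finset.sum_add_distrib] at h0
    exact (CharTwo.add_eq_zero).1 h0
  set f : ℝ × ℝ → ZMod 2 := fun c => F ⌊c.2 - s₀⌋ c.1 with hf
  have hfk : ∀ (k : ℤ) (c : ℝ × ℝ), c ∉ W → s₀ + k ≤ c.2 → c.2 ≤ s₀ + k + 1 → f c = F k c.1 := by
    rintro k ⟨p, s⟩ hc h1 h2
    rcases h2.lt_or_eq with h2 | h2
    · have : ⌊s - s₀⌋ = k := Int.floor_eq_iff.2 ⟨by simp only at h1; linarith, by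
        simp only at h2; linarith⟩
      simp only [hf, this]
    · simp only at h2
      have : ⌊s - s₀⌋ = k + 1 := Int.floor_eq_iff.2 ⟨by push_cast; linarith, by
        push_cast; linarith⟩
      simp only [hf, this]
      rw [hlevel (k + 1) p, add_sub_cancel_right]
      convert hc using 3
      push_cast; linarith
  have hFloc : ∀ (k : ℤ) (c : ℝ × ℝ), c ∉ W → s₀ + k ≤ c.2 → c.2 ≤ s₀ + k + 1 →
      ∀ᶠ c' : ℝ × ℝ in 𝓝 c, F k c'.1 = F k c.1 := by
    rintro k ⟨p, s⟩ hc h1 h2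
    have hcont : Tendsto (fun c' : ℝ × ℝ => c'.1) (𝓝 (p, s)) (𝓝 p) :=
      continuous_fst.tendsto (p, s)
    have h3 : ∀ e ∈ E, ∀ᶠ c' : ℝ × ℝ in 𝓝 (p, s),
        (if e.1 = k ∧ e.2 < c'.1 then x e else 0) = if e.1 = k ∧ e.2 < p then x e else 0 := by
      intro e he
      by_cases hek : e.1 = k
      · have hne : e.2 ≠ p := by
          rintro rfl
          apply hc
          have := hE e he (s - (s₀ + k)) ⟨by simp only at h1; linarith, by
            simp only at h2; linarith⟩
          rw [hek] at this
          simpa using this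
        rcases hne.lt_or_gt with h | h
        · filter_upwards [hcont.eventually (lt_mem_nhds h)] with c' hc'
          simp [h, hc']
        · filter_upwards [hcont.eventually (gt_mem_nhds h)] with c' hc'
          simp [not_lt.2 h.le, not_lt.2 hc'.le]
      · simp [hek]
    have h4 := (Finset.eventually_all E).2 h3
    filter_upwards [h4] with c' hc'
    exact Finset.sum_congr rfl hc'
  have hcontf : ContinuousOn f Wᶜ := by
    intro c hc
    have : f =ᶠ[𝓝[Wᶜ] c] fun _ => f c := by
      set k := ⌊c.2 - s₀⌋ with hk
      have hk1 : s₀ + k ≤ c.2 := by have := Int.floor_le (c.2 - s₀); linarith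
      have hk2 : c.2 < s₀ + k + 1 := by have := Int.lt_floor_add_one (c.2 - s₀); linarith
      have hcont : Tendsto (fun c' : ℝ × ℝ => c'.2) (𝓝 c) (𝓝 c.2) := continuous_snd.tendsto c
      have hup : ∀ᶠ c' : ℝ × ℝ in 𝓝 c, c'.2 < s₀ + k + 1 := hcont.eventually (gt_mem_nhds hk2)
      have hF1 := hFloc k c hc hk1 hk2.le
      have hfc : f c = F k c.1 := rfl
      rcases hk1.lt_or_eq with hk3 | hk3
      · have hlo : ∀ᶠ c' : ℝ × ℝ in 𝓝 c, s₀ + k < c'.2 := hcont.eventually (lt_mem_nhds hk3)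
        filter_upwards [mem_nhdsWithin_of_mem_nhds hup, mem_nhdsWithin_of_mem_nhds hlo,
          mem_nhdsWithin_of_mem_nhds hF1, self_mem_nhdsWithin] with c' h1 h2 h3 h4
        rw [hfk k c' h4 h2.le h1.le, h3, hfc]
      · have hlo : ∀ᶠ c' : ℝ × ℝ in 𝓝 c, s₀ + k - 1 < c'.2 :=
          hcont.eventually (lt_mem_nhds (by linarith))
        have hF2 := hFloc (k - 1) c hc (by push_cast; linarith) (by push_cast; linarith)
        have hFF : F k c.1 = F (k - 1) c.1 := hlevel k c.1 (by rw [hk3]; exact hc)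
        filter_upwards [mem_nhdsWithin_of_mem_nhds hup, mem_nhdsWithin_of_mem_nhds hlo,
          mem_nhdsWithin_of_mem_nhds hF1, mem_nhdsWithin_of_mem_nhds hF2,
          self_mem_nhdsWithin] with c' h1 h2 h3 h3' h4
        rcases le_total (s₀ + k) c'.2 with h5 | h5
        · rw [hfk k c' h4 h5 h1.le, h3, hfc]
        · rw [hfk (k - 1) c' h4 (by push_cast; linarith) (by push_cast; linarith), h3', hfc, hFF]
    exact (continuousWithinAt_const (b := f c)).congr_of_eventuallyEq this rfl
  -- far above, no edge is seen, so the parity vanishes identically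
  obtain ⟨K, hK⟩ : ∃ K : ℤ, ∀ e ∈ E, e.1 < K := by
    obtain ⟨K, hK⟩ := (E.image Prod.fst).bddAbove
    exact ⟨K + 1, fun e he => Int.lt_add_one_iff.2 (hK (by
      simpa using ⟨e.2, he⟩))⟩
  have hzero : ∀ c ∉ W, f c = 0 := by
    obtain ⟨M, hM1, hM2⟩ : ∃ M : ℤ, K ≤ M ∧ B ≤ s₀ + M := by
      obtain ⟨n, hn⟩ := exists_int_gt (B - s₀)
      refine ⟨max K n, le_max_left _ _, ?_⟩
      have : (n : ℝ) ≤ ((max K n : ℤ) : ℝ) := by exact_mod_cast le_max_right K n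
      linarith
    have hfar : ((0 : ℝ), s₀ + (M : ℝ)) ∉ W := fun h => by
      have := (abs_lt.1 (hB _ h).2).2
      simp only at this
      linarith
    intro c hc
    rw [hC.constant hcontf hc hfar, hfk M _ hfar (by simp) (by simp)]
    refine Finset.sum_eq_zero fun e he => if_neg ?_
    rintro ⟨h1, -⟩
    have := hK e he
    omega
  -- next to the leftmost edge of the cycle the parity is odd
  obtain ⟨e₁, he₁, hmin⟩ := Finset.exists_min_image {e ∈ E | e.1 = e₀.1 ∧ x e ≠ 0}
    (fun e => e.2) ⟨e₀, by simp [he₀, hx₀]⟩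
  simp only [Finset.mem_filter] at he₁ hmin
  obtain ⟨he₁E, he₁k, he₁x⟩ := he₁
  set k := e₀.1 with hk
  have hone : ∀ c ∉ W, s₀ + k ≤ c.2 → c.2 ≤ s₀ + k + 1 → e₁.2 < c.1 →
      (∀ e ∈ E, e.1 = k → x e ≠ 0 → e ≠ e₁ → c.1 ≤ e.2) → False := by
    intro c hc h1 h2 h3 h4
    have h5 := hzero c hc
    rw [hfk k c hc h1 h2] at h5
    apply he₁x
    rw [← h5]
    simp only [hF]
    rw [Finset.sum_eq_single e₁]
    · simp [he₁k, h3]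
    · intro e he hne
      split_ifs with h6
      · by_contra h7
        exact absurd h6.2 (not_lt.2 (h4 e he h6.1 h7 hne))
      · rfl
    · exact fun h => absurd he₁E h
  by_cases hex : ∃ e ∈ E, e.1 = k ∧ x e ≠ 0 ∧ e ≠ e₁
  · obtain ⟨e₂', h₂'⟩ := hex
    obtain ⟨e₂, he₂, hmin₂⟩ := Finset.exists_min_image {e ∈ E | e.1 = k ∧ x e ≠ 0 ∧ e ≠ e₁}
      (fun e => e.2) ⟨e₂', by simpa using h₂'⟩
    simp only [Finset.mem_filter] at he₂ hmin₂
    obtain ⟨he₂E, he₂k, he₂x, he₂ne⟩ := he₂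
    obtain ⟨z, hz, σ, hσ, hzW⟩ := hsep e₁ he₁E e₂ he₂E (by rw [he₁k, he₂k]) he₂ne.symm
    rw [uIcc_of_le (hmin e₂ ⟨he₂E, he₂k, he₂x⟩)] at hz
    rw [he₁k] at hzW
    refine hone (z, s₀ + k + σ) hzW (by simpa using hσ.1) (by simpa using hσ.2) ?_ ?_
    · refine lt_of_le_of_ne hz.1 fun h => hzW ?_
      have := hE e₁ he₁E σ hσ
      rwa [he₁k, h] at this
    · intro e he hek hxe hne
      exact hz.2.trans (hmin₂ e ⟨he, hek, hxe, hne⟩)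
  · push Not at hex
    have hBe : e₁.2 < max B (e₁.2 + 1) := lt_max_of_lt_right (by linarith)
    refine hone (max B (e₁.2 + 1), s₀ + k) (fun h => ?_) (by simp) (by simp) hBe ?_
    · have := (abs_lt.1 (hB _ h).1).2
      exact absurd (le_max_left B (e₁.2 + 1)) (not_le.2 this)
    · intro e he hek hxe hne
      exact absurd (hex e he hek hxe) hne

/-- The set of points all of whose translates by elements of `Z` lie in `W`. -/
def erosion {E : Type*} [Add E] (W Z : Set E) : Set E := {x | ∀ z ∈ Z, x + z ∈ W}

lemma isOpen_erosion {E : Type*} [TopologicalSpace E] [Add E] [ContinuousAdd E] {W Z : Set E}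
    (hW : IsOpen W) (hZ : IsCompact Z) : IsOpen (erosion W Z) := by
  rw [isOpen_iff_mem_nhds]
  intro x hx
  refine hZ.eventually_forall_of_forall_eventually (P := fun x z => x + z ∈ W) fun z hz => ?_
  exact (continuous_add.tendsto (x, z)).eventually (hW.mem_nhds (hx z hz))

lemma lintegral_eq_lintegral_tsum_int {f : ℝ → ℝ≥0∞} (hf : Measurable f) :
    ∫⁻ s, f s = ∫⁻ s in Ioc (0 : ℝ) 1, ∑' k : ℤ, f (s + k) := by
  rw [lintegral_tsum fun k : ℤ => (by fun_prop : Measurable fun s : ℝ => f (s + k)).aemeasurable]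
  rw [← setLIntegral_univ, ← iUnion_Ioc_add_intCast (0 : ℝ),
    lintegral_iUnion (fun _ => measurableSet_Ioc) (pairwise_disjoint_Ioc_add_intCast (0 : ℝ))]
  congr 1
  ext k
  rw [← lintegral_indicator measurableSet_Ioc, ← lintegral_indicator measurableSet_Ioc,
    ← lintegral_add_right_eq_self _ (k : ℝ)]
  congr 1
  ext s
  simp only [indicator, mem_Ioc]
  congr 1
  apply propext
  constructor <;> rintro ⟨h1, h2⟩ <;> constructor <;> linarith

lemma sum_card_add_one_le_tsum_intervalCount {W : Set (ℝ × ℝ)} {B : ℝ}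
    (hB : ∀ x ∈ W, |x.1| < B ∧ |x.2| < B) (hC : IsPreconnected Wᶜ)
    (hne : ∃ x : ℝ × ℝ, ∀ σ ∈ Icc (0 : ℝ) 1, (x.1, x.2 + σ) ∈ W) (s₀ : ℝ) (K : Finset ℤ)
    (T : ℤ → Finset ℝ)
    (hT : ∀ k ∈ K, IsIntervalSeparated
      {p | ∀ σ ∈ Icc (0 : ℝ) 1, (p, s₀ + k + σ) ∈ W} (T k)) :
    ((∑ k ∈ K, (T k).card : ℕ) : ℝ≥0∞) + 1 ≤
      ∑' k : ℤ, intervalCount {p | (p, s₀ + (k : ℝ)) ∈ W} := by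
  by_cases htop : ∑' k : ℤ, intervalCount {p | (p, s₀ + (k : ℝ)) ∈ W} = ⊤
  · simp [htop]
  have hfin := ENNReal.ne_top_of_tsum_ne_top htop
  choose V hVsep hVcard using fun k => exists_separated_card_eq (hfin k)
  have hrep : ∀ (k : ℤ) (p : ℝ), ∃ t, (p, s₀ + (k : ℝ)) ∈ W →
      t ∈ V k ∧ ∀ z ∈ uIcc p t, (z, s₀ + (k : ℝ)) ∈ W := by
    intro k p
    by_cases hp : (p, s₀ + (k : ℝ)) ∈ W
    · obtain ⟨t, ht, hsub⟩ := (hVsep k).exists_uIcc_subset (hVcard k) hp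
      exact ⟨t, fun _ => ⟨ht, hsub⟩⟩
    · exact ⟨0, fun h => absurd h hp⟩
  choose r hr using hrep
  set I : Finset ℤ := Finset.Icc ⌊-B - s₀⌋ ⌈B - s₀⌉ with hI
  have hmemI : ∀ (k : ℤ) (p : ℝ), (p, s₀ + (k : ℝ)) ∈ W → k ∈ I := by
    intro k p hp
    have h := abs_lt.1 (hB _ hp).2
    simp only at h
    rw [hI, Finset.mem_Icc]
    constructor
    · have := Int.floor_le (-B - s₀)
      exact_mod_cast (show ((⌊-B - s₀⌋ : ℤ) : ℝ) ≤ k by linarith)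
    · have := Int.le_ceil (B - s₀)
      exact_mod_cast (show (k : ℝ) ≤ ((⌈B - s₀⌉ : ℤ) : ℝ) by linarith)
  have hinj : Function.Injective fun x : (_ : ℤ) × ℝ => (x.1, x.2) := by
    rintro ⟨a, b⟩ ⟨c, d⟩ h
    simp only [Prod.mk.injEq] at h
    obtain ⟨rfl, rfl⟩ := h
    rfl
  set VV : Finset (ℤ × ℝ) := (I.sigma V).image fun x => (x.1, x.2) with hVV
  set EE : Finset (ℤ × ℝ) := (K.sigma T).image fun x => (x.1, x.2) with hEE
  have hVVcard : VV.card = ∑ k ∈ I, (V k).card := by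
    rw [hVV, Finset.card_image_of_injective _ hinj, Finset.card_sigma]
  have hEEcard : EE.card = ∑ k ∈ K, (T k).card := by
    rw [hEE, Finset.card_image_of_injective _ hinj, Finset.card_sigma]
  have hVVmem : ∀ k p, (k, p) ∈ VV ↔ k ∈ I ∧ p ∈ V k := by
    intro k p
    simp only [hVV, Finset.mem_image, Finset.mem_sigma, Prod.mk.injEq]
    exact ⟨by rintro ⟨⟨a, b⟩, h, rfl, rfl⟩; exact h, fun h => ⟨⟨k, p⟩, h, rfl, rfl⟩⟩
  have hEEmem : ∀ k p, (k, p) ∈ EE ↔ k ∈ K ∧ p ∈ T k := by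
    intro k p
    simp only [hEE, Finset.mem_image, Finset.mem_sigma, Prod.mk.injEq]
    exact ⟨by rintro ⟨⟨a, b⟩, h, rfl, rfl⟩; exact h, fun h => ⟨⟨k, p⟩, h, rfl, rfl⟩⟩
  have hrV : ∀ (k : ℤ) (p : ℝ), (p, s₀ + (k : ℝ)) ∈ W →
      (k, r k p) ∈ VV ∧ ∀ z ∈ uIcc p (r k p), (z, s₀ + (k : ℝ)) ∈ W := fun k p hp =>
    ⟨(hVVmem _ _).2 ⟨hmemI k p hp, (hr k p hp).1⟩, (hr k p hp).2⟩
  have main : EE.card + 1 ≤ VV.card := by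
    refine card_edges_lt_card_vertices hB hC s₀ EE VV ?_ ?_ r hrV ?_
    · rintro ⟨k, p⟩ he σ hσ
      obtain ⟨hk, hp⟩ := (hEEmem k p).1 he
      exact (hT k hk).1 p hp σ hσ
    · rintro ⟨k, p⟩ he ⟨k', q⟩ he' hkk hne
      obtain rfl : k = k' := hkk
      obtain ⟨hk, hp⟩ := (hEEmem k p).1 he
      obtain ⟨-, hq⟩ := (hEEmem k q).1 he'
      have := (hT k hk).2 p hp q hq (fun h => hne (by rw [h]))
      rw [not_subset] at this
      obtain ⟨z, hz, hzW⟩ := this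
      simp only [mem_ofPred_eq] at hzW
      push Not at hzW
      obtain ⟨σ, hσ, h⟩ := hzW
      exact ⟨z, hz, σ, hσ, h⟩
    · obtain ⟨x, hx⟩ := hne
      set k := ⌈x.2 - s₀⌉ with hk
      have h1 := Int.le_ceil (x.2 - s₀)
      have h2 := Int.ceil_lt_add_one (x.2 - s₀)
      have := hx (s₀ + k - x.2) ⟨by linarith, by linarith⟩
      rw [add_sub_cancel] at this
      exact ⟨_, (hrV k x.1 this).1⟩
  rw [hVVcard, hEEcard] at main
  calc ((∑ k ∈ K, (T k).card : ℕ) : ℝ≥0∞) + 1 ≤ ((∑ k ∈ I, (V k).card : ℕ) : ℝ≥0∞) := by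
        exact_mod_cast main
    _ = ∑ k ∈ I, intervalCount {p | (p, s₀ + (k : ℝ)) ∈ W} := by
        push_cast
        exact Finset.sum_congr rfl fun k _ => hVcard k
    _ ≤ _ := ENNReal.sum_le_tsum I

/-- Erosion by a transversal segment decreases the total number of intervals in the slices by
at least the height of the segment. -/
theorem lintegral_intervalCount_erosion_add_one_le {W : Set (ℝ × ℝ)} (hW : IsOpen W) {B : ℝ}
    (hB : ∀ x ∈ W, |x.1| < B ∧ |x.2| < B) (hC : IsPreconnected Wᶜ)
    (hne : ∃ x : ℝ × ℝ, ∀ σ ∈ Icc (0 : ℝ) 1, (x.1, x.2 + σ) ∈ W) :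
    (∫⁻ s, intervalCount {p | ∀ σ ∈ Icc (0 : ℝ) 1, (p, s + σ) ∈ W}) + 1 ≤
      ∫⁻ s, intervalCount {p | (p, s) ∈ W} := by
  have hopen : IsOpen {x : ℝ × ℝ | ∀ σ ∈ Icc (0 : ℝ) 1, (x.1, x.2 + σ) ∈ W} := by
    convert isOpen_erosion hW (isCompact_Icc.image
      (by fun_prop : Continuous fun σ : ℝ => ((0 : ℝ), σ)) : IsCompact (_ '' Icc (0 : ℝ) 1))
      using 1
    ext x
    simp only [erosion, mem_ofPred_eq, forall_mem_image]
    simp [Prod.add_def]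
  have hM := measurable_intervalCount_slice hopen
  have hN := measurable_intervalCount_slice hW
  simp only [mem_ofPred_eq] at hM
  rw [lintegral_eq_lintegral_tsum_int hM, lintegral_eq_lintegral_tsum_int hN]
  have hone : (1 : ℝ≥0∞) = ∫⁻ s in Ioc (0 : ℝ) 1, 1 := by simp
  rw [hone, ← lintegral_add_right _ measurable_const]
  refine lintegral_mono fun s => ?_
  simp only
  by_cases htop : ∑' k : ℤ, intervalCount {p | (p, s + (k : ℝ)) ∈ W} = ⊤
  · simp [htop]
  have key := sum_card_add_one_le_tsum_intervalCount hB hC hne s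
  have hfin : ∀ k : ℤ,
      intervalCount {p | ∀ σ ∈ Icc (0 : ℝ) 1, (p, s + (k : ℝ) + σ) ∈ W} ≠ ⊤ := by
    intro k
    refine ne_top_of_le_ne_top htop (iSup₂_le fun T hT => ?_)
    have := key {k} (fun _ => T) (fun j hj => by
      rw [Finset.mem_singleton] at hj
      rwa [hj])
    rw [Finset.sum_singleton] at this
    exact le_self_add.trans this
  choose T hTsep hTcard using fun k => exists_separated_card_eq (hfin k)
  rw [ENNReal.tsum_eq_iSup_sum, ENNReal.iSup_add]
  refine iSup_le fun K => ?_
  have := key K T fun k _ => hTsep k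
  push_cast at this
  simp_rw [hTcard] at this
  exact this

/-- The determinant of two plane vectors. -/
def cross (v x : Eu 2) : ℝ := v 0 * x 1 - v 1 * x 0

lemma cross_add_right (v x y : Eu 2) : cross v (x + y) = cross v x + cross v y := by
  simp [cross]; ring

lemma cross_sub_right (v x y : Eu 2) : cross v (x - y) = cross v x - cross v y := by
  simp [cross]; ring

lemma cross_smul_right (v x : Eu 2) (c : ℝ) : cross v (c • x) = c * cross v x := by
  simp [cross]; ring

lemma cross_smul_left (v x : Eu 2) (c : ℝ) : cross (c • v) x = c * cross v x := by
  simp [cross]; ring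

lemma planeCross_self (v : Eu 2) : cross v v = 0 := by simp [cross]; ring

lemma cross_comm (v u : Eu 2) : cross v u = -cross u v := by simp [cross]; ring

lemma continuous_cross (v : Eu 2) : Continuous (cross v) := by unfold cross; fun_prop

lemma ne_zero_of_cross_ne_zero {v u : Eu 2} (h : cross v u ≠ 0) : v ≠ 0 := by
  rintro rfl; simp [cross] at h

/-- The coordinates of a vector in a basis of the plane. -/
lemma smul_add_smul_eq {v u : Eu 2} (h : cross v u ≠ 0) (x : Eu 2) :
    (cross x u / cross v u) • v + (cross v x / cross v u) • u = x := by
  ext i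
  fin_cases i
  · simp
    field_simp
    simp [cross]; ring
  · simp
    field_simp
    simp [cross]; ring

/-- A vector orthogonal to `v` whose determinant with `v` is one. -/
def normalDual (v : Eu 2) : Eu 2 := (‖v‖ ^ 2)⁻¹ • !₂[-v 1, v 0]

lemma norm_sq_eq_two (v : Eu 2) : ‖v‖ ^ 2 = v 0 ^ 2 + v 1 ^ 2 := by
  rw [EuclideanSpace.norm_sq_eq]
  simp [Fin.sum_univ_two]

lemma cross_normalDual {v : Eu 2} (hv : v ≠ 0) : cross v (normalDual v) = 1 := by
  have h1 : ‖v‖ ^ 2 ≠ 0 := by simpa using hv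
  have h2 := norm_sq_eq_two v
  simp [cross, normalDual]
  field_simp
  rw [h2]

/-- The total number of intervals in which the lines parallel to `v` meet `W`. -/
def sliceCount (W : Set (Eu 2)) (v : Eu 2) : ℝ≥0∞ :=
  ∫⁻ s : ℝ, intervalCount {p : ℝ | p • v + s • normalDual v ∈ W}

lemma sliceCount_eq_mul_lintegral {W : Set (Eu 2)} (v u : Eu 2)
    (h : cross v u ≠ 0) :
    sliceCount W v =
      ENNReal.ofReal |cross v u| * ∫⁻ s : ℝ, intervalCount {p : ℝ | p • v + s • u ∈ W} := by
  have hv := ne_zero_of_cross_ne_zero h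
  have hd := cross_normalDual hv
  have hu := smul_add_smul_eq (v := v) (u := normalDual v) (by rw [hd]; exact one_ne_zero) u
  rw [hd, div_one, div_one] at hu
  have h1 : ∀ s : ℝ, intervalCount {p : ℝ | p • v + s • u ∈ W} =
      intervalCount {p : ℝ | p • v + (s * cross v u) • normalDual v ∈ W} := by
    intro s
    rw [← intervalCount_preimage_add {p : ℝ | p • v + (s * cross v u) • normalDual v ∈ W}
      (s * cross u (normalDual v))]
    congr 1
    ext p
    simp only [mem_ofPred_eq]
    have : p • v + s • u = (p + s * cross u (normalDual v)) • v +
        (s * cross v u) • normalDual v := by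
      conv_lhs => rw [← hu]
      module
    rw [this]
  simp_rw [h1]
  have hme : MeasurableEmbedding fun s : ℝ => s * cross v u :=
    (Homeomorph.mulRight₀ _ h).measurableEmbedding
  rw [← hme.lintegral_map (μ := volume)
    (fun s => intervalCount {p : ℝ | p • v + s • normalDual v ∈ W}),
    ← smul_eq_mul, ← lintegral_smul_measure, Real.smul_map_volume_mul_right h]
  rfl

lemma volume_eq_lintegral_slice {v w : Eu 2} (h : cross v w = 1) {A : Set (Eu 2)}
    (hA : MeasurableSet A) : volume A = ∫⁻ s : ℝ, volume {p : ℝ | p • v + s • w ∈ A} := by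
  let L : Eu 2 →ₗ[ℝ] Eu 2 :=
    { toFun := fun x => x 0 • v + x 1 • w
      map_add' := fun x y => by simp only [PiLp.add_apply]; module
      map_smul' := fun c x => by simp only [PiLp.smul_apply, smul_eq_mul, RingHom.id_apply]; module }
  have hL : LinearMap.det L = 1 := by
    rw [← LinearMap.det_toMatrix (EuclideanSpace.basisFun (Fin 2) ℝ).toBasis, Matrix.det_fin_two]
    simp only [LinearMap.toMatrix_apply]
    simp [L]
    rw [← h, cross]; ring
  have h1 : volume A = volume (L ⁻¹' A) := by
    rw [Measure.addHaar_preimage_linearMap _ (by rw [hL]; exact one_ne_zero), hL]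
    simp
  have hLc : Continuous L := L.continuous_of_finiteDimensional
  have hm : MeasurePreserving (fun x : ℝ × ℝ => (WithLp.toLp 2 ![x.1, x.2] : Eu 2)) :=
    (PiLp.volume_preserving_toLp (Fin 2)).comp (volume_preserving_finTwoArrow ℝ).symm
  rw [h1, ← hm.measure_preimage (hLc.measurable hA).nullMeasurableSet]
  rw [Measure.volume_eq_prod, Measure.prod_apply_symm
    (hm.measurable (hLc.measurable hA))]
  rfl

/-- The segment from the origin to `u`. -/
def unitSegment (u : Eu 2) : Set (Eu 2) := (fun σ : ℝ => σ • u) '' Icc 0 1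

lemma isCompact_unitSegment (u : Eu 2) : IsCompact (unitSegment u) :=
  isCompact_Icc.image (by fun_prop)

lemma zero_mem_unitSegment (u : Eu 2) : 0 ∈ unitSegment u := ⟨0, by simp, by simp⟩

lemma isPreconnected_unitSegment (u : Eu 2) : IsPreconnected (unitSegment u) :=
  isPreconnected_Icc.image _ (by fun_prop)

lemma erosion_subset {W Z : Set (Eu 2)} (hZ : 0 ∈ Z) : erosion W Z ⊆ W := fun x hx => by
  simpa using hx 0 hZ

lemma isPreconnected_compl_erosion {W Z : Set (Eu 2)} (hW : IsPreconnected Wᶜ)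
    (hZ : IsPreconnected Z) : IsPreconnected (erosion W Z)ᶜ := by
  have : (erosion W Z)ᶜ = (fun x : Eu 2 × Eu 2 => x.1 - x.2) '' (Wᶜ ×ˢ Z) := by
    ext x
    simp only [erosion, mem_compl_iff, mem_ofPred_eq, mem_image, mem_prod, Prod.exists]
    push Not
    constructor
    · rintro ⟨z, hz, h⟩
      exact ⟨x + z, z, ⟨h, hz⟩, by simp⟩
    · rintro ⟨c, z, ⟨hc, hz⟩, rfl⟩
      exact ⟨z, hz, by simpa using hc⟩
  rw [this]
  exact (hW.prod hZ).image _ (by fun_prop)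

lemma erosion_add (W Z₁ Z₂ : Set (Eu 2)) :
    erosion W (Set.image2 (· + ·) Z₁ Z₂) = erosion (erosion W Z₁) Z₂ := by
  ext x
  simp only [erosion, mem_ofPred_eq, forall_mem_image2]
  constructor
  · intro h z₂ h₂ z₁ h₁
    rw [add_assoc, add_comm z₂]
    exact h z₁ h₁ z₂ h₂
  · intro h z₁ h₁ z₂ h₂
    rw [add_comm z₁, ← add_assoc]
    exact h z₂ h₂ z₁ h₁

theorem sliceCount_erosion_add_le {W : Set (Eu 2)} (hW : IsOpen W)
    (hb : Bornology.IsBounded W) (hC : IsPreconnected Wᶜ) {v u : Eu 2} (h : cross v u ≠ 0)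
    (hne : (erosion W (unitSegment u)).Nonempty) :
    sliceCount (erosion W (unitSegment u)) v + ENNReal.ofReal |cross v u| ≤ sliceCount W v := by
  rw [sliceCount_eq_mul_lintegral v u h, sliceCount_eq_mul_lintegral v u h]
  set φ : ℝ × ℝ → Eu 2 := fun x => x.1 • v + x.2 • u with hφ
  set ψ : Eu 2 → ℝ × ℝ := fun x => (cross x u / cross v u, cross v x / cross v u) with hψ
  have hφc : Continuous φ := by fun_prop
  have hψc : Continuous ψ := by
    simp only [hψ, cross]
    fun_prop
  have hφψ : ∀ x, φ (ψ x) = x := fun x => smul_add_smul_eq h x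
  have hψφ : ∀ x, ψ (φ x) = x := by
    rintro ⟨p, s⟩
    have h1 : cross (p • v + s • u) u = p * cross v u := by simp [cross]; ring
    have h2 : cross v (p • v + s • u) = s * cross v u := by simp [cross]; ring
    simp only [hφ, hψ, h1, h2, mul_div_cancel_right₀ _ h]
  have himg : ∀ A : Set (Eu 2), φ ⁻¹' A = ψ '' A := fun A =>
    (congrFun (image_eq_preimage_of_inverse hφψ hψφ) A).symm
  obtain ⟨B, hB⟩ : ∃ B : ℝ, ∀ x ∈ φ ⁻¹' W, |x.1| < B ∧ |x.2| < B := by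
    have h1 : Bornology.IsBounded (ψ '' closure W) :=
      (hb.isCompact_closure.image hψc).isBounded
    obtain ⟨B, hB⟩ := h1.exists_norm_le
    refine ⟨B + 1, fun x hx => ?_⟩
    have h2 := hB x ⟨φ x, subset_closure hx, hψφ x⟩
    have h3 := norm_fst_le x
    have h4 := norm_snd_le x
    rw [Real.norm_eq_abs] at h3 h4
    constructor <;> linarith
  have hC' : IsPreconnected (φ ⁻¹' W)ᶜ := by
    rw [← preimage_compl, himg]
    exact hC.image _ hψc.continuousOn
  have hslice : ∀ (p s : ℝ), p • v + s • u ∈ erosion W (unitSegment u) ↔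
      ∀ σ ∈ Icc (0 : ℝ) 1, (p, s + σ) ∈ φ ⁻¹' W := by
    intro p s
    simp only [erosion, unitSegment, mem_ofPred_eq, forall_mem_image, mem_preimage, hφ]
    refine forall₂_congr fun σ _ => ?_
    rw [add_assoc, add_smul]
  have hne' : ∃ x : ℝ × ℝ, ∀ σ ∈ Icc (0 : ℝ) 1, (x.1, x.2 + σ) ∈ φ ⁻¹' W := by
    obtain ⟨x, hx⟩ := hne
    refine ⟨ψ x, ?_⟩
    rw [← hslice]
    rwa [show (ψ x).1 • v + (ψ x).2 • u = x from hφψ x]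
  have key := lintegral_intervalCount_erosion_add_one_le (hW.preimage hφc) hB hC' hne'
  simp_rw [hslice]
  calc _ = ENNReal.ofReal |cross v u| *
        ((∫⁻ s, intervalCount {p | ∀ σ ∈ Icc (0 : ℝ) 1, (p, s + σ) ∈ φ ⁻¹' W}) + 1) := by
        rw [mul_add, mul_one]
    _ ≤ _ := mul_le_mul_right key _

theorem volume_le_volume_erosion_add_sliceCount {W : Set (Eu 2)} (hW : IsOpen W)
    (hb : Bornology.IsBounded W) {v : Eu 2} (hv : v ≠ 0) :
    volume W ≤ volume (erosion W (unitSegment v)) + sliceCount W v := by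
  have hE := isOpen_erosion hW (isCompact_unitSegment v)
  have hsub : erosion W (unitSegment v) ⊆ W := erosion_subset (zero_mem_unitSegment v)
  rw [← union_sdiff_cancel hsub]
  refine (measure_union_le _ _).trans ?_
  rw [union_sdiff_cancel hsub]
  gcongr
  rw [volume_eq_lintegral_slice (cross_normalDual hv) (hW.measurableSet.diff hE.measurableSet)]
  refine lintegral_mono fun s => ?_
  obtain ⟨B, hB⟩ := hb.exists_norm_le
  have hbd : BddAbove {p : ℝ | p • v + s • normalDual v ∈ W} := by
    refine ⟨(B + ‖s • normalDual v‖) / ‖v‖, fun p hp => ?_⟩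
    rw [le_div_iff₀ (norm_pos_iff.2 hv)]
    have h1 := hB _ hp
    have h2 : ‖p • v‖ ≤ ‖p • v + s • normalDual v‖ + ‖s • normalDual v‖ := by
      simpa using norm_sub_le (p • v + s • normalDual v) (s • normalDual v)
    rw [norm_smul, Real.norm_eq_abs] at h2
    have h3 := mul_le_mul_of_nonneg_right (le_abs_self p) (norm_nonneg v)
    linarith
  refine le_trans (measure_mono ?_) (volume_diff_le_intervalCount hbd)
  rintro p ⟨hp, hp'⟩
  refine ⟨hp, fun hI => hp' ?_⟩
  rintro _ ⟨σ, hσ, rfl⟩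
  have := hI (show p + σ ∈ Icc p (p + 1) from ⟨by linarith [hσ.1], by linarith [hσ.2]⟩)
  simp only [mem_ofPred_eq] at this
  convert this using 1
  module

/-- The sum of the absolute determinants of the pairs in a list of vectors. -/
def pairCrossSum : List (Eu 2) → ℝ
  | [] => 0
  | u :: l => (l.map fun v => |cross v u|).sum + pairCrossSum l

/-- The Minkowski sum of the segments from the origin to the vectors of a list. -/
def zonotope : List (Eu 2) → Set (Eu 2)
  | [] => {0}
  | u :: l => Set.image2 (· + ·) (unitSegment u) (zonotope l)

lemma zero_mem_zonotope (l : List (Eu 2)) : 0 ∈ zonotope l := by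
  induction l with
  | nil => exact mem_singleton 0
  | cons u l ih => exact ⟨0, zero_mem_unitSegment u, 0, ih, by simp⟩

theorem volume_add_pairCrossSum_le (l : List (Eu 2)) (hl : l.Pairwise fun u v => cross v u ≠ 0)
    (h0 : ∀ u ∈ l, u ≠ 0) {W : Set (Eu 2)} (hW : IsOpen W) (hb : Bornology.IsBounded W)
    (hC : IsPreconnected Wᶜ) (hne : (erosion W (zonotope l)).Nonempty) :
    volume W + ENNReal.ofReal (pairCrossSum l) ≤
      volume (erosion W (zonotope l)) + (l.map (sliceCount W)).sum := by
  induction l generalizing W with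
  | nil => simp [pairCrossSum, zonotope, erosion]
  | cons u l ih =>
    rw [List.pairwise_cons] at hl
    simp only [zonotope, erosion_add] at hne ⊢
    set W₁ := erosion W (unitSegment u) with hW₁
    have hsub : W₁ ⊆ W := erosion_subset (zero_mem_unitSegment u)
    have hne₁ : W₁.Nonempty := hne.mono (erosion_subset (zero_mem_zonotope l))
    have h1 := ih hl.2 (fun v hv => h0 v (List.mem_cons_of_mem _ hv))
      (isOpen_erosion hW (isCompact_unitSegment u)) (hb.subset hsub)
      (isPreconnected_compl_erosion hC (isPreconnected_unitSegment u)) hne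
    have h2 := volume_le_volume_erosion_add_sliceCount hW hb (h0 u (by simp))
    have h3 : (l.map (sliceCount W₁)).sum +
        ENNReal.ofReal (l.map fun v => |cross v u|).sum ≤ (l.map (sliceCount W)).sum := by
      have : ∀ l' : List (Eu 2), (∀ v ∈ l', cross v u ≠ 0) → (l'.map (sliceCount W₁)).sum +
          ENNReal.ofReal (l'.map fun v => |cross v u|).sum ≤ (l'.map (sliceCount W)).sum := by
        intro l' hl'
        induction l' with
        | nil => simp
        | cons v l' ih' =>
          simp only [List.map_cons, List.sum_cons]
          have h4 := sliceCount_erosion_add_le hW hb hC (hl' v (by simp)) hne₁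
          have h5 := ih' fun w hw => hl' w (List.mem_cons_of_mem _ hw)
          calc _ ≤ sliceCount W₁ v + (l'.map (sliceCount W₁)).sum + (ENNReal.ofReal |cross v u| +
                ENNReal.ofReal (l'.map fun v => |cross v u|).sum) := by
                gcongr; exact ENNReal.ofReal_add_le
            _ = (sliceCount W₁ v + ENNReal.ofReal |cross v u|) + ((l'.map (sliceCount W₁)).sum +
                ENNReal.ofReal (l'.map fun v => |cross v u|).sum) := by ring
            _ ≤ _ := add_le_add h4 h5
      exact this l hl.1
    simp only [List.map_cons, List.sum_cons, pairCrossSum]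
    calc _ ≤ (volume W₁ + sliceCount W u) + (ENNReal.ofReal (l.map fun v => |cross v u|).sum +
          ENNReal.ofReal (pairCrossSum l)) := by
          gcongr; exact ENNReal.ofReal_add_le
      _ = (volume W₁ + ENNReal.ofReal (pairCrossSum l)) + sliceCount W u +
          ENNReal.ofReal (l.map fun v => |cross v u|).sum := by ring
      _ ≤ (volume (erosion W₁ (zonotope l)) + (l.map (sliceCount W₁)).sum) + sliceCount W u +
          ENNReal.ofReal (l.map fun v => |cross v u|).sum := by gcongr
      _ = volume (erosion W₁ (zonotope l)) + (sliceCount W u + ((l.map (sliceCount W₁)).sum +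
          ENNReal.ofReal (l.map fun v => |cross v u|).sum)) := by ring
      _ ≤ _ := by gcongr

lemma subset_of_disjoint_frontier {X : Type*} [TopologicalSpace X] {U S : Set X} (hU : IsOpen U)
    (hS : IsPreconnected S) (hd : Disjoint S (frontier U)) (hne : (S ∩ U).Nonempty) : S ⊆ U := by
  refine hS.subset_left_of_subset_union hU isClosed_closure.isOpen_compl
    (disjoint_compl_right.mono_left subset_closure) (fun x hx => ?_) hne
  by_cases hxU : x ∈ U
  · exact Or.inl hxU
  · refine Or.inr fun hc => disjoint_left.1 hd hx ?_
    rw [hU.frontier_eq]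
    exact ⟨hc, hxU⟩

lemma isPreconnected_compl_closedBall {r : ℝ} (hr : 0 ≤ r) :
    IsPreconnected (closedBall (0 : Eu 2) r)ᶜ := by
  have hrank : 1 < Module.rank ℝ (Eu 2) := by
    rw [← Module.finrank_eq_rank]
    simp
  have h : (closedBall (0 : Eu 2) r)ᶜ =
      (fun x : ℝ × Eu 2 => x.1 • x.2) '' (Ioi r ×ˢ sphere (0 : Eu 2) 1) := by
    ext x
    simp only [mem_compl_iff, mem_closedBall, dist_zero_right, not_le, mem_image, mem_prod,
      mem_Ioi, mem_sphere, Prod.exists]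
    constructor
    · intro hx
      have hx0 : ‖x‖ ≠ 0 := (hr.trans_lt hx).ne'
      refine ⟨‖x‖, ‖x‖⁻¹ • x, ⟨hx, ?_⟩, ?_⟩
      · rw [norm_smul, norm_inv, norm_norm, inv_mul_cancel₀ hx0]
      · rw [smul_smul, mul_inv_cancel₀ hx0, one_smul]
    · rintro ⟨a, y, ⟨ha, hy⟩, rfl⟩
      rw [norm_smul, hy, mul_one, Real.norm_eq_abs]
      exact ha.trans_le (le_abs_self a)
  rw [h]
  exact (isPreconnected_Ioi.prod (isPreconnected_sphere hrank 0 1)).image _ (by fun_prop)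

lemma exists_compl_closedBall_subset_unboundedPart {Ω : Set (Eu 2)}
    (hb : Bornology.IsBounded Ω) :
    ∃ r, (closedBall (0 : Eu 2) r)ᶜ ⊆ unboundedPart Ω ∧ IsPreconnected (unboundedPart Ω) ∧
      IsOpen (unboundedPart Ω) ∧ (unboundedPart Ω).Nonempty := by
  obtain ⟨r₀, hr₀⟩ := hb.closure.subset_closedBall (0 : Eu 2)
  set r := max r₀ 0
  have hr : closure Ω ⊆ closedBall 0 r := hr₀.trans (closedBall_subset_closedBall (le_max_left _ _))
  set K := (closedBall (0 : Eu 2) r)ᶜ with hK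
  have hKp : IsPreconnected K := isPreconnected_compl_closedBall (le_max_right _ _)
  have hKF : K ⊆ (closure Ω)ᶜ := compl_subset_compl.2 hr
  have hKu : ¬ Bornology.IsBounded K := by
    intro h
    refine NormedSpace.unbounded_univ ℝ (Eu 2) ?_
    rw [← compl_union_self (closedBall (0 : Eu 2) r)]
    exact h.union isBounded_closedBall
  have hcomp : ∀ x ∈ K, K ⊆ connectedComponentIn (closure Ω)ᶜ x := fun x hx =>
    hKp.subset_connectedComponentIn hx hKF
  have hKne : K.Nonempty := nonempty_iff_ne_empty.2 fun h => hKu (by rw [h]; exact Bornology.isBounded_empty)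
  obtain ⟨x₀, hx₀⟩ := hKne
  have hUeq : unboundedPart Ω = connectedComponentIn (closure Ω)ᶜ x₀ := by
    ext x
    constructor
    · rintro ⟨hx, hxu⟩
      obtain ⟨y, hy, hyK⟩ : ∃ y ∈ connectedComponentIn (closure Ω)ᶜ x, y ∈ K := by
        by_contra! hcon
        refine hxu ((isBounded_closedBall (x := (0 : Eu 2)) (r := r)).subset fun y hy => ?_)
        simpa [hK] using hcon y hy
      have h1 := connectedComponentIn_eq hy
      have h2 := connectedComponentIn_eq (hcomp y hyK hx₀)
      rw [← h2, ← h1]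
      exact mem_connectedComponentIn hx
    · intro hx
      refine ⟨connectedComponentIn_subset _ _ hx, fun h => hKu (h.subset ?_)⟩
      rw [← connectedComponentIn_eq hx]
      exact hcomp x₀ hx₀
  refine ⟨r, ?_, ?_, ?_, ?_⟩
  · rw [hUeq]; exact hcomp x₀ hx₀
  · rw [hUeq]; exact isPreconnected_connectedComponentIn
  · rw [hUeq]; exact isClosed_closure.isOpen_compl.connectedComponentIn
  · rw [hUeq]; exact ⟨x₀, hcomp x₀ hx₀ hx₀⟩

lemma disjoint_unboundedPart_closure (Ω : Set (Eu 2)) :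
    Disjoint (unboundedPart Ω) (closure Ω) :=
  disjoint_left.2 fun _ hx => hx.1

lemma outerBoundary_subset_frontier {Ω : Set (Eu 2)} (hΩ : IsOpen Ω)
    (hb : Bornology.IsBounded Ω) : outerBoundary Ω ⊆ frontier Ω := by
  obtain ⟨-, -, -, hU, -⟩ := exists_compl_closedBall_subset_unboundedPart hb
  intro p hp
  rw [outerBoundary, hU.frontier_eq] at hp
  rw [hΩ.frontier_eq]
  constructor
  · by_contra hpc
    have ho : IsOpen (connectedComponentIn (closure Ω)ᶜ p) :=
      isClosed_closure.isOpen_compl.connectedComponentIn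
    obtain ⟨z, hz, hzU⟩ := mem_closure_iff.1 hp.1 _ ho (mem_connectedComponentIn hpc)
    refine hp.2 ⟨hpc, ?_⟩
    rw [connectedComponentIn_eq hz]
    exact hzU.2
  · intro hpΩ
    obtain ⟨z, hz, hzU⟩ := mem_closure_iff.1 hp.1 _ hΩ hpΩ
    exact hzU.1 (subset_closure hz)

lemma subset_innerRegion {Ω : Set (Eu 2)} (hΩ : IsOpen Ω) : Ω ⊆ innerRegion Ω := by
  refine subset_compl_iff_disjoint_right.2 ?_
  exact (((disjoint_unboundedPart_closure Ω).mono_right subset_closure).symm.closure_right hΩ)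

lemma frontier_innerRegion_subset (Ω : Set (Eu 2)) :
    frontier (innerRegion Ω) ⊆ outerBoundary Ω := by
  rw [innerRegion, frontier_compl]
  exact frontier_closure_subset

lemma isOpen_innerRegion (Ω : Set (Eu 2)) : IsOpen (innerRegion Ω) :=
  isClosed_closure.isOpen_compl

lemma isBounded_innerRegion {Ω : Set (Eu 2)} (hb : Bornology.IsBounded Ω) :
    Bornology.IsBounded (innerRegion Ω) := by
  obtain ⟨r, hr, -⟩ := exists_compl_closedBall_subset_unboundedPart hb
  refine (isBounded_closedBall (x := (0 : Eu 2)) (r := r)).subset fun x hx => ?_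
  by_contra h
  exact hx (subset_closure (hr h))

lemma isPreconnected_compl_innerRegion {Ω : Set (Eu 2)} (hb : Bornology.IsBounded Ω) :
    IsPreconnected (innerRegion Ω)ᶜ := by
  obtain ⟨r, -, h, -⟩ := exists_compl_closedBall_subset_unboundedPart hb
  rw [innerRegion, compl_compl]
  exact h.closure

lemma disjoint_innerRegion_outerBoundary (Ω : Set (Eu 2)) :
    Disjoint (innerRegion Ω) (outerBoundary Ω) :=
  disjoint_left.2 fun _ hx hx' => hx (frontier_subset_closure hx')

/-- A boundary point of `U` near which the boundary is crossed at most once by each line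
parallel to `v` has points of `U` arbitrarily close on the line through it. -/
lemma exists_mem_or_mem_of_transversal {U Γ : Set (Eu 2)} (hU : IsOpen U) (hΓ : IsClosed Γ)
    (hUΓ : frontier U ⊆ Γ) (hd : Disjoint U Γ) {v p : Eu 2} (hv : v ≠ 0) (hp : p ∈ frontier U)
    {r : ℝ} (hr : 0 < r)
    (hs : ∀ q ∈ Γ ∩ ball p r, ∀ q' ∈ Γ ∩ ball p r, q ≠ q' → cross v (q - q') ≠ 0) :
    ∃ δ₀ : ℝ, 0 < δ₀ ∧ ∀ δ : ℝ, 0 < δ → δ < δ₀ → p + δ • v ∈ U ∨ p - δ • v ∈ U := by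
  have hv' : 0 < ‖v‖ := norm_pos_iff.2 hv
  refine ⟨r / (2 * ‖v‖), by positivity, fun δ hδ hδr => ?_⟩
  have hδr' : δ * ‖v‖ < r / 2 := by
    rw [lt_div_iff₀ (by positivity)] at hδr
    linarith
  have hpΓ : p ∈ Γ := hUΓ hp
  have hcv : ∀ c : ℝ, cross v (c • v) = 0 := fun c => by
    rw [cross_smul_right, planeCross_self, mul_zero]
  have hout : ∀ c : ℝ, c ≠ 0 → |c| * ‖v‖ < r → p + c • v ∉ Γ := by
    intro c hc hcr hmem
    refine hs (p + c • v) ⟨hmem, ?_⟩ p ⟨hpΓ, mem_ball_self hr⟩ ?_ ?_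
    · simpa [norm_smul] using hcr
    · simpa [hv] using hc
    · rw [add_sub_cancel_left, hcv]
  have h1 : p + δ • v ∈ Γᶜ := hout δ hδ.ne' (by rw [abs_of_pos hδ]; linarith)
  have h2 : p - δ • v ∈ Γᶜ := by
    have := hout (-δ) (neg_ne_zero.2 hδ.ne') (by rw [abs_neg, abs_of_pos hδ]; linarith)
    rwa [neg_smul, ← sub_eq_add_neg] at this
  obtain ⟨η₁, hη₁, hb₁⟩ := Metric.isOpen_iff.1 hΓ.isOpen_compl _ h1
  obtain ⟨η₂, hη₂, hb₂⟩ := Metric.isOpen_iff.1 hΓ.isOpen_compl _ h2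
  set η := min (min η₁ η₂) (r / 2) with hη
  have hηpos : 0 < η := by positivity
  obtain ⟨z, hz, hzU⟩ := mem_closure_iff.1 (frontier_subset_closure hp) _ isOpen_ball
    (mem_ball_self hηpos)
  have hzp : ‖z - p‖ < η := by simpa [dist_eq_norm] using hz
  have hzr : ‖z - p‖ < r / 2 := hzp.trans_le (min_le_right _ _)
  have hball : ∀ c ∈ Icc (-δ) δ, z + c • v ∈ ball p r := by
    intro c hc
    rw [mem_ball, dist_eq_norm, show z + c • v - p = (z - p) + c • v by abel]
    refine (norm_add_le _ _).trans_lt ?_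
    rw [norm_smul, Real.norm_eq_abs]
    have : |c| * ‖v‖ ≤ δ * ‖v‖ := by gcongr; exact abs_le.2 hc
    linarith
  have huniq : ∀ c ∈ Icc (-δ) δ, ∀ c' ∈ Icc (-δ) δ, z + c • v ∈ Γ → z + c' • v ∈ Γ → c = c' := by
    intro c hc c' hc' hm hm'
    by_contra hne
    refine hs _ ⟨hm, hball c hc⟩ _ ⟨hm', hball c' hc'⟩ ?_ ?_
    · intro h
      have := add_left_cancel h
      exact hne (smul_left_injective ℝ hv this)
    · rw [add_sub_add_left_eq_sub, ← sub_smul, hcv]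
  have hmove : ∀ w : Eu 2, ∀ S : Set (Eu 2), IsPreconnected S → z ∈ S → w ∈ S → Disjoint S Γ →
      w ∈ U := fun w S hS hzS hwS hSΓ =>
    subset_of_disjoint_frontier hU hS (hSΓ.mono_right hUΓ) ⟨z, hzS, hzU⟩ hwS
  have hfin : ∀ w e : Eu 2, ∀ η' ≥ η, ball w η' ⊆ Γᶜ → e - z = w - p → e ∈ U → w ∈ U := by
    intro w e η' hη' hbw he heU
    refine subset_of_disjoint_frontier hU (convex_ball w η').isPreconnected
      ((disjoint_compl_left_iff_subset.2 le_rfl |>.mono_left hbw).mono_right hUΓ)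
      ⟨e, ?_, heU⟩ (mem_ball_self (hηpos.trans_le hη'))
    rw [mem_ball, dist_eq_norm, show e - w = z - p by
      rw [sub_eq_sub_iff_add_eq_add] at he ⊢; rw [he]; abel]
    exact hzp.trans_le hη'
  have hside : (∀ c ∈ Icc (0 : ℝ) δ, z + c • v ∉ Γ) ∨ (∀ c ∈ Icc (-δ) (0 : ℝ), z + c • v ∉ Γ) := by
    by_contra! hcon
    obtain ⟨⟨c, hc, hm⟩, c', hc', hm'⟩ := hcon
    have := huniq c ⟨by linarith [hc.1], hc.2⟩ c' ⟨hc'.1, by linarith [hc'.2]⟩ hm hm'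
    have hc0 : c = 0 := le_antisymm (this ▸ hc'.2) hc.1
    rw [hc0, zero_smul, add_zero] at hm
    exact disjoint_left.1 hd hzU hm
  have hpre : ∀ a b : ℝ, IsPreconnected ((fun c : ℝ => z + c • v) '' Icc a b) := fun a b =>
    isPreconnected_Icc.image _ (by fun_prop)
  rcases hside with h | h
  · left
    refine hfin _ (z + δ • v) η₁ ((min_le_left _ _).trans (min_le_left _ _)) hb₁ (by abel) ?_
    refine hmove _ _ (hpre 0 δ) ⟨0, ⟨le_rfl, hδ.le⟩, by simp⟩ ⟨δ, ⟨hδ.le, le_rfl⟩, rfl⟩ ?_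
    rw [disjoint_left, forall_mem_image]
    exact h
  · right
    refine hfin _ (z + (-δ) • v) η₂ ((min_le_left _ _).trans (min_le_right _ _)) hb₂
      (by rw [neg_smul]; abel) ?_
    refine hmove _ _ (hpre (-δ) 0) ⟨0, ⟨by linarith, le_rfl⟩, by simp⟩
      ⟨-δ, ⟨le_rfl, by linarith⟩, rfl⟩ ?_
    rw [disjoint_left, forall_mem_image]
    exact h

/-- The determinant with a fixed first vector as a linear functional. -/
def crossCLM (v : Eu 2) : Eu 2 →L[ℝ] ℝ :=
  v 0 • EuclideanSpace.proj (1 : Fin 2) - v 1 • EuclideanSpace.proj (0 : Fin 2)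

lemma crossCLM_apply (v x : Eu 2) : crossCLM v x = cross v x := by
  simp [crossCLM, cross]

lemma abs_cross_le (u x : Eu 2) : |cross u x| ≤ ‖u‖ * ‖x‖ := by
  refine abs_le_of_sq_le_sq ?_ (by positivity)
  rw [mul_pow, norm_sq_eq_two, norm_sq_eq_two, cross]
  nlinarith [sq_nonneg (u 0 * x 0 + u 1 * x 1)]

lemma IsC2JordanCurve.hasDerivAt {γ : ℝ → Eu 2} (h : IsC2JordanCurve γ) (t : ℝ) :
    HasDerivAt γ (deriv γ t) t :=
  (h.1.differentiable (by norm_num) t).hasDerivAt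

lemma IsC2JordanCurve.continuous_deriv {γ : ℝ → Eu 2} (h : IsC2JordanCurve γ) :
    Continuous (deriv γ) :=
  h.1.continuous_deriv (by norm_num)

lemma IsC2JordanCurve.hasDerivAt_cross {γ : ℝ → Eu 2} (h : IsC2JordanCurve γ) (v : Eu 2) (t : ℝ) :
    HasDerivAt (fun a => cross v (γ a)) (cross v (deriv γ t)) t := by
  have := (crossCLM v).hasFDerivAt.comp_hasDerivAt t (h.hasDerivAt t)
  simpa only [crossCLM_apply, Function.comp_def] using this

lemma IsC2JordanCurve.eq_of_abs_sub_lt {γ : ℝ → Eu 2} (h : IsC2JordanCurve γ) {s t : ℝ}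
    (hst : γ s = γ t) (hlt : |s - t| < 1) : s = t := by
  have hfr : ∀ x, γ (Int.fract x) = γ x := fun x => by
    have := h.2.1.sub_int_mul_eq (x := x) ⌊x⌋
    rwa [mul_one] at this
  have h1 := h.2.2.1 (Int.fract s) ⟨Int.fract_nonneg s, Int.fract_lt_one s⟩ (Int.fract t)
    ⟨Int.fract_nonneg t, Int.fract_lt_one t⟩ (by rw [hfr, hfr, hst])
  obtain ⟨z, hz⟩ := Int.fract_eq_fract.1 h1
  rw [hz] at hlt
  have : z = 0 := by
    rw [← Int.cast_abs] at hlt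
    exact Int.abs_lt_one_iff.1 (by exact_mod_cast hlt)
  rw [this] at hz
  simpa [sub_eq_zero] using hz

lemma IsC2JordanCurve.range_eq {γ : ℝ → Eu 2} (h : IsC2JordanCurve γ) (a : ℝ) :
    range γ = γ '' Ico a (a + 1) := by
  refine subset_antisymm ?_ (image_subset_range _ _)
  rintro _ ⟨t, rfl⟩
  obtain ⟨s, hs, hst⟩ := h.2.1.exists_mem_Ico one_pos t a
  exact ⟨s, hs, hst.symm⟩

lemma IsC2JordanCurve.isCompact_range {γ : ℝ → Eu 2} (h : IsC2JordanCurve γ) :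
    IsCompact (range γ) := by
  rw [← h.2.1.image_Icc one_pos 0]
  exact isCompact_Icc.image h.1.continuous

/-- Near a point where a union of Jordan curves is not tangent to `v`, no two points of the
union lie on the same line parallel to `v`. -/
lemma exists_ball_cross_sub_ne_zero {N : ℕ} {γ : Fin N → ℝ → Eu 2}
    (hγ : ∀ i, IsC2JordanCurve (γ i))
    (hd : ∀ i j, i ≠ j → Disjoint (range (γ i)) (range (γ j))) {v : Eu 2} {i₀ : Fin N} {τ : ℝ}
    (hτ : cross v (deriv (γ i₀) τ) ≠ 0) :
    ∃ r > 0, ∀ q ∈ (⋃ i, range (γ i)) ∩ ball (γ i₀ τ) r,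
      ∀ q' ∈ (⋃ i, range (γ i)) ∩ ball (γ i₀ τ) r, q ≠ q' → cross v (q - q') ≠ 0 := by
  have h0 := hγ i₀
  have hc : Continuous fun a => cross v (deriv (γ i₀) a) :=
    (continuous_cross v).comp h0.continuous_deriv
  obtain ⟨δ₁, hδ₁, hb⟩ := Metric.eventually_nhds_iff.1 (hc.continuousAt.eventually_ne hτ)
  set δ := min δ₁ (1 / 4) with hδ
  have hδpos : 0 < δ := by positivity
  set K : Set (Eu 2) := (⋃ i ∈ {i | i ≠ i₀}, range (γ i)) ∪
    γ i₀ '' (Icc (τ - 1 / 2) (τ - δ) ∪ Icc (τ + δ) (τ + 1 / 2)) with hK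
  have hKc : IsCompact K :=
    ((toFinite _).isCompact_biUnion fun i _ => (hγ i).isCompact_range).union
      ((isCompact_Icc.union isCompact_Icc).image h0.1.continuous)
  have hp : γ i₀ τ ∈ Kᶜ := by
    rintro (h | ⟨a, ha, hpa⟩)
    · simp only [mem_iUnion] at h
      obtain ⟨i, hi, hp⟩ := h
      exact disjoint_left.1 (hd i i₀ hi) hp (mem_range_self τ)
    · have hlt : |a - τ| < 1 := by
        rw [abs_lt]
        rcases ha with ha | ha <;> constructor <;> linarith [ha.1, ha.2]
      have := h0.eq_of_abs_sub_lt hpa hlt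
      rcases ha with ha | ha <;> linarith [ha.1, ha.2]
  obtain ⟨r, hr, hball⟩ := Metric.isOpen_iff.1 hKc.isClosed.isOpen_compl _ hp
  have hpar : ∀ q ∈ (⋃ i, range (γ i)) ∩ ball (γ i₀ τ) r, ∃ a ∈ Ioo (τ - δ) (τ + δ), γ i₀ a = q := by
    rintro q ⟨hq, hqb⟩
    have hqK : q ∉ K := hball hqb
    obtain ⟨i, hi⟩ := mem_iUnion.1 hq
    have hii : i = i₀ := by
      by_contra hne
      exact hqK (Or.inl (mem_biUnion (show i ∈ {i | i ≠ i₀} from hne) hi))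
    subst hii
    rw [h0.range_eq (τ - 1 / 2)] at hi
    obtain ⟨a, ha, rfl⟩ := hi
    refine ⟨a, ⟨?_, ?_⟩, rfl⟩
    · by_contra! hcon
      exact hqK (Or.inr ⟨a, Or.inl ⟨ha.1, hcon⟩, rfl⟩)
    · by_contra! hcon
      exact hqK (Or.inr ⟨a, Or.inr ⟨hcon, by linarith [ha.2]⟩, rfl⟩)
  have hrolle : ∀ a b, a ∈ Ioo (τ - δ) (τ + δ) → b ∈ Ioo (τ - δ) (τ + δ) → a < b →
      cross v (γ i₀ a) ≠ cross v (γ i₀ b) := by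
    intro a b ha hb' hab heq
    obtain ⟨c, hc1, hc2⟩ := exists_hasDerivAt_eq_zero hab
      (((continuous_cross v).comp h0.1.continuous).continuousOn) heq
      fun x _ => h0.hasDerivAt_cross v x
    refine hb ?_ hc2
    rw [Real.dist_eq, abs_lt]
    have := min_le_left δ₁ (1 / 4)
    constructor <;> linarith [hc1.1, hc1.2, ha.1, hb'.2]
  refine ⟨r, hr, fun q hq q' hq' hne heq => ?_⟩
  obtain ⟨a, ha, rfl⟩ := hpar q hq
  obtain ⟨b, hb', rfl⟩ := hpar q' hq'
  rw [cross_sub_right, sub_eq_zero] at heq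
  rcases lt_trichotomy a b with h | h | h
  · exact hrolle a b ha hb' h heq
  · exact hne (by rw [h])
  · exact hrolle b a hb' ha h heq.symm

lemma ae_cross_deriv_ne_zero {N : ℕ} {γ : Fin N → ℝ → Eu 2} (hγ : ∀ i, IsC2JordanCurve (γ i))
    (v : Eu 2) : ∀ᵐ s : ℝ, ∀ i τ, cross v (γ i τ) = s → cross v (deriv (γ i) τ) ≠ 0 := by
  rw [ae_all_iff]
  intro i
  have h : volume ((fun a => cross v (γ i a)) '' {τ | cross v (deriv (γ i) τ) = 0}) = 0 := by
    refine addHaar_image_eq_zero_of_det_fderivWithin_eq_zero volume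
      (f' := fun τ => ContinuousLinearMap.toSpanSingleton ℝ (cross v (deriv (γ i) τ)))
      (fun τ _ => ((hγ i).hasDerivAt_cross v τ).hasFDerivAt.hasFDerivWithinAt) fun τ hτ => ?_
    rw [mem_ofPred_eq] at hτ
    rw [hτ]
    simp
  filter_upwards [measure_eq_zero_iff_ae_notMem.1 h] with s hs τ hτ h0
  exact hs ⟨τ, h0, hτ⟩

/-- A short piece of a regular curve is nearly straight. -/
lemma IsC2JordanCurve.eventually_abs_cross_sub_le {γ : ℝ → Eu 2} (h : IsC2JordanCurve γ) {ε : ℝ}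
    (hε : 0 < ε) : ∀ᶠ n : ℕ in atTop, ∀ k < n, ∃ w : Eu 2, ‖w‖ = 1 ∧
      ∀ q ∈ γ '' Ico ((k : ℝ) / n) ((k + 1) / n), ∀ q' ∈ γ '' Ico ((k : ℝ) / n) ((k + 1) / n),
      ∀ u, |cross u (q - q')| ≤ (|cross u w| + ε * ‖u‖) * ‖q - q'‖ := by
  obtain ⟨a₀, -, hmin⟩ := (isCompact_Icc (a := (0 : ℝ)) (b := 1)).exists_isMinOn
    (nonempty_Icc.2 zero_le_one) (h.continuous_deriv.norm.continuousOn)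
  set m := ‖deriv γ a₀‖ with hm
  have hmpos : 0 < m := norm_pos_iff.2 (h.2.2.2 a₀)
  set η := ε * m / (2 + ε) with hη
  have hηpos : 0 < η := by positivity
  have hηε : η * (2 + ε) = ε * m := by rw [hη]; field_simp
  have huc := (isCompact_Icc (a := (0 : ℝ)) (b := 1)).uniformContinuousOn_of_continuous
    h.continuous_deriv.continuousOn
  obtain ⟨δ, hδ, huc⟩ := Metric.uniformContinuousOn_iff.1 huc η hηpos
  filter_upwards [tendsto_one_div_atTop_nhds_zero_nat.eventually (gt_mem_nhds hδ)] with n hn k hk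
  have hn0 : (0 : ℝ) < n := by exact_mod_cast (Nat.zero_le k).trans_lt hk
  have hkn : ((k : ℝ) + 1) / n = k / n + 1 / n := by ring
  set c : ℝ := (k : ℝ) / n with hc
  have hc0 : 0 ≤ c := by positivity
  have hc1 : c + 1 / n ≤ 1 := by
    rw [← hkn, div_le_one hn0]
    exact_mod_cast hk
  rw [hkn]
  have hsub : Ico c (c + 1 / n) ⊆ Icc 0 1 := fun x hx => ⟨hc0.trans hx.1, hx.2.le.trans hc1⟩
  have hcI : c ∈ Icc (0 : ℝ) 1 := ⟨hc0, by linarith [one_div_pos.2 hn0]⟩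
  set d := deriv γ c with hd
  have hmd : m ≤ ‖d‖ := hmin hcI
  have hd0 : 0 < ‖d‖ := hmpos.trans_le hmd
  have hclose : ∀ s ∈ Ico c (c + 1 / n), ∀ t ∈ Ico c (c + 1 / n),
      ‖γ s - γ t - (s - t) • d‖ ≤ η * |s - t| := by
    intro s hs t ht
    have := Convex.norm_image_sub_le_of_norm_hasDerivWithin_le (f := fun x => γ x - x • d)
      (f' := fun x => deriv γ x - (1 : ℝ) • d) (s := Ico c (c + 1 / n)) (C := η)
      (fun x _ => ((h.hasDerivAt x).sub ((hasDerivAt_id x).smul_const d)).hasDerivWithinAt)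
      (fun x hx => by
        rw [one_smul, ← dist_eq_norm]
        refine (huc x (hsub hx) c hcI ?_).le
        rw [Real.dist_eq, abs_lt]
        constructor <;> linarith [hx.1, hx.2]) (convex_Ico _ _) ht hs
    rw [Real.norm_eq_abs] at this
    refine le_trans (le_of_eq ?_) this
    congr 1
    module
  refine ⟨‖d‖⁻¹ • d, by rw [norm_smul, norm_inv, norm_norm, inv_mul_cancel₀ hd0.ne'], ?_⟩
  rintro _ ⟨s, hs, rfl⟩ _ ⟨t, ht, rfl⟩ u
  set x := γ s - γ t with hx
  have h1 := hclose s hs t ht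
  set w := ‖d‖⁻¹ • d with hw
  have hw1 : ‖w‖ = 1 := by rw [hw, norm_smul, norm_inv, norm_norm, inv_mul_cancel₀ hd0.ne']
  have hdw : d = ‖d‖ • w := by rw [hw, smul_smul, mul_inv_cancel₀ hd0.ne', one_smul]
  have h2 : (‖d‖ - η) * |s - t| ≤ ‖x‖ := by
    have h3 : ‖(s - t) • d‖ ≤ ‖x‖ + ‖x - (s - t) • d‖ := by
      have := norm_sub_le x (x - (s - t) • d)
      rwa [sub_sub_cancel] at this
    rw [norm_smul, Real.norm_eq_abs] at h3
    linarith
  have hcw : |cross u w| ≤ ‖u‖ := by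
    have := abs_cross_le u w
    rwa [hw1, mul_one] at this
  have h4 : |cross u x| ≤ (‖d‖ * |cross u w| + η * ‖u‖) * |s - t| := by
    have h5 : cross u x = (s - t) * (‖d‖ * cross u w) + cross u (x - (s - t) • d) := by
      rw [← cross_smul_right, ← hdw, cross_sub_right u x, cross_smul_right]
      ring
    rw [h5]
    refine (abs_add_le _ _).trans ?_
    rw [abs_mul, abs_mul, abs_of_pos hd0]
    have h6 := (abs_cross_le u (x - (s - t) • d)).trans
      (mul_le_mul_of_nonneg_left h1 (norm_nonneg u))
    linarith
  refine h4.trans ?_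
  have h7 : ‖d‖ * |cross u w| + η * ‖u‖ ≤ (|cross u w| + ε * ‖u‖) * (‖d‖ - η) := by
    have h8 : η * |cross u w| ≤ η * ‖u‖ := by gcongr
    have h9 : ε * ‖u‖ * m ≤ ε * ‖u‖ * ‖d‖ := by gcongr
    have h10 : η * (2 + ε) * ‖u‖ = ε * m * ‖u‖ := by rw [hηε]
    nlinarith
  calc _ ≤ (|cross u w| + ε * ‖u‖) * (‖d‖ - η) * |s - t| := by gcongr
    _ = (|cross u w| + ε * ‖u‖) * ((‖d‖ - η) * |s - t|) := by ring
    _ ≤ _ := by gcongr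

lemma exists_right_endpoint {O : Set ℝ} (hO : IsOpen O) (hb : BddAbove O) {t : ℝ} (ht : t ∈ O) :
    ∃ b, t < b ∧ b ∉ O ∧ Ico t b ⊆ O := by
  obtain ⟨M, hM⟩ := hb
  have hne : (Ici t ∩ Oᶜ).Nonempty :=
    ⟨max t (M + 1), mem_Ici.2 (le_max_left _ _), fun h => by linarith [hM h, le_max_right t (M + 1)]⟩
  have hbd : BddBelow (Ici t ∩ Oᶜ) := ⟨t, fun x hx => hx.1⟩
  have hmem := (isClosed_Ici.inter hO.isClosed_compl).csInf_mem hne hbd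
  refine ⟨sInf (Ici t ∩ Oᶜ), lt_of_le_of_ne hmem.1 ?_, hmem.2, fun x hx => ?_⟩
  · intro h
    exact hmem.2 (h ▸ ht)
  · by_contra hxO
    exact notMem_of_lt_csInf hx.2 hbd ⟨hx.1, hxO⟩

lemma exists_left_endpoint {O : Set ℝ} (hO : IsOpen O) (hb : BddBelow O) {t : ℝ} (ht : t ∈ O) :
    ∃ a, a < t ∧ a ∉ O ∧ Ioc a t ⊆ O := by
  obtain ⟨M, hM⟩ := hb
  have hne : (Iic t ∩ Oᶜ).Nonempty :=
    ⟨min t (M - 1), mem_Iic.2 (min_le_left _ _), fun h => by linarith [hM h, min_le_right t (M - 1)]⟩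
  have hbd : BddAbove (Iic t ∩ Oᶜ) := ⟨t, fun x hx => hx.1⟩
  have hmem := (isClosed_Iic.inter hO.isClosed_compl).csSup_mem hne hbd
  refine ⟨sSup (Iic t ∩ Oᶜ), lt_of_le_of_ne hmem.1 ?_, hmem.2, fun x hx => ?_⟩
  · intro h
    exact hmem.2 (by rw [h]; exact ht)
  · by_contra hxO
    exact notMem_of_csSup_lt hx.1 hbd ⟨hx.2, hxO⟩

/-- The endpoints of the intervals of an open set are distinct when no boundary point is
surrounded by the set. -/
lemma IsIntervalSeparated.exists_frontier_finset {O : Set ℝ} (hO : IsOpen O)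
    (hb : Bornology.IsBounded O)
    (hfr : ∀ p ∈ frontier O, ∃ δ₀ > 0, ∀ δ, 0 < δ → δ < δ₀ → p + δ ∉ O ∨ p - δ ∉ O)
    {T : Finset ℝ} (hT : IsIntervalSeparated O T) :
    ∃ Q : Finset ℝ, (∀ q ∈ Q, q ∈ frontier O) ∧ Q.card = 2 * T.card := by
  choose! b hb1 hb2 hb3 using fun t (ht : t ∈ O) => exists_right_endpoint hO hb.bddAbove ht
  choose! a ha1 ha2 ha3 using fun t (ht : t ∈ O) => exists_left_endpoint hO hb.bddBelow ht
  have hbf : ∀ t ∈ O, b t ∈ frontier O := fun t ht => by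
    rw [hO.frontier_eq]
    refine ⟨closure_mono (hb3 t ht) ?_, hb2 t ht⟩
    rw [closure_Ico (hb1 t ht).ne]
    exact right_mem_Icc.2 (hb1 t ht).le
  have haf : ∀ t ∈ O, a t ∈ frontier O := fun t ht => by
    rw [hO.frontier_eq]
    refine ⟨closure_mono (ha3 t ht) ?_, ha2 t ht⟩
    rw [closure_Ioc (ha1 t ht).ne]
    exact left_mem_Icc.2 (ha1 t ht).le
  have hlt : ∀ t ∈ T, ∀ t' ∈ T, t < t' → b t < t' ∧ t < a t' := by
    intro t ht t' ht' hlt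
    have hO1 := hT.1 t ht
    have hO2 := hT.1 t' ht'
    have hsep := hT.2 t ht t' ht' hlt.ne
    rw [uIcc_of_le hlt.le] at hsep
    constructor
    · by_contra! h
      rcases h.lt_or_eq with h | h
      · exact hsep fun x hx => hb3 t hO1 ⟨hx.1, hx.2.trans_lt h⟩
      · exact hb2 t hO1 (h ▸ hO2)
    · by_contra! h
      rcases h.lt_or_eq with h | h
      · exact hsep fun x hx => ha3 t' hO2 ⟨h.trans_le hx.1, hx.2⟩
      · exact ha2 t' hO2 (h ▸ hO1)
  have hbi : InjOn b T := by
    intro t ht t' ht' h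
    rcases lt_trichotomy t t' with h' | h' | h'
    · linarith [(hlt t ht t' ht' h').1, hb1 t' (hT.1 t' ht')]
    · exact h'
    · linarith [(hlt t' ht' t ht h').1, hb1 t (hT.1 t ht)]
  have hai : InjOn a T := by
    intro t ht t' ht' h
    rcases lt_trichotomy t t' with h' | h' | h'
    · linarith [(hlt t ht t' ht' h').2, ha1 t (hT.1 t ht)]
    · exact h'
    · linarith [(hlt t' ht' t ht h').2, ha1 t' (hT.1 t' ht')]
  have hdis : Disjoint (T.image a) (T.image b) := by
    rw [Finset.disjoint_left]
    simp only [Finset.mem_image, not_exists, not_and]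
    rintro _ ⟨t, ht, rfl⟩ t' ht' h
    have hO1 := hT.1 t ht
    have hO2 := hT.1 t' ht'
    obtain ⟨δ₀, hδ₀, hδ⟩ := hfr _ (haf t hO1)
    have h1 := ha1 t hO1
    have h2 := hb1 t' hO2
    set δ := min (δ₀ / 2) (min (t - a t) (b t' - t')) with hδdef
    have hpos : 0 < δ := by
      refine lt_min (by linarith) (lt_min (by linarith) (by linarith))
    have e1 : δ ≤ δ₀ / 2 := min_le_left _ _
    have e2 : δ ≤ t - a t := (min_le_right _ _).trans (min_le_left _ _)
    have e3 : δ ≤ b t' - t' := (min_le_right _ _).trans (min_le_right _ _)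
    rcases hδ δ hpos (by linarith) with h3 | h3
    · exact h3 (ha3 t hO1 ⟨by linarith, by linarith⟩)
    · exact h3 (hb3 t' hO2 ⟨by linarith, by linarith⟩)
  refine ⟨T.image a ∪ T.image b, ?_, ?_⟩
  · intro q hq
    rcases Finset.mem_union.1 hq with hq | hq
    · obtain ⟨t, ht, rfl⟩ := Finset.mem_image.1 hq
      exact haf t (hT.1 t ht)
    · obtain ⟨t, ht, rfl⟩ := Finset.mem_image.1 hq
      exact hbf t (hT.1 t ht)
  · rw [Finset.card_union_of_disjoint hdis, Finset.card_image_of_injOn hai,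
      Finset.card_image_of_injOn hbi]
    ring

/-- The part in `S` of the `k`-th of `n` arcs of a closed curve. -/
def arcPiece (γ : ℝ → Eu 2) (S : Set (Eu 2)) (n k : ℕ) : Set (Eu 2) :=
  S ∩ γ '' Ico ((k : ℝ) / n) ((k + 1) / n)

lemma Ico_div_subset {n k : ℕ} (hk : k < n) : Ico ((k : ℝ) / n) ((k + 1) / n) ⊆ Ico 0 1 := by
  have hn0 : (0 : ℝ) < n := by exact_mod_cast (Nat.zero_le k).trans_lt hk
  intro x hx
  refine ⟨le_trans (by positivity) hx.1, hx.2.trans_le ?_⟩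
  rw [div_le_one hn0]
  exact_mod_cast hk

lemma exists_mem_Ico_div {n : ℕ} (hn : 0 < n) {τ : ℝ} (hτ : τ ∈ Ico (0 : ℝ) 1) :
    ∃ k < n, τ ∈ Ico ((k : ℝ) / n) ((k + 1) / n) := by
  have hn0 : (0 : ℝ) < n := by exact_mod_cast hn
  have h0 : 0 ≤ τ * n := mul_nonneg hτ.1 hn0.le
  refine ⟨⌊τ * n⌋₊, ?_, ?_, ?_⟩
  · rw [Nat.floor_lt h0]
    nlinarith [hτ.2]
  · rw [div_le_iff₀ hn0]
    exact Nat.floor_le h0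
  · rw [lt_div_iff₀ hn0]
    exact Nat.lt_floor_add_one _

lemma eq_of_mem_Ico_div {n k k' : ℕ} (hn : 0 < n) {τ : ℝ}
    (h : τ ∈ Ico ((k : ℝ) / n) ((k + 1) / n)) (h' : τ ∈ Ico ((k' : ℝ) / n) ((k' + 1) / n)) :
    k = k' := by
  have hn0 : (0 : ℝ) < n := by exact_mod_cast hn
  simp only [mem_Ico, div_le_iff₀ hn0, lt_div_iff₀ hn0] at h h'
  have h1 : (k : ℝ) < k' + 1 := by linarith [h.1, h'.2]
  have h2 : (k' : ℝ) < k + 1 := by linarith [h'.1, h.2]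
  have h3 : k < k' + 1 := by exact_mod_cast h1
  have h4 : k' < k + 1 := by exact_mod_cast h2
  omega

lemma IsC2JordanCurve.injOn_Ico {γ : ℝ → Eu 2} (h : IsC2JordanCurve γ) : InjOn γ (Ico 0 1) :=
  fun s hs t ht => h.2.2.1 s hs t ht

lemma measurableSet_arcPiece {γ : ℝ → Eu 2} (h : IsC2JordanCurve γ) {S : Set (Eu 2)}
    (hS : MeasurableSet S) {n k : ℕ} (hk : k < n) : MeasurableSet (arcPiece γ S n k) :=
  hS.inter (measurableSet_Ico.image_of_continuousOn_injOn h.1.continuous.continuousOn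
    (h.injOn_Ico.mono (Ico_div_subset hk)))

lemma pairwiseDisjoint_arcPiece {N : ℕ} {γ : Fin N → ℝ → Eu 2} (hγ : ∀ i, IsC2JordanCurve (γ i))
    (hd : ∀ i j, i ≠ j → Disjoint (range (γ i)) (range (γ j))) (S : Set (Eu 2)) (n : ℕ) :
    ((Finset.univ ×ˢ Finset.range n : Finset (Fin N × ℕ)) : Set (Fin N × ℕ)).PairwiseDisjoint
      fun x => arcPiece (γ x.1) S n x.2 := by
  rintro ⟨i, k⟩ hx ⟨j, l⟩ hy hne
  simp only [Finset.coe_product, Finset.coe_univ, Finset.coe_range, mem_prod, mem_univ, mem_Iio,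
    true_and] at hx hy
  refine disjoint_left.2 ?_
  rintro _ ⟨-, s, hs, rfl⟩ ⟨-, t, ht, hst⟩
  by_cases hij : i = j
  · subst hij
    have := (hγ i).injOn_Ico (Ico_div_subset hx hs) (Ico_div_subset hy ht) hst.symm
    subst this
    have hkl : k = l := eq_of_mem_Ico_div ((Nat.zero_le k).trans_lt hx) hs ht
    exact hne (by rw [hkl])
  · exact disjoint_left.1 (hd i j hij) (mem_range_self s) ⟨t, hst⟩

/-- Finitely many points of a union of curves are separated by sufficiently short arcs. -/
lemma eventually_card_le_card_filter {N : ℕ} {γ : Fin N → ℝ → Eu 2}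
    (hγ : ∀ i, IsC2JordanCurve (γ i)) {S : Set (Eu 2)} (hS : S ⊆ ⋃ i, range (γ i))
    {ι : Type*} [DecidableEq ι] (Q : Finset ι) (z : ι → Eu 2) (hz : InjOn z Q)
    (hzS : ∀ q ∈ Q, z q ∈ S)
    (p : Set (Eu 2) → Prop) (hp : ∀ q ∈ Q, ∀ A, z q ∈ A → p A) : ∀ᶠ n : ℕ in atTop,
      ∃ F : Finset (Fin N × ℕ), F ⊆ Finset.univ ×ˢ Finset.range n ∧ Q.card ≤ F.card ∧
        ∀ x ∈ F, p (arcPiece (γ x.1) S n x.2) := by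
  have hpar : ∀ q ∈ Q, ∃ x : Fin N × ℝ, x.2 ∈ Ico (0 : ℝ) 1 ∧ γ x.1 x.2 = z q := by
    intro q hq
    obtain ⟨i, hi⟩ := mem_iUnion.1 (hS (hzS q hq))
    rw [(hγ i).range_eq 0, zero_add] at hi
    obtain ⟨τ, hτ, h⟩ := hi
    exact ⟨(i, τ), hτ, h⟩
  rcases Q.eq_empty_or_nonempty with rfl | ⟨q₀, hq₀⟩
  · exact Eventually.of_forall fun n => ⟨∅, by simp, by simp, by simp⟩
  have : Nonempty (Fin N × ℝ) := ⟨(hpar q₀ hq₀).choose⟩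
  choose! x hx hxz using hpar
  have hev : ∀ᶠ n : ℕ in atTop, ∀ q ∈ Q, ∀ q' ∈ Q, (x q).2 ≠ (x q').2 →
      1 / (n : ℝ) < |(x q).2 - (x q').2| := by
    rw [Filter.eventually_all_finset]
    intro q _
    rw [Filter.eventually_all_finset]
    intro q' _
    by_cases h : (x q).2 = (x q').2
    · simp [h]
    · filter_upwards [tendsto_one_div_atTop_nhds_zero_nat.eventually
        (gt_mem_nhds (abs_pos.2 (sub_ne_zero.2 h)))] with n hn _ using hn
  filter_upwards [hev, eventually_gt_atTop 0] with n hn hn0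
  choose! k hk hkm using fun q (hq : q ∈ Q) => exists_mem_Ico_div hn0 (hx q hq)
  have hinj : InjOn (fun q => ((x q).1, k q)) Q := by
    intro q hq q' hq' h
    simp only [Prod.mk.injEq] at h
    refine hz hq hq' ?_
    rw [← hxz q hq, ← hxz q' hq', h.1]
    congr 1
    by_contra hne
    have h1 := hn q hq q' hq' hne
    have h2 := hkm q hq
    have h3 := hkm q' hq'
    rw [h.2] at h2
    have h4 : ((k q' : ℝ) + 1) / n = k q' / n + 1 / n := by ring
    rw [h4] at h2 h3
    refine h1.not_ge ?_
    rw [abs_le]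
    constructor <;> linarith [h2.1, h2.2, h3.1, h3.2]
  refine ⟨Q.image fun q => ((x q).1, k q), ?_, ?_, ?_⟩
  · intro y hy
    obtain ⟨q, hq, rfl⟩ := Finset.mem_image.1 hy
    simpa using hk q hq
  · rw [Finset.card_image_of_injOn hinj]
  · intro y hy
    obtain ⟨q, hq, rfl⟩ := Finset.mem_image.1 hy
    exact hp q hq _ ⟨hzS q hq, (x q).2, hkm q hq, hxz q hq⟩

lemma isBounded_slice {W : Set (Eu 2)} (hb : Bornology.IsBounded W) {v : Eu 2} (hv : v ≠ 0)
    (c : Eu 2) : Bornology.IsBounded {p : ℝ | p • v + c ∈ W} := by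
  obtain ⟨B, hB⟩ := hb.exists_norm_le
  refine isBounded_iff_forall_norm_le.2 ⟨(B + ‖c‖) / ‖v‖, fun p hp => ?_⟩
  rw [le_div_iff₀ (norm_pos_iff.2 hv), ← norm_smul]
  have h1 := hB _ hp
  have h2 : ‖p • v‖ ≤ ‖p • v + c‖ + ‖c‖ := by
    simpa using norm_sub_le (p • v + c) c
  linarith

theorem two_mul_intervalCount_le_liminf {N : ℕ} {γ : Fin N → ℝ → Eu 2}
    (hγ : ∀ i, IsC2JordanCurve (γ i))
    (hd : ∀ i j, i ≠ j → Disjoint (range (γ i)) (range (γ j))) {U W : Set (Eu 2)} (hU : IsOpen U)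
    (hUΓ : frontier U ⊆ ⋃ i, range (γ i)) (hUd : Disjoint U (⋃ i, range (γ i))) (hW : IsOpen W)
    (hb : Bornology.IsBounded W) (hWU : Disjoint W U) (hWf : frontier W ⊆ frontier U)
    {v : Eu 2} (hv : v ≠ 0) :
    ∀ᵐ s : ℝ, 2 * intervalCount {p : ℝ | p • v + s • normalDual v ∈ W} ≤
      liminf (fun n : ℕ => ∑ x ∈ Finset.univ ×ˢ Finset.range n,
        (toMeasurable volume (cross v '' arcPiece (γ x.1) (frontier U) n x.2)).indicator
          (1 : ℝ → ℝ≥0∞) s) atTop := by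
  have hΓ : IsClosed (⋃ i, range (γ i)) :=
    isClosed_iUnion_of_finite fun i => (hγ i).isCompact_range.isClosed
  filter_upwards [ae_cross_deriv_ne_zero hγ v] with s hs
  set f : ℝ → Eu 2 := fun p => p • v + s • normalDual v with hf
  have hfc : Continuous f := by fun_prop
  have hcf : ∀ p, cross v (f p) = s := fun p => by
    rw [hf, cross_add_right, cross_smul_right, cross_smul_right, planeCross_self,
      cross_normalDual hv]
    ring
  have hfi : Function.Injective f := fun p q h =>
    smul_left_injective ℝ hv (add_right_cancel h)
  have hfr : ∀ p ∈ frontier (f ⁻¹' W), f p ∈ frontier U := fun p hp =>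
    hWf (hfc.frontier_preimage_subset W hp)
  have hside : ∀ p ∈ frontier (f ⁻¹' W),
      ∃ δ₀ > 0, ∀ δ, 0 < δ → δ < δ₀ → p + δ ∉ f ⁻¹' W ∨ p - δ ∉ f ⁻¹' W := by
    intro p hp
    have hpU := hfr p hp
    obtain ⟨i, τ, hτ⟩ := mem_iUnion.1 (hUΓ hpU)
    obtain ⟨r, hr, hsec⟩ := exists_ball_cross_sub_ne_zero hγ hd (hs i τ (by rw [hτ, hcf]))
    rw [hτ] at hsec
    obtain ⟨δ₀, hδ₀, h⟩ := exists_mem_or_mem_of_transversal hU hΓ hUΓ hUd hv hpU hr hsec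
    refine ⟨δ₀, hδ₀, fun δ h1 h2 => ?_⟩
    have e1 : f (p + δ) = f p + δ • v := by simp only [hf]; module
    have e2 : f (p - δ) = f p - δ • v := by simp only [hf]; module
    rw [mem_preimage, mem_preimage, e1, e2]
    exact (h δ h1 h2).imp (fun h h' => disjoint_left.1 hWU h' h)
      (fun h h' => disjoint_left.1 hWU h' h)
  change 2 * intervalCount (f ⁻¹' W) ≤ _
  rw [intervalCount, ENNReal.mul_iSup]
  refine iSup_le fun T => ?_
  rw [ENNReal.mul_iSup]
  refine iSup_le fun hT => ?_
  obtain ⟨Q, hQ, hQc⟩ := hT.exists_frontier_finset (hW.preimage hfc) (isBounded_slice hb hv _) hside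
  refine le_liminf_of_le (by isBoundedDefault) ?_
  filter_upwards [eventually_card_le_card_filter hγ hUΓ Q f hfi.injOn (fun q hq => hfr q (hQ q hq))
    (fun A => s ∈ cross v '' A) fun q _ A hA => ⟨f q, hA, hcf q⟩] with n hn
  obtain ⟨F, hF, hFc, hFs⟩ := hn
  calc (2 * T.card : ℝ≥0∞) = Q.card := by rw [hQc]; push_cast; rfl
    _ ≤ F.card := by exact_mod_cast hFc
    _ = ∑ x ∈ F, 1 := by simp
    _ ≤ ∑ x ∈ F, (toMeasurable volume
          (cross v '' arcPiece (γ x.1) (frontier U) n x.2)).indicator (1 : ℝ → ℝ≥0∞) s := by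
        refine Finset.sum_le_sum fun x hx => ?_
        rw [indicator_of_mem (subset_toMeasurable _ _ (hFs x hx))]
        rfl
    _ ≤ _ := Finset.sum_le_sum_of_subset hF

theorem two_mul_sliceCount_le_liminf {N : ℕ} {γ : Fin N → ℝ → Eu 2}
    (hγ : ∀ i, IsC2JordanCurve (γ i))
    (hd : ∀ i j, i ≠ j → Disjoint (range (γ i)) (range (γ j))) {U W : Set (Eu 2)} (hU : IsOpen U)
    (hUΓ : frontier U ⊆ ⋃ i, range (γ i)) (hUd : Disjoint U (⋃ i, range (γ i))) (hW : IsOpen W)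
    (hb : Bornology.IsBounded W) (hWU : Disjoint W U) (hWf : frontier W ⊆ frontier U)
    {v : Eu 2} (hv : v ≠ 0) :
    2 * sliceCount W v ≤ liminf (fun n : ℕ => ∑ x ∈ Finset.univ ×ˢ Finset.range n,
        volume (cross v '' arcPiece (γ x.1) (frontier U) n x.2)) atTop := by
  rw [sliceCount, ← lintegral_const_mul' _ _ (by norm_num)]
  refine (lintegral_mono_ae
    (two_mul_intervalCount_le_liminf hγ hd hU hUΓ hUd hW hb hWU hWf hv)).trans ?_
  have hm : ∀ (n : ℕ) (x : Fin N × ℕ), Measurable ((toMeasurable volume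
      (cross v '' arcPiece (γ x.1) (frontier U) n x.2)).indicator (1 : ℝ → ℝ≥0∞)) := fun n x =>
    measurable_one.indicator (measurableSet_toMeasurable _ _)
  refine (lintegral_liminf_le fun n => Finset.measurable_fun_sum _ fun x _ => hm n x).trans_eq ?_
  congr 1
  ext n
  rw [lintegral_finsetSum _ fun x _ => hm n x]
  refine Finset.sum_congr rfl fun x _ => ?_
  rw [lintegral_indicator_one (measurableSet_toMeasurable _ _), measure_toMeasurable]

lemma volume_cross_image_le {A : Set (Eu 2)} {u : Eu 2} {C : ℝ} (hC : 0 ≤ C)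
    (h : ∀ q ∈ A, ∀ q' ∈ A, |cross u (q - q')| ≤ C * ‖q - q'‖) :
    volume (cross u '' A) ≤ ENNReal.ofReal C * μH[1] A := by
  have hL : LipschitzOnWith C.toNNReal (cross u) A := by
    refine LipschitzOnWith.of_dist_le_mul fun q hq q' hq' => ?_
    rw [Real.dist_eq, ← cross_sub_right, dist_eq_norm, Real.coe_toNNReal C hC]
    exact h q hq q' hq'
  have := hL.hausdorffMeasure_image_le zero_le_one
  rwa [hausdorffMeasure_real, ENNReal.rpow_one] at this

lemma liminf_add_liminf_le (f g : ℕ → ℝ≥0∞) :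
    liminf f atTop + liminf g atTop ≤ liminf (fun n => f n + g n) atTop := by
  have hmono : ∀ h : ℕ → ℝ≥0∞, Monotone fun n => ⨅ i ≥ n, h i := fun h m n hmn =>
    le_iInf₂ fun i hi => iInf₂_le i (hmn.trans hi)
  simp only [liminf_eq_iSup_iInf_of_nat]
  rw [ENNReal.iSup_add_iSup_of_monotone (hmono f) (hmono g)]
  exact iSup_mono fun n => le_iInf₂ fun i hi => add_le_add (iInf₂_le i hi) (iInf₂_le i hi)

lemma sum_liminf_le_liminf_sum {ι : Type*} (l : List ι) (f : ι → ℕ → ℝ≥0∞) :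
    (l.map fun u => liminf (f u) atTop).sum ≤ liminf (fun n => (l.map fun u => f u n).sum) atTop := by
  induction l with
  | nil => simp
  | cons u l ih =>
    simp only [List.map_cons, List.sum_cons]
    exact (add_le_add le_rfl ih).trans
      (liminf_add_liminf_le (f u) fun n => (l.map fun u => f u n).sum)

lemma hausdorffMeasure_lt_top_of_subset {N : ℕ} {γ : Fin N → ℝ → Eu 2}
    (hγ : ∀ i, IsC2JordanCurve (γ i)) {S : Set (Eu 2)} (hS : S ⊆ ⋃ i, range (γ i)) :
    μH[1] S < ⊤ := by
  refine (measure_mono hS).trans_lt ((measure_iUnion_le _).trans_lt ?_)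
  rw [tsum_fintype, ENNReal.sum_lt_top]
  intro i _
  rw [← (hγ i).2.1.image_Icc one_pos 0]
  obtain ⟨C, hC⟩ := (isCompact_Icc (a := (0 : ℝ)) (b := 0 + 1)).exists_bound_of_continuousOn
    (hγ i).continuous_deriv.continuousOn
  have hL : LipschitzOnWith C.toNNReal (γ i) (Icc 0 (0 + 1)) :=
    (convex_Icc (0 : ℝ) (0 + 1)).lipschitzOnWith_of_nnnorm_hasDerivWithin_le
      (fun x _ => ((hγ i).hasDerivAt x).hasDerivWithinAt) fun x hx => by
        rw [← NNReal.coe_le_coe, coe_nnnorm]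
        exact (hC x hx).trans (Real.le_coe_toNNReal C)
  refine (hL.hausdorffMeasure_image_le zero_le_one).trans_lt ?_
  rw [hausdorffMeasure_real, ENNReal.rpow_one]
  exact ENNReal.mul_lt_top ENNReal.coe_lt_top (by simp)

/-- An upper bound for a sum of intersection numbers by the length of the boundary. -/
theorem two_mul_sum_sliceCount_le {N : ℕ} {γ : Fin N → ℝ → Eu 2}
    (hγ : ∀ i, IsC2JordanCurve (γ i))
    (hd : ∀ i j, i ≠ j → Disjoint (range (γ i)) (range (γ j))) {U W : Set (Eu 2)} (hU : IsOpen U)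
    (hUΓ : frontier U ⊆ ⋃ i, range (γ i)) (hUd : Disjoint U (⋃ i, range (γ i))) (hW : IsOpen W)
    (hb : Bornology.IsBounded W) (hWU : Disjoint W U) (hWf : frontier W ⊆ frontier U)
    (l : List (Eu 2)) (hl : ∀ u ∈ l, u ≠ 0) {M : ℝ}
    (hM : ∀ w : Eu 2, ‖w‖ = 1 → (l.map fun u => |cross u w|).sum ≤ M) :
    2 * (l.map (sliceCount W)).sum ≤ ENNReal.ofReal M * μH[1] (frontier U) := by
  have hfin := hausdorffMeasure_lt_top_of_subset hγ hUΓ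
  set D := (l.map fun u => ‖u‖).sum with hD
  have key : ∀ ε > 0, 2 * (l.map (sliceCount W)).sum ≤
      ENNReal.ofReal (M + ε * D) * μH[1] (frontier U) := by
    intro ε hε
    have h1 : 2 * (l.map (sliceCount W)).sum ≤ (l.map fun u => liminf (fun n : ℕ =>
        ∑ x ∈ Finset.univ ×ˢ Finset.range n,
          volume (cross u '' arcPiece (γ x.1) (frontier U) n x.2)) atTop).sum := by
      rw [← List.sum_map_mul_left]
      exact List.sum_le_sum fun u hu =>
        two_mul_sliceCount_le_liminf hγ hd hU hUΓ hUd hW hb hWU hWf (hl u hu)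
    refine h1.trans ((sum_liminf_le_liminf_sum l _).trans ?_)
    have hev : ∀ᶠ n : ℕ in atTop, ∀ i, ∀ k < n, ∃ w : Eu 2, ‖w‖ = 1 ∧
        ∀ q ∈ γ i '' Ico ((k : ℝ) / n) ((k + 1) / n),
        ∀ q' ∈ γ i '' Ico ((k : ℝ) / n) ((k + 1) / n),
        ∀ u, |cross u (q - q')| ≤ (|cross u w| + ε * ‖u‖) * ‖q - q'‖ := by
      rw [eventually_all]
      exact fun i => (hγ i).eventually_abs_cross_sub_le hε
    refine liminf_le_of_frequently_le' (Eventually.frequently ?_)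
    filter_upwards [hev] with n hn
    have hpiece : ∀ x ∈ (Finset.univ ×ˢ Finset.range n : Finset (Fin N × ℕ)),
        (l.map fun u => volume (cross u '' arcPiece (γ x.1) (frontier U) n x.2)).sum ≤
          ENNReal.ofReal (M + ε * D) * μH[1] (arcPiece (γ x.1) (frontier U) n x.2) := by
      rintro ⟨i, k⟩ hx
      obtain ⟨w, hw, hsec⟩ := hn i k (by simpa using hx)
      have h2 : ∀ l' : List (Eu 2),
          (l'.map fun u => volume (cross u '' arcPiece (γ i) (frontier U) n k)).sum ≤
          ENNReal.ofReal ((l'.map fun u => |cross u w|).sum + ε * (l'.map fun u => ‖u‖).sum) *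
            μH[1] (arcPiece (γ i) (frontier U) n k) := by
        intro l'
        induction l' with
        | nil => simp
        | cons u l' ih =>
          have h3 := volume_cross_image_le (A := arcPiece (γ i) (frontier U) n k) (u := u)
            (C := |cross u w| + ε * ‖u‖) (by positivity)
            fun q hq q' hq' => hsec q hq.2 q' hq'.2 u
          simp only [List.map_cons, List.sum_cons]
          refine (add_le_add h3 ih).trans_eq ?_
          rw [← add_mul, ← ENNReal.ofReal_add (by positivity)]
          · congr 2
            ring
          · refine add_nonneg (List.sum_nonneg ?_) (mul_nonneg hε.le (List.sum_nonneg ?_))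
            · simp only [List.mem_map]
              rintro _ ⟨_, -, rfl⟩
              exact abs_nonneg _
            · simp only [List.mem_map]
              rintro _ ⟨_, -, rfl⟩
              exact norm_nonneg _
      refine (h2 l).trans ?_
      gcongr
      exact hM w hw
    calc _ = ∑ x ∈ Finset.univ ×ˢ Finset.range n,
          (l.map fun u => volume (cross u '' arcPiece (γ x.1) (frontier U) n x.2)).sum := by
          clear hpiece h1 hM hD hl
          induction l with
          | nil => simp
          | cons u l ih => simp only [List.map_cons, List.sum_cons, Finset.sum_add_distrib, ih]
      _ ≤ ∑ x ∈ Finset.univ ×ˢ Finset.range n, ENNReal.ofReal (M + ε * D) *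
          μH[1] (arcPiece (γ x.1) (frontier U) n x.2) := Finset.sum_le_sum hpiece
      _ = ENNReal.ofReal (M + ε * D) * ∑ x ∈ Finset.univ ×ˢ Finset.range n,
          μH[1] (arcPiece (γ x.1) (frontier U) n x.2) := by rw [Finset.mul_sum]
      _ ≤ _ := by
        gcongr
        rw [← measure_biUnion_finset (pairwiseDisjoint_arcPiece hγ hd _ n) fun x hx =>
          measurableSet_arcPiece (hγ x.1) isClosed_frontier.measurableSet (by simpa using hx)]
        exact measure_mono (iUnion₂_subset fun x _ => inter_subset_left)
  have hlim : Tendsto (fun ε : ℝ => ENNReal.ofReal (M + ε * D) * μH[1] (frontier U)) (𝓝[>] 0)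
      (𝓝 (ENNReal.ofReal M * μH[1] (frontier U))) := by
    refine ENNReal.Tendsto.mul_const ?_ (Or.inr hfin.ne)
    have : Continuous fun ε : ℝ => ENNReal.ofReal (M + ε * D) :=
      ENNReal.continuous_ofReal.comp (by fun_prop)
    have h := (this.tendsto 0).mono_left (nhdsWithin_le_nhds (s := Ioi 0))
    simpa using h
  exact ge_of_tendsto hlim (eventually_nhdsWithin_of_forall key)

lemma convex_zonotope (l : List (Eu 2)) : Convex ℝ (zonotope l) := by
  induction l with
  | nil => exact convex_singleton 0
  | cons u l ih =>
    have h : Convex ℝ (unitSegment u) := by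
      have := (convex_Icc (0 : ℝ) 1).linear_image (LinearMap.toSpanSingleton ℝ (Eu 2) u)
      exact this
    exact h.add ih

lemma isCompact_zonotope (l : List (Eu 2)) : IsCompact (zonotope l) := by
  induction l with
  | nil => exact isCompact_singleton
  | cons u l ih => exact (isCompact_unitSegment u).add ih

lemma cross_zero_right (v : Eu 2) : cross v 0 = 0 := by simp [cross]

/-- The centre of a zonotope. -/
def zonotopeCenter (l : List (Eu 2)) : Eu 2 := (1 / 2 : ℝ) • l.sum

lemma abs_cross_sub_zonotopeCenter_le (w : Eu 2) (l : List (Eu 2)) {z : Eu 2}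
    (hz : z ∈ zonotope l) :
    |cross w (z - zonotopeCenter l)| ≤ 1 / 2 * (l.map fun u => |cross w u|).sum := by
  induction l generalizing z with
  | nil =>
    have : z = 0 := hz
    simp [this, zonotopeCenter, cross_zero_right]
  | cons u l ih =>
    obtain ⟨_, ⟨σ, hσ, rfl⟩, z', hz', rfl⟩ := hz
    have h1 : σ • u + z' - zonotopeCenter (u :: l) =
        (σ - 1 / 2) • u + (z' - zonotopeCenter l) := by
      simp only [zonotopeCenter, List.sum_cons]
      module
    simp only
    rw [h1, cross_add_right, cross_smul_right, List.map_cons, List.sum_cons, mul_add]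
    refine (abs_add_le _ _).trans (add_le_add ?_ (ih hz'))
    rw [abs_mul]
    gcongr
    rw [abs_le]
    constructor <;> linarith [hσ.1, hσ.2]

lemma exists_cross_sub_zonotopeCenter_eq (w : Eu 2) (l : List (Eu 2)) :
    ∃ z ∈ zonotope l,
      cross w (z - zonotopeCenter l) = 1 / 2 * (l.map fun u => |cross w u|).sum := by
  induction l with
  | nil => exact ⟨0, mem_singleton 0, by simp [zonotopeCenter, cross_zero_right]⟩
  | cons u l ih =>
    obtain ⟨z, hz, h⟩ := ih
    have key : ∀ σ : ℝ, σ ∈ Icc (0 : ℝ) 1 → (σ - 1 / 2) * cross w u = 1 / 2 * |cross w u| →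
        ∃ z ∈ zonotope (u :: l), cross w (z - zonotopeCenter (u :: l)) =
          1 / 2 * ((u :: l).map fun u => |cross w u|).sum := by
      intro σ hσ he
      refine ⟨σ • u + z, ⟨_, ⟨σ, hσ, rfl⟩, z, hz, rfl⟩, ?_⟩
      have h1 : σ • u + z - zonotopeCenter (u :: l) =
          (σ - 1 / 2) • u + (z - zonotopeCenter l) := by
        simp only [zonotopeCenter, List.sum_cons]
        module
      rw [h1, cross_add_right, cross_smul_right, h, he, List.map_cons, List.sum_cons, mul_add]
    rcases le_total 0 (cross w u) with h0 | h0
    · exact key 1 (by simp) (by rw [abs_of_nonneg h0]; ring)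
    · exact key 0 (by simp) (by rw [abs_of_nonpos h0]; ring)

lemma exists_cross_eq_norm (x : Eu 2) : ∃ w : Eu 2, ‖w‖ ≤ 1 ∧ cross w x = ‖x‖ := by
  by_cases hx : x = 0
  · exact ⟨0, by simp, by simp [hx, cross]⟩
  have h0 : ‖x‖ ≠ 0 := norm_ne_zero_iff.2 hx
  have h1 := norm_sq_eq_two x
  refine ⟨‖x‖⁻¹ • !₂[x 1, -x 0], le_of_eq ?_, ?_⟩
  · have h2 : ‖(!₂[x 1, -x 0] : Eu 2)‖ = ‖x‖ := by
      refine (sq_eq_sq₀ (norm_nonneg _) (norm_nonneg _)).1 ?_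
      rw [h1, norm_sq_eq_two]
      simp
      ring
    rw [norm_smul, h2, norm_inv, norm_norm, inv_mul_cancel₀ h0]
  · rw [cross_smul_left, inv_mul_eq_iff_eq_mul₀ h0, ← sq, h1]
    simp [cross]
    ring

lemma zonotope_subset_closedBall {l : List (Eu 2)} {ρ : ℝ} (hρ : 0 ≤ ρ)
    (h : ∀ w, (l.map fun u => |cross w u|).sum ≤ 2 * ρ * ‖w‖) :
    zonotope l ⊆ closedBall (zonotopeCenter l) ρ := by
  intro z hz
  rw [mem_closedBall, dist_eq_norm]
  obtain ⟨w, hw, hw'⟩ := exists_cross_eq_norm (z - zonotopeCenter l)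
  have h1 := (le_abs_self _).trans (abs_cross_sub_zonotopeCenter_le w l hz)
  have h2 := h w
  have h3 : ρ * ‖w‖ ≤ ρ * 1 := by gcongr
  linarith

lemma closedBall_subset_zonotope {l : List (Eu 2)} {ρ : ℝ}
    (h : ∀ w, 2 * ρ * ‖w‖ ≤ (l.map fun u => |cross w u|).sum) :
    closedBall (zonotopeCenter l) ρ ⊆ zonotope l := by
  intro p hp
  by_contra hpz
  rw [mem_closedBall, dist_eq_norm] at hp
  obtain ⟨f, c, hf1, hf2⟩ := geometric_hahn_banach_closed_point (convex_zonotope l)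
    (isCompact_zonotope l).isClosed hpz
  set w : Eu 2 := !₂[f (EuclideanSpace.single 1 1), -f (EuclideanSpace.single 0 1)] with hw
  have hfw : ∀ x, f x = cross w x := by
    intro x
    have hx : x = x 0 • EuclideanSpace.single 0 1 + x 1 • EuclideanSpace.single 1 1 := by
      ext i
      fin_cases i <;> simp
    conv_lhs => rw [hx]
    simp [hw, cross]
    ring
  obtain ⟨z, hz, hze⟩ := exists_cross_sub_zonotopeCenter_eq w l
  have h1 := (hf1 z hz).trans hf2
  rw [hfw, hfw] at h1
  rw [cross_sub_right] at hze
  have h2 : cross w (p - zonotopeCenter l) ≤ ρ * ‖w‖ :=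
    (le_abs_self _).trans ((abs_cross_le _ _).trans (by
      rw [mul_comm]; gcongr))
  rw [cross_sub_right] at h2
  linarith [h w]

lemma two_mul_pairCrossSum (l : List (Eu 2)) :
    2 * pairCrossSum l = (l.map fun v => (l.map fun u => |cross v u|).sum).sum := by
  induction l with
  | nil => simp [pairCrossSum]
  | cons a l ih =>
    simp only [pairCrossSum, List.map_cons, List.sum_cons, planeCross_self, abs_zero, zero_add,
      List.sum_map_add]
    rw [mul_add, ih]
    have h : (l.map fun v => |cross a v|) = l.map fun v => |cross v a| :=
      List.map_congr_left fun v _ => by rw [cross_comm, abs_neg]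
    rw [h]
    ring

lemma mul_sum_norm_le_pairCrossSum {l : List (Eu 2)} {ρ : ℝ}
    (h : ∀ w, 2 * ρ * ‖w‖ ≤ (l.map fun u => |cross w u|).sum) :
    ρ * (l.map fun u => ‖u‖).sum ≤ pairCrossSum l := by
  have h1 : (l.map fun v => 2 * ρ * ‖v‖).sum ≤ 2 * pairCrossSum l := by
    rw [two_mul_pairCrossSum]
    exact List.sum_le_sum fun v _ => h v
  rw [List.sum_map_mul_left] at h1
  linarith

lemma integral_abs_sin_sub (α : ℝ) : ∫ x in (0 : ℝ)..π, |sin (x - α)| = 2 := by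
  have hper : Function.Periodic (fun x => |sin x|) π := fun x => by
    simp only [sin_add_pi, abs_neg]
  rw [intervalIntegral.integral_comp_sub_right (fun x => |sin x|) α]
  have h1 := hper.intervalIntegral_add_eq (-α) 0
  rw [show 0 - α = -α by ring, show π - α = -α + π by ring, h1, zero_add]
  rw [intervalIntegral.integral_congr (g := sin) fun x hx => ?_, integral_sin]
  · simp; norm_num
  · rw [uIcc_of_le pi_pos.le] at hx
    exact abs_of_nonneg (sin_nonneg_of_mem_Icc hx)

lemma abs_sum_abs_sin_sub_two_le {m : ℕ} (hm : 0 < m) (α : ℝ) :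
    |∑ j ∈ Finset.range m, π / m * |sin (π * j / m - α)| - 2| ≤ π ^ 2 / m := by
  have hm0 : (0 : ℝ) < m := by exact_mod_cast hm
  set a : ℕ → ℝ := fun j => π * j / m with ha
  have hstep : ∀ j, a (j + 1) = a j + π / m := fun j => by simp only [ha]; push_cast; ring
  have hint : ∀ b c : ℝ, IntervalIntegrable (fun x => |sin (x - α)|) volume b c := fun b c =>
    (by fun_prop : Continuous fun x => |sin (x - α)|).intervalIntegrable b c
  have h1 := intervalIntegral.sum_integral_adjacent_intervals (a := a) (n := m)
    fun k _ => hint (a k) (a (k + 1))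
  have h2 : a m = π := by simp only [ha]; field_simp
  have h3 : a 0 = 0 := by simp [ha]
  rw [h2, h3, integral_abs_sin_sub] at h1
  rw [← h1, ← Finset.sum_sub_distrib]
  have hpm : 0 < π / m := by positivity
  have h4 : ∀ j ∈ Finset.range m, |π / m * |sin (π * j / m - α)| -
      (∫ x in a j..a (j + 1), |sin (x - α)|)| ≤ (π / m) ^ 2 := by
    intro j _
    have h5 : π / m * |sin (π * j / m - α)| = ∫ _ in a j..a (j + 1), |sin (a j - α)| := by
      rw [intervalIntegral.integral_const, hstep, add_sub_cancel_left, smul_eq_mul]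
    rw [h5, ← intervalIntegral.integral_sub intervalIntegrable_const (hint _ _),
      ← Real.norm_eq_abs]
    refine (intervalIntegral.norm_integral_le_of_norm_le_const (C := π / m) ?_).trans_eq ?_
    · intro x hx
      rw [uIoc_of_le (by rw [hstep]; linarith), hstep] at hx
      rw [Real.norm_eq_abs]
      refine (abs_abs_sub_abs_le_abs_sub _ _).trans ?_
      have h6 := Real.abs_sin_sub_sin_le (a j - α) (x - α)
      refine h6.trans ?_
      rw [abs_le]
      constructor <;> linarith [hx.1, hx.2]
    · rw [hstep, add_sub_cancel_left, abs_of_pos hpm, sq]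
  refine (Finset.abs_sum_le_sum_abs _ _).trans ((Finset.sum_le_sum h4).trans_eq ?_)
  rw [Finset.sum_const, Finset.card_range, nsmul_eq_mul]
  field_simp

lemma exists_eq_norm_smul_cos_sin (w : Eu 2) :
    ∃ α, w 0 = ‖w‖ * cos α ∧ w 1 = ‖w‖ * sin α := by
  have h : ‖(⟨w 0, w 1⟩ : ℂ)‖ = ‖w‖ := by
    refine (sq_eq_sq₀ (norm_nonneg _) (norm_nonneg _)).1 ?_
    rw [norm_sq_eq_two, Complex.sq_norm, Complex.normSq_mk]
    ring
  refine ⟨Complex.arg ⟨w 0, w 1⟩, ?_, ?_⟩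
  · rw [← h, Complex.norm_mul_cos_arg]
  · rw [← h, Complex.norm_mul_sin_arg]

lemma sum_map_range (m : ℕ) (f : ℕ → ℝ) :
    ((List.range m).map f).sum = ∑ j ∈ Finset.range m, f j := by
  induction m with
  | zero => simp
  | succ m ih => rw [List.range_succ, Finset.sum_range_succ, List.map_append, List.sum_append, ih]
                 simp

/-- Zonotopes approximating a disc. -/
theorem exists_list_cross_sum_near {s ε : ℝ} (hs : 0 < s) (hε : 0 < ε) :
    ∃ l : List (Eu 2), (l.Pairwise fun u v => cross v u ≠ 0) ∧ (∀ u ∈ l, u ≠ 0) ∧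
      (l.map fun u => ‖u‖).sum = π * s ∧
      ∀ w, 2 * (s * (1 - ε)) * ‖w‖ ≤ (l.map fun u => |cross w u|).sum ∧
        (l.map fun u => |cross w u|).sum ≤ 2 * (s * (1 + ε)) * ‖w‖ := by
  obtain ⟨m, hm⟩ := exists_nat_gt (π ^ 2 / (2 * ε))
  have hm0 : (0 : ℝ) < m := lt_of_le_of_lt (by positivity) hm
  have hmpos : 0 < m := by exact_mod_cast hm0
  have hmε : π ^ 2 / m ≤ 2 * ε := by
    rw [div_lt_iff₀ (by positivity)] at hm
    rw [div_le_iff₀ hm0]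
    linarith
  set e : ℕ → Eu 2 := fun j => (π * s / m) • !₂[cos (π * j / m), sin (π * j / m)] with he
  have hpos : 0 < π * s / m := by positivity
  have hnorm : ∀ j, ‖e j‖ = π * s / m := fun j => by
    have h1 : ‖(!₂[cos (π * j / m), sin (π * j / m)] : Eu 2)‖ = 1 := by
      refine (sq_eq_sq₀ (norm_nonneg _) zero_le_one).1 ?_
      rw [norm_sq_eq_two]
      simp
    rw [he]
    simp only
    rw [norm_smul, h1, mul_one, Real.norm_eq_abs, abs_of_pos hpos]
  have hsum : ∀ w, ∃ α, ((List.range m).map fun j => |cross w (e j)|).sum =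
      s * ‖w‖ * ∑ j ∈ Finset.range m, π / m * |sin (π * j / m - α)| := by
    intro w
    obtain ⟨α, h0, h1⟩ := exists_eq_norm_smul_cos_sin w
    refine ⟨α, ?_⟩
    rw [sum_map_range, Finset.mul_sum]
    refine Finset.sum_congr rfl fun j _ => ?_
    have h2 : cross w (e j) = ‖w‖ * (π * s / m) * sin (π * j / m - α) := by
      rw [he, cross_smul_right, sin_sub, cross, h0, h1]
      simp
      ring
    rw [h2, abs_mul, abs_of_nonneg (by positivity)]
    ring
  refine ⟨(List.range m).map e, ?_, ?_, ?_, ?_⟩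
  · rw [List.pairwise_map]
    refine (List.pairwise_lt_range (n := m)).imp_of_mem ?_
    intro i j hi hj hij
    rw [List.mem_range] at hi hj
    have h1 : cross (e j) (e i) = (π * s / m) ^ 2 * sin (π * i / m - π * j / m) := by
      rw [he, cross_smul_right, cross_smul_left, sin_sub]
      simp [cross]
      ring
    rw [h1]
    refine mul_ne_zero (by positivity) (ne_of_lt (sin_neg_of_neg_of_neg_pi_lt ?_ ?_))
    · rw [sub_neg]
      gcongr
    · have h2 : π * j / m < π := by
        rw [div_lt_iff₀ hm0]
        gcongr
      have h3 : 0 ≤ π * i / m := by positivity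
      linarith
  · simp only [List.mem_map]
    rintro _ ⟨j, -, rfl⟩ h
    have := hnorm j
    rw [h, norm_zero] at this
    exact hpos.ne this
  · rw [List.map_map, sum_map_range]
    simp only [Function.comp_def, hnorm]
    rw [Finset.sum_const, Finset.card_range, nsmul_eq_mul]
    field_simp
  · intro w
    obtain ⟨α, h⟩ := hsum w
    rw [List.map_map]
    simp only [Function.comp_def]
    rw [h]
    have h1 := abs_le.1 ((abs_sum_abs_sin_sub_two_le hmpos α).trans hmε)
    set X := ∑ j ∈ Finset.range m, π / m * |sin (π * j / m - α)|
    have h2 : 0 ≤ s * ‖w‖ := by positivity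
    constructor
    · have := mul_le_mul_of_nonneg_left (show 2 * (1 - ε) ≤ X by linarith [h1.1]) h2
      linarith
    · have := mul_le_mul_of_nonneg_left (show X ≤ 2 * (1 + ε) by linarith [h1.2]) h2
      linarith

lemma le_infDist_of_closedBall_subset {W Γ : Set (Eu 2)} (hd : Disjoint W Γ) (hΓ : Γ.Nonempty)
    {x : Eu 2} {r : ℝ} (h : closedBall x r ⊆ W) : r ≤ infDist x Γ := by
  rw [le_infDist hΓ]
  intro y hy
  by_contra! hlt
  exact hd.le_bot ⟨h (mem_closedBall'.2 hlt.le), hy⟩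

lemma closedBall_subset_innerRegion {Ω : Set (Eu 2)} {c : Eu 2} {r : ℝ} (hr : 0 ≤ r)
    (hc : c ∈ innerRegion Ω) (h : r < infDist c (outerBoundary Ω)) :
    closedBall c r ⊆ innerRegion Ω := by
  refine subset_of_disjoint_frontier (isOpen_innerRegion Ω)
    (convex_closedBall c r).isPreconnected ?_ ⟨c, mem_closedBall_self hr, hc⟩
  refine Set.disjoint_left.2 fun y hy hyf => ?_
  have h1 := infDist_le_dist_of_mem (x := c) (frontier_innerRegion_subset Ω hyf)
  have h2 := mem_closedBall'.1 hy
  linarith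

lemma outerBoundary_nonempty_of_innerRadius_pos {Ω : Set (Eu 2)} (h : 0 < innerRadius Ω) :
    (outerBoundary Ω).Nonempty := by
  by_contra! hΓ
  have h0 : innerRadius Ω ≤ 0 := by
    refine Real.sSup_le ?_ le_rfl
    rintro _ ⟨x, -, rfl⟩
    simp [hΓ]
  linarith

lemma exists_closedBall_subset_innerRegion {Ω : Set (Eu 2)} {r : ℝ} (hr : 0 ≤ r)
    (h : r < innerRadius Ω) : ∃ c, closedBall c r ⊆ innerRegion Ω := by
  have hne : ((fun x => infDist x (outerBoundary Ω)) '' innerRegion Ω).Nonempty := by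
    by_contra! he
    rw [innerRadius, he, Real.sSup_empty] at h
    linarith
  obtain ⟨_, ⟨c, hc, rfl⟩, hlt⟩ := exists_lt_of_lt_csSup hne h
  exact ⟨c, closedBall_subset_innerRegion hr hc hlt⟩

lemma volume_innerRegion_add_le {Ω : Set (Eu 2)} (hΩ : IsC2Domain Ω) {s ε : ℝ} (hs : 0 < s)
    (hε : 0 < ε) (hε1 : ε < 1) (h : s * (1 + ε) < innerRadius Ω) :
    volume (innerRegion Ω) + ENNReal.ofReal (π * s ^ 2 * (1 - ε)) ≤
      volume {x ∈ innerRegion Ω | s * (1 - ε) ≤ infDist x (outerBoundary Ω)} +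
        ENNReal.ofReal (s * (1 + ε)) * μH[1] (outerBoundary Ω) := by
  obtain ⟨hopen, -, hb, N, γ, hγ, hdisj, hfr⟩ := hΩ
  have hsε : 0 ≤ s * (1 + ε) := by positivity
  have hΓ : (outerBoundary Ω).Nonempty :=
    outerBoundary_nonempty_of_innerRadius_pos (hsε.trans_lt h)
  obtain ⟨l, hl, h0, hlen, hsum⟩ := exists_list_cross_sum_near hs hε
  obtain ⟨c, hc⟩ := exists_closedBall_subset_innerRegion hsε h
  have hcomm : ∀ u w : Eu 2, |cross u w| = |cross w u| := fun u w => by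
    rw [cross_comm w u, abs_neg]
  have hZ := zonotope_subset_closedBall (l := l) hsε fun w => (hsum w).2
  have hZ' := closedBall_subset_zonotope (l := l) fun w => (hsum w).1
  have hpair := mul_sum_norm_le_pairCrossSum (l := l) fun w => (hsum w).1
  rw [hlen] at hpair
  have hne : (erosion (innerRegion Ω) (zonotope l)).Nonempty := by
    refine ⟨c - zonotopeCenter l, fun z hz => hc ?_⟩
    have := hZ hz
    rw [mem_closedBall, dist_eq_norm] at this ⊢
    rwa [show c - zonotopeCenter l + z - c = z - zonotopeCenter l by abel]
  have hmain := volume_add_pairCrossSum_le l hl h0 (isOpen_innerRegion Ω) (isBounded_innerRegion hb)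
    (isPreconnected_compl_innerRegion hb) hne
  have hslice : (l.map (sliceCount (innerRegion Ω))).sum ≤
      ENNReal.ofReal (s * (1 + ε)) * μH[1] (outerBoundary Ω) := by
    obtain ⟨r, -, -, hUo, -⟩ := exists_compl_closedBall_subset_unboundedPart hb
    have h2 := two_mul_sum_sliceCount_le hγ hdisj hUo
      (by rw [← hfr]; exact outerBoundary_subset_frontier hopen hb)
      (by rw [← hfr]
          exact (disjoint_unboundedPart_closure Ω).mono_right frontier_subset_closure)
      (isOpen_innerRegion Ω) (isBounded_innerRegion hb)
      (Set.disjoint_left.2 fun x hx hxU => hx (subset_closure hxU))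
      (frontier_innerRegion_subset Ω) l h0 (M := 2 * (s * (1 + ε)))
      (fun w hw => by
        have := (hsum w).2
        rw [hw, mul_one] at this
        simpa only [hcomm] using this)
    rw [ENNReal.ofReal_mul two_pos.le, ENNReal.ofReal_ofNat, mul_assoc] at h2
    exact (ENNReal.mul_le_mul_iff_right two_ne_zero ENNReal.ofNat_ne_top).1 h2
  have herosion : volume (erosion (innerRegion Ω) (zonotope l)) ≤
      volume {x ∈ innerRegion Ω | s * (1 - ε) ≤ infDist x (outerBoundary Ω)} := by
    rw [← measure_preimage_add_right volume (zonotopeCenter l)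
      {x ∈ innerRegion Ω | s * (1 - ε) ≤ infDist x (outerBoundary Ω)}]
    refine measure_mono fun x hx => ?_
    have hball : closedBall (x + zonotopeCenter l) (s * (1 - ε)) ⊆ innerRegion Ω := by
      intro y hy
      have hy' : y - x ∈ zonotope l := hZ' (by
        rw [mem_closedBall, dist_eq_norm] at hy ⊢
        rwa [show y - x - zonotopeCenter l = y - (x + zonotopeCenter l) by abel])
      simpa using hx _ hy'
    have hpos : 0 ≤ s * (1 - ε) := mul_nonneg hs.le (by linarith)
    exact ⟨hball (mem_closedBall_self hpos),
      le_infDist_of_closedBall_subset (disjoint_innerRegion_outerBoundary Ω) hΓ hball⟩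
  refine le_trans ?_ (hmain.trans (add_le_add herosion hslice))
  gcongr
  calc π * s ^ 2 * (1 - ε) = s * (1 - ε) * (π * s) := by ring
    _ ≤ _ := hpair

lemma areaFn_add_le {Ω : Set (Eu 2)} (hΩ : IsC2Domain Ω) {s ε : ℝ} (hs : 0 < s)
    (hε : 0 < ε) (hε1 : ε < 1) (h : s * (1 + ε) < innerRadius Ω) :
    areaFn Ω (s * (1 - ε)) + π * s ^ 2 * (1 - ε) ≤ s * (1 + ε) * outerPerim Ω := by
  have hmain := volume_innerRegion_add_le hΩ hs hε hε1 h
  obtain ⟨hopen, -, hb, N, γ, hγ, -, hfr⟩ := hΩ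
  have hH : μH[1] (outerBoundary Ω) < ⊤ := hausdorffMeasure_lt_top_of_subset hγ
    (by rw [← hfr]; exact outerBoundary_subset_frontier hopen hb)
  have hW : volume (innerRegion Ω) < ⊤ := (isBounded_innerRegion hb).measure_lt_top
  set S := {x ∈ innerRegion Ω | s * (1 - ε) ≤ infDist x (outerBoundary Ω)} with hS
  set T := {x ∈ innerRegion Ω | infDist x (outerBoundary Ω) < s * (1 - ε)} with hT
  have hTm : MeasurableSet T := (isOpen_innerRegion Ω).measurableSet.inter
    (measurableSet_lt (continuous_infDist_pt _).measurable measurable_const)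
  have hunion : innerRegion Ω = S ∪ T := by
    ext x
    simp only [hS, hT, Set.mem_union, Set.mem_ofPred_eq, ← and_or_left, le_or_gt, and_true]
  have hdisj : Disjoint S T := Set.disjoint_left.2 fun x hx hx' => hx.2.not_gt hx'.2
  have hSfin : volume S ≠ ⊤ := ((measure_mono (hunion ▸ subset_union_left)).trans_lt hW).ne
  have hTfin : volume T ≠ ⊤ := ((measure_mono (hunion ▸ subset_union_right)).trans_lt hW).ne
  rw [hunion, measure_union hdisj hTm, add_assoc, ENNReal.add_le_add_iff_left hSfin] at hmain
  have hr := ENNReal.toReal_mono (ENNReal.mul_ne_top ENNReal.ofReal_ne_top hH.ne) hmain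
  rw [ENNReal.toReal_add hTfin ENNReal.ofReal_ne_top, ENNReal.toReal_mul,
    ENNReal.toReal_ofReal (by have : 0 ≤ 1 - ε := by linarith
                              positivity), ENNReal.toReal_ofReal (by positivity)] at hr
  refine le_trans ?_ hr
  gcongr
  exact ENNReal.toReal_mono hTfin
    (measure_mono fun x hx => ⟨subset_innerRegion hopen hx.1, hx.2⟩)

lemma tendsto_areaFn {Ω : Set (Eu 2)} (hb : Bornology.IsBounded Ω) {t : ℝ} {a : ℕ → ℝ}
    (ha : Monotone a) (hat : ∀ n, a n < t) (hlim : Tendsto a atTop (𝓝 t)) :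
    Tendsto (fun n => areaFn Ω (a n)) atTop (𝓝 (areaFn Ω t)) := by
  have hunion : {x ∈ Ω | infDist x (outerBoundary Ω) < t} =
      ⋃ n, {x ∈ Ω | infDist x (outerBoundary Ω) < a n} := by
    ext x
    simp only [Set.mem_iUnion, Set.mem_ofPred_eq]
    constructor
    · rintro ⟨hx, hlt⟩
      obtain ⟨n, hn⟩ := (hlim.eventually_const_lt hlt).exists
      exact ⟨n, hx, hn⟩
    · rintro ⟨n, hx, hlt⟩
      exact ⟨hx, hlt.trans (hat n)⟩
  have hfin : volume {x ∈ Ω | infDist x (outerBoundary Ω) < t} ≠ ⊤ :=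
    ((measure_mono fun x hx => hx.1).trans_lt hb.measure_lt_top).ne
  unfold areaFn
  refine (ENNReal.tendsto_toReal hfin).comp ?_
  rw [hunion]
  exact tendsto_measure_iUnion_atTop fun m n hmn x hx => ⟨hx.1, hx.2.trans_le (ha hmn)⟩

lemma areaFn_le_of_le_innerRadius {Ω : Set (Eu 2)} (hΩ : IsC2Domain Ω) {t : ℝ} (ht : 0 < t)
    (htR : t ≤ innerRadius Ω) : areaFn Ω t ≤ outerPerim Ω * t - π * t ^ 2 := by
  let ε : ℕ → ℝ := fun n => 1 / ((n : ℝ) + 2)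
  have hε0 : ∀ n, 0 < ε n := fun n => by positivity
  have hε1 : ∀ n, ε n < 1 := fun n => by
    rw [div_lt_one (by positivity)]
    linarith [(Nat.cast_nonneg n : (0 : ℝ) ≤ n)]
  have hεanti : Antitone ε := fun m n hmn => by
    have : (m : ℝ) ≤ n := by exact_mod_cast hmn
    exact one_div_le_one_div_of_le (by positivity) (by linarith)
  have hεlim : Tendsto ε atTop (𝓝 0) := by
    have := (tendsto_one_div_add_atTop_nhds_zero_nat (𝕜 := ℝ)).comp (tendsto_add_atTop_nat 1)
    refine this.congr fun n => ?_
    simp only [Function.comp_apply, ε]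
    push_cast
    ring_nf
  have hlim1 : Tendsto (fun n => 1 - ε n) atTop (𝓝 1) := by
    simpa using hεlim.const_sub 1
  have hlim2 : Tendsto (fun n => t * (1 - ε n)) atTop (𝓝 t) := by
    simpa using hlim1.const_mul t
  have hlim3 : Tendsto (fun n => t * (1 - ε n) * (1 + ε n)) atTop (𝓝 t) := by
    simpa using hlim2.mul (hεlim.const_add 1)
  have hlim4 : Tendsto (fun n => t * (1 - ε n) * (1 - ε n)) atTop (𝓝 t) := by
    simpa using hlim2.mul hlim1
  have harea := tendsto_areaFn (a := fun n => t * (1 - ε n) * (1 - ε n)) hΩ.2.2.1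
    (fun m n hmn => by
      have h1 := hεanti hmn
      have h2 := hε1 m
      have h3 := hε1 n
      have h4 : (1 - ε m) * (1 - ε m) ≤ (1 - ε n) * (1 - ε n) :=
        mul_self_le_mul_self (by linarith) (by linarith)
      simp only [mul_assoc]
      exact mul_le_mul_of_nonneg_left h4 ht.le)
    (fun n => by
      have := mul_lt_one_of_nonneg_of_lt_one_left (a := 1 - ε n) (b := 1 - ε n)
        (by linarith [hε1 n]) (by linarith [hε0 n]) (by linarith [hε0 n])
      simpa only [mul_assoc, mul_one] using mul_lt_mul_of_pos_left this ht)
    hlim4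
  have hleft := harea.add (((hlim2.pow 2).const_mul π).mul hlim1)
  have hle := le_of_tendsto_of_tendsto' hleft (hlim3.mul_const (outerPerim Ω)) fun n =>
    areaFn_add_le hΩ (mul_pos ht (by linarith [hε1 n])) (hε0 n) (hε1 n) (by
      have : t * (1 - ε n) * (1 + ε n) = t - t * ε n ^ 2 := by ring
      have h5 : 0 < t * ε n ^ 2 := mul_pos ht (pow_pos (hε0 n) 2)
      linarith)
  linarith

end

theorem area_function_upper_bound
    (Ω : Set (Eu 2)) (hΩ : IsC2Domain Ω) :
    ∀ t ∈ Set.Icc 0 (innerRadius Ω),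
      areaFn Ω t ≤ outerPerim Ω * t - π * t ^ 2 := by
  rintro t ⟨ht0, htR⟩
  obtain rfl | ht := ht0.eq_or_lt
  · have hempty : {x ∈ Ω | infDist x (outerBoundary Ω) < 0} = ∅ :=
      Set.eq_empty_of_forall_notMem fun x hx => infDist_nonneg.not_gt hx.2
    simp [areaFn, hempty]
  exact areaFn_le_of_le_innerRadius hΩ ht htR

end
end
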